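/- arXiv:q-alg/9504002 — 10 statements merged into one kernel-verified Lean document; each statement's English description precedes it below -/
import Mathlib

section
/- Let b be a quadratic bracket on the polynomial ring k[x₁,…,xₙ], i.e. a skew-symmetric biderivation determined by homogeneous quadratic polynomials y_{ij} = b(x_i,x_j) (with y_{ji} = −y_{ij}), and let P(b) be the n×n matrix over k with entries p_{ij} = ∂/∂x_j(Σ_k ∂y_{ik}/∂x_k). For an invertible matrix A ∈ GL(n,k), let φ_A be the algebra automorphism of k[x₁,…,xₙ] with φ_A(x_i) = Σ_j A_{ij} x_j, and let b^A be the quadratic bracket with b^A(f,g) = φ_A^{-1}(b(φ_A f, φ_A g)). Then P(b^A) = A · P(b) · A^{-1}. -/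
open MvPolynomial

/-- The quadratic bracket on `k[x₁,…,xₙ]` determined by the family `y i j = b(xᵢ, xⱼ)`:
`b(f,g) = ∑ i j, y i j * (∂f/∂xᵢ) * (∂g/∂xⱼ)`. -/
noncomputable def qBracket {k : Type*} [CommRing k] {n : ℕ}
    (y : Fin n → Fin n → MvPolynomial (Fin n) k)
    (f g : MvPolynomial (Fin n) k) : MvPolynomial (Fin n) k :=
  ∑ i, ∑ j, y i j * pderiv i f * pderiv j g

/-- The matrix `P(b)` with entries `p i j = ∂/∂xⱼ (∑ m ∂ y i m/∂ x m)`; since the divergences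
are linear forms, the entries are scalars, obtained as constant coefficients. -/
noncomputable def Pmat {k : Type*} [CommRing k] {n : ℕ}
    (y : Fin n → Fin n → MvPolynomial (Fin n) k) : Matrix (Fin n) (Fin n) k :=
  fun i j => constantCoeff (pderiv j (∑ m, pderiv m (y i m)))

/-- The algebra automorphism `φ_A` of `k[x₁,…,xₙ]` with `φ_A(xᵢ) = ∑ j A i j • xⱼ`. -/
noncomputable def linSubst {k : Type*} [CommRing k] {n : ℕ}
    (A : Matrix (Fin n) (Fin n) k) :
    MvPolynomial (Fin n) k →ₐ[k] MvPolynomial (Fin n) k :=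
  aeval fun i => ∑ j, C (A i j) * X j

theorem pderiv_linSubst_aux {k : Type*} [CommRing k] {n : ℕ}
    (B : Matrix (Fin n) (Fin n) k) (m : Fin n) (f : MvPolynomial (Fin n) k) :
    pderiv m (linSubst B f) = ∑ r, C (B r m) * linSubst B (pderiv r f) := by
  induction f using MvPolynomial.induction_on with
  | C a => simp [linSubst]
  | add p q hp hq => simp only [map_add, hp, hq, mul_add, Finset.sum_add_distrib]
  | mul_X p i hp =>
    have h1 : pderiv m (linSubst B (X i)) = C (B i m) := by
      simp [linSubst, pderiv_X, Pi.single_apply]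
    simp only [map_mul, Derivation.leibniz, hp, h1, map_add, smul_eq_mul, mul_add,
      Finset.sum_add_distrib, pderiv_X]
    congr 1
    · rw [Finset.sum_eq_single i]
      · simp [mul_comm]
      · intro b _ hb
        simp [Pi.single_apply, hb.symm]
      · simp
    · rw [Finset.mul_sum]
      exact Finset.sum_congr rfl fun _ _ => by ring

theorem cc_linSubst_aux {k : Type*} [CommRing k] {n : ℕ}
    (B : Matrix (Fin n) (Fin n) k) (f : MvPolynomial (Fin n) k) :
    constantCoeff (linSubst B f) = constantCoeff f := by
  induction f using MvPolynomial.induction_on with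
  | C a => simp [linSubst]
  | add p q hp hq => simp only [map_add, hp, hq]
  | mul_X p i hp => simp [hp, linSubst]

theorem qBracket_lin_aux {k : Type*} [CommRing k] {n : ℕ}
    (y : Fin n → Fin n → MvPolynomial (Fin n) k) (A : Matrix (Fin n) (Fin n) k) (i j : Fin n) :
    qBracket y (linSubst A (X i)) (linSubst A (X j)) =
      ∑ p, ∑ q, C (A i p) * C (A j q) * y p q := by
  have h1 : ∀ i m, pderiv m (linSubst A (X i)) = C (A i m) := by
    intro i m
    simp [linSubst, pderiv_X, Pi.single_apply]
  simp only [qBracket, h1]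
  exact Finset.sum_congr rfl fun _ _ => Finset.sum_congr rfl fun _ _ => by ring

theorem linSubst_C_aux {k : Type*} [CommRing k] {n : ℕ}
    (B : Matrix (Fin n) (Fin n) k) (a : k) : linSubst B (C a) = C a := by
  simp [linSubst]

theorem div_aux {k : Type*} [CommRing k] {n : ℕ}
    (y : Fin n → Fin n → MvPolynomial (Fin n) k) (A B : Matrix (Fin n) (Fin n) k)
    (h : B * A = 1) (i : Fin n) :
    ∑ m, pderiv m (linSubst B (qBracket y (linSubst A (X i)) (linSubst A (X m)))) =
      ∑ p, C (A i p) * linSubst B (∑ q, pderiv q (y p q)) := by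
  have hBA : ∀ r q, ∑ m, C (σ := Fin n) (B r m) * C (A m q) = if r = q then 1 else 0 := by
    intro r q
    have := congrFun (congrFun h r) q
    rw [Matrix.mul_apply, Matrix.one_apply] at this
    simp only [← C_mul, ← map_sum, this]
    split_ifs <;> simp
  simp only [qBracket_lin_aux, map_sum, map_mul, linSubst_C_aux, mul_assoc, pderiv_C_mul,
    pderiv_linSubst_aux, smul_eq_C_mul]
  rw [Finset.sum_comm]
  refine Finset.sum_congr rfl fun p _ => ?_
  rw [Finset.sum_comm, Finset.mul_sum]
  refine Finset.sum_congr rfl fun q _ => ?_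
  calc _ = ∑ r, C (A i p) * ((∑ m, C (B r m) * C (A m q)) * linSubst B (pderiv r (y p q))) := by
        simp only [Finset.mul_sum, Finset.sum_mul]
        rw [Finset.sum_comm]
        refine Finset.sum_congr rfl fun _ _ => Finset.sum_congr rfl fun _ _ => ?_
        ring
    _ = _ := by simp [hBA]

theorem Pmat_conj {k : Type*} [Field k] [CharZero k] {n : ℕ}
    (y : Fin n → Fin n → MvPolynomial (Fin n) k)
    (hhom : ∀ i j, (y i j).IsHomogeneous 2)
    (hskew : ∀ i j, y j i = - y i j)
    (A : Matrix (Fin n) (Fin n) k) (hA : IsUnit A.det) :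
    Pmat (fun i j => linSubst A⁻¹ (qBracket y (linSubst A (X i)) (linSubst A (X j)))) =
      A * Pmat y * A⁻¹ := by
  have h : A⁻¹ * A = 1 := Matrix.nonsing_inv_mul A hA
  ext i j
  simp only [Pmat]
  rw [div_aux y A A⁻¹ h i]
  simp only [Matrix.mul_apply, map_sum (pderiv j), pderiv_C_mul, pderiv_linSubst_aux,
    smul_eq_C_mul, map_sum constantCoeff, map_mul, constantCoeff_C, cc_linSubst_aux,
    Finset.mul_sum, Finset.sum_mul]
  rw [Finset.sum_comm]
  refine Finset.sum_congr rfl fun _ _ => Finset.sum_congr rfl fun _ _ => ?_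
  simp only [Pmat]
  ring
end

section
/- Let y₁₂, y₂₃, y₃₁ be homogeneous quadratic polynomials in k[x₁,x₂,x₃]; set y_{ji} = −y_{ij}, y_{ii} = 0, define the bracket b(f,g) = Σ_{i,j} y_{ij} (∂f/∂x_i)(∂g/∂x_j), and set v_i = Σ_k ∂y_{ik}/∂x_k. Then b satisfies the Jacobi identity b(b(f,g),h) + b(b(g,h),f) + b(b(h,f),g) = 0 for all f,g,h ∈ k[x₁,x₂,x₃] if and only if y₁₂·v₃ + y₂₃·v₁ + y₃₁·v₂ = 0 in k[x₁,x₂,x₃]. -/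
open MvPolynomial

theorem pd_comm_aux {k : Type*} [Field k] (i j : Fin 3) (f : MvPolynomial (Fin 3) k) :
    pderiv i (pderiv j f) = pderiv j (pderiv i f) := by
  have h : ⁅(pderiv i : Derivation k (MvPolynomial (Fin 3) k) (MvPolynomial (Fin 3) k)),
      (pderiv j : Derivation k (MvPolynomial (Fin 3) k) (MvPolynomial (Fin 3) k))⁆ = 0 := by
    apply MvPolynomial.derivation_ext
    intro m
    rw [Derivation.commutator_apply]
    simp only [pderiv_X, Pi.single_apply]
    split_ifs <;> simp
  have h2 := congrArg (fun D => D f) h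
  simp only [Derivation.commutator_apply, Derivation.zero_apply] at h2
  exact sub_eq_zero.mp h2

set_option maxHeartbeats 4000000 in
theorem jac_aux {k : Type*} [Field k]
    (y : Fin 3 → Fin 3 → MvPolynomial (Fin 3) k)
    (hskew : ∀ i j, y j i = - y i j)
    (hdiag : ∀ i, y i i = 0) (f g h : MvPolynomial (Fin 3) k) :
    qBracket y (qBracket y f g) h + qBracket y (qBracket y g h) f +
          qBracket y (qBracket y h f) g =
      (y 0 1 * (∑ m, pderiv m (y 2 m)) + y 1 2 * (∑ m, pderiv m (y 0 m)) +
        y 2 0 * (∑ m, pderiv m (y 1 m))) *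
      (pderiv 0 f * (pderiv 1 g * pderiv 2 h - pderiv 2 g * pderiv 1 h)
       - pderiv 1 f * (pderiv 0 g * pderiv 2 h - pderiv 2 g * pderiv 0 h)
       + pderiv 2 f * (pderiv 0 g * pderiv 1 h - pderiv 1 g * pderiv 0 h)) := by
  simp only [qBracket, Fin.sum_univ_three, hdiag, hskew 0 1, hskew 1 2, hskew 2 0,
    map_add, map_neg, map_zero, Derivation.leibniz, smul_eq_mul,
    pd_comm_aux 1 0, pd_comm_aux 2 0, pd_comm_aux 2 1]
  ring

theorem jacobi_iff {k : Type*} [Field k] [CharZero k]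
    (y : Fin 3 → Fin 3 → MvPolynomial (Fin 3) k)
    (hhom : ∀ i j, (y i j).IsHomogeneous 2)
    (hskew : ∀ i j, y j i = - y i j)
    (hdiag : ∀ i, y i i = 0) :
    (∀ f g h : MvPolynomial (Fin 3) k,
        qBracket y (qBracket y f g) h + qBracket y (qBracket y g h) f +
          qBracket y (qBracket y h f) g = 0) ↔
      y 0 1 * (∑ m, pderiv m (y 2 m)) + y 1 2 * (∑ m, pderiv m (y 0 m)) +
        y 2 0 * (∑ m, pderiv m (y 1 m)) = 0 := by
  constructor
  · intro H
    have h := H (X 0) (X 1) (X 2)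
    rw [jac_aux y hskew hdiag] at h
    simpa only [pderiv_X, Pi.single_apply, Fin.reduceEq, if_true, if_false, mul_one, mul_zero,
      sub_zero, add_zero, zero_mul] using h
  · intro H f g h
    rw [jac_aux y hskew hdiag, H, zero_mul]
end

section
/- Let y₁₂, y₂₃, y₃₁ be homogeneous quadratic polynomials in k[x₁,x₂,x₃], set y_{ji} = −y_{ij}, y_{ii} = 0, and v_i = Σ_k ∂y_{ik}/∂x_k. If v₁ = v₂ = v₃ = 0, then there exists a homogeneous cubic polynomial f ∈ k[x₁,x₂,x₃] such that y₁₂ = ∂f/∂x₃, y₂₃ = ∂f/∂x₁, and y₃₁ = ∂f/∂x₂. -/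
open MvPolynomial

theorem rank_zero_case {k : Type*} [Field k] [CharZero k]
    (y : Fin 3 → Fin 3 → MvPolynomial (Fin 3) k)
    (hhom : ∀ i j, (y i j).IsHomogeneous 2)
    (hskew : ∀ i j, y j i = - y i j)
    (hdiag : ∀ i, y i i = 0)
    (hv : ∀ i, ∑ m, pderiv m (y i m) = 0) :
    ∃ f : MvPolynomial (Fin 3) k, f.IsHomogeneous 3 ∧
      y 0 1 = pderiv 2 f ∧ y 1 2 = pderiv 0 f ∧ y 2 0 = pderiv 1 f := by
  have h0 := hv 0
  have h1 := hv 1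
  have h2 := hv 2
  have ec := (hhom 0 1).sum_X_mul_pderiv
  have ea := (hhom 1 2).sum_X_mul_pderiv
  have eb := (hhom 2 0).sum_X_mul_pderiv
  simp only [Fin.sum_univ_three, hdiag, hskew 2 0, hskew 0 1, hskew 1 2, map_neg, map_zero,
    nsmul_eq_mul, Nat.cast_ofNat] at h0 h1 h2 ea eb ec
  have h3 : (C (3⁻¹ : k) : MvPolynomial (Fin 3) k) * 3 = 1 := by
    have : (3 : MvPolynomial (Fin 3) k) = C 3 := (map_ofNat C 3).symm
    rw [this, ← C_mul, inv_mul_cancel₀ (by norm_num), C_1]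
  refine ⟨C (3⁻¹ : k) * (X 0 * y 1 2 + X 1 * y 2 0 + X 2 * y 0 1), ?_, ?_, ?_, ?_⟩
  · have hx : ∀ i a b, (X i * y a b).IsHomogeneous 3 := fun i a b => by
      simpa using (isHomogeneous_X k i).mul (hhom a b)
    simpa using (isHomogeneous_C (Fin 3) (3⁻¹ : k)).mul (((hx 0 1 2).add (hx 1 2 0)).add (hx 2 0 1))
  all_goals
    simp only [pderiv_C, map_add, pderiv_mul, pderiv_X_self,
      pderiv_X_of_ne (show (0 : Fin 3) ≠ 1 by decide), pderiv_X_of_ne (show (0 : Fin 3) ≠ 2 by decide),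
      pderiv_X_of_ne (show (1 : Fin 3) ≠ 0 by decide), pderiv_X_of_ne (show (1 : Fin 3) ≠ 2 by decide),
      pderiv_X_of_ne (show (2 : Fin 3) ≠ 0 by decide), pderiv_X_of_ne (show (2 : Fin 3) ≠ 1 by decide)]
  · linear_combination (-y 0 1) * h3 - C (3⁻¹ : k) * ec + C (3⁻¹ : k) * (X 1 * h0 - X 0 * h1)
  · linear_combination (-y 1 2) * h3 - C (3⁻¹ : k) * ea + C (3⁻¹ : k) * (X 2 * h1 - X 1 * h2)
  · linear_combination (-y 2 0) * h3 - C (3⁻¹ : k) * eb + C (3⁻¹ : k) * (X 0 * h2 - X 2 * h0)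
end

section
/- Let y₁₂, y₂₃, y₃₁ be homogeneous quadratic polynomials in k[x₁,x₂,x₃], set y_{ji} = −y_{ij}, y_{ii} = 0 and v_i = Σ_k ∂y_{ik}/∂x_k, and suppose the Jacobi condition y₁₂v₃ + y₂₃v₁ + y₃₁v₂ = 0 holds together with v₁ = v₂ = 0 and v₃ = x₁. Then y₁₂ = 0 and there exists a homogeneous cubic polynomial f ∈ k[x₁,x₂] (i.e. ∂f/∂x₃ = 0) such that y₂₃ = ∂f/∂x₁ − x₁x₂ and y₃₁ = ∂f/∂x₂. -/
open MvPolynomial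

theorem rank_one_case {k : Type*} [Field k] [CharZero k]
    (y : Fin 3 → Fin 3 → MvPolynomial (Fin 3) k)
    (hhom : ∀ i j, (y i j).IsHomogeneous 2)
    (hskew : ∀ i j, y j i = - y i j)
    (hdiag : ∀ i, y i i = 0)
    (hJac : y 0 1 * (∑ m, pderiv m (y 2 m)) + y 1 2 * (∑ m, pderiv m (y 0 m)) +
        y 2 0 * (∑ m, pderiv m (y 1 m)) = 0)
    (hv0 : ∑ m, pderiv m (y 0 m) = 0)
    (hv1 : ∑ m, pderiv m (y 1 m) = 0)
    (hv2 : ∑ m, pderiv m (y 2 m) = X 0) :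
    y 0 1 = 0 ∧
      ∃ f : MvPolynomial (Fin 3) k, f.IsHomogeneous 3 ∧ pderiv 2 f = 0 ∧
        y 1 2 = pderiv 0 f - X 0 * X 1 ∧ y 2 0 = pderiv 1 f := by
  have h01 : y 0 1 = 0 := by
    rw [hv0, hv1, hv2] at hJac
    simpa using hJac
  refine ⟨h01, ?_⟩
  have h02 : y 0 2 = - y 2 0 := hskew 2 0
  have h10 : y 1 0 = - y 0 1 := hskew 0 1
  have h21 : y 2 1 = - y 1 2 := hskew 1 2
  simp only [Fin.sum_univ_three, hdiag, h02, h10, h21, h01, map_zero, map_neg, neg_zero,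
    zero_add, add_zero, neg_eq_zero] at hv0 hv1 hv2
  have hXX : (X 0 * X 1 : MvPolynomial (Fin 3) k).IsHomogeneous 2 :=
    (isHomogeneous_X k 0).mul (isHomogeneous_X k 1)
  have ha : (y 1 2 + X 0 * X 1).IsHomogeneous 2 := (hhom 1 2).add hXX
  have hb := hhom 2 0
  obtain ⟨a, hadef⟩ : ∃ a, a = y 1 2 + X 0 * X 1 := ⟨_, rfl⟩
  obtain ⟨b, hbdef⟩ : ∃ b, b = y 2 0 := ⟨_, rfl⟩
  rw [← hadef] at ha
  rw [← hbdef] at hb hv0 hv2 ⊢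
  have hy : y 1 2 = a - X 0 * X 1 := by rw [hadef]; ring
  have n01 : (0 : Fin 3) ≠ 1 := by decide
  have n10 : (1 : Fin 3) ≠ 0 := by decide
  have n02 : (0 : Fin 3) ≠ 2 := by decide
  have n12 : (1 : Fin 3) ≠ 2 := by decide
  have ha2 : pderiv 2 a = 0 := by
    rw [hadef]
    simp [Derivation.leibniz, hv1, pderiv_X_of_ne n02, pderiv_X_of_ne n12]
  have hab : pderiv 1 a = pderiv 0 b := by
    rw [hadef]
    simp only [map_add, Derivation.leibniz, pderiv_X_self, pderiv_X_of_ne n01, smul_eq_mul]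
    linear_combination -hv2
  have ea := ha.sum_X_mul_pderiv
  have eb := hb.sum_X_mul_pderiv
  simp only [Fin.sum_univ_three, ha2, hv0, nsmul_eq_mul, mul_zero, add_zero] at ea eb
  push_cast at ea eb
  have h3 : (C (3⁻¹ : k) : MvPolynomial (Fin 3) k) * 3 = 1 := by
    rw [show (3 : MvPolynomial (Fin 3) k) = C 3 from (map_ofNat C 3).symm, ← C_mul]
    simp
  refine ⟨C 3⁻¹ * (X 0 * a + X 1 * b), ?_, ?_, ?_, ?_⟩
  · have h : (X 0 * a + X 1 * b).IsHomogeneous 3 :=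
      ((isHomogeneous_X k 0).mul ha).add ((isHomogeneous_X k 1).mul hb)
    simpa using (isHomogeneous_C (Fin 3) (3⁻¹ : k)).mul h
  · simp [Derivation.leibniz, ha2, hv0, pderiv_X_of_ne n02, pderiv_X_of_ne n12]
  · rw [hy]
    simp only [Derivation.leibniz, map_add, pderiv_C, pderiv_X_self, pderiv_X_of_ne n10,
      smul_eq_mul]
    linear_combination (-a) * h3 - C 3⁻¹ * ea + C 3⁻¹ * X 1 * hab
  · simp only [Derivation.leibniz, map_add, pderiv_C, pderiv_X_self, pderiv_X_of_ne n01,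
      smul_eq_mul]
    linear_combination (-b) * h3 - C 3⁻¹ * eb - C 3⁻¹ * X 0 * hab
end

section
/- Let f ∈ k[x₁,x₂,x₃] be a homogeneous cubic polynomial satisfying x₂·∂f/∂x₃ + x₁·∂f/∂x₂ = 0. Then there exist c₁, c₂ ∈ k such that f = c₁·(x₁x₂² − 2x₁²x₃) + c₂·x₁³. -/
open MvPolynomial

noncomputable def mm (a b c : ℕ) : Fin 3 →₀ ℕ := Finsupp.equivFunOnFinite.symm ![a, b, c]

lemma mm_eq (m : Fin 3 →₀ ℕ) : m = mm (m 0) (m 1) (m 2) := by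
  ext i; fin_cases i <;> simp [mm]

lemma mm_inj (a b c a' b' c' : ℕ) : mm a b c = mm a' b' c' ↔ a = a' ∧ b = b' ∧ c = c' := by
  constructor
  · intro h
    exact ⟨by simpa [mm] using DFunLike.congr_fun h 0, by simpa [mm] using DFunLike.congr_fun h 1,
      by simpa [mm] using DFunLike.congr_fun h 2⟩
  · rintro ⟨rfl, rfl, rfl⟩; rfl

lemma mono_mm {k : Type*} [Field k] (a b c : ℕ) (r : k) :
    monomial (mm a b c) r = C r * (X 0 ^ a * X 1 ^ b * X 2 ^ c) := by
  rw [monomial_eq, Finsupp.prod_fintype _ _ (by simp)]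
  simp [Fin.prod_univ_three, mm]

lemma expand {k : Type*} [Field k] (f : MvPolynomial (Fin 3) k) (hf : f.IsHomogeneous 3) :
    f = monomial (mm 3 0 0) (coeff (mm 3 0 0) f) + monomial (mm 0 3 0) (coeff (mm 0 3 0) f)
      + monomial (mm 0 0 3) (coeff (mm 0 0 3) f) + monomial (mm 2 1 0) (coeff (mm 2 1 0) f)
      + monomial (mm 2 0 1) (coeff (mm 2 0 1) f) + monomial (mm 1 2 0) (coeff (mm 1 2 0) f)
      + monomial (mm 0 2 1) (coeff (mm 0 2 1) f) + monomial (mm 1 0 2) (coeff (mm 1 0 2) f)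
      + monomial (mm 0 1 2) (coeff (mm 0 1 2) f) + monomial (mm 1 1 1) (coeff (mm 1 1 1) f) := by
  ext m
  rw [mm_eq m]
  generalize m 0 = a
  generalize m 1 = b
  generalize m 2 = c
  by_cases h : a + b + c = 3
  · have ha : a ≤ 3 := by omega
    have hb : b ≤ 3 := by omega
    obtain rfl : c = 3 - a - b := by omega
    interval_cases a <;> interval_cases b <;> first | omega | simp [coeff_monomial, mm_inj]
  · rw [hf.coeff_eq_zero (d := mm a b c) (by
      simpa [Finsupp.degree_eq_sum, Fin.sum_univ_three, mm] using h)]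
    simp only [coeff_add, coeff_monomial, mm_inj]
    repeat rw [if_neg (by omega)]
    simp

theorem cubic_case_cb {k : Type*} [Field k] [CharZero k]
    (f : MvPolynomial (Fin 3) k) (hf : f.IsHomogeneous 3)
    (heq : X 1 * pderiv 2 f + X 0 * pderiv 1 f = 0) :
    ∃ c₁ c₂ : k, f = C c₁ * (X 0 * X 1 ^ 2 - 2 * X 0 ^ 2 * X 2) + C c₂ * X 0 ^ 3 := by
  have c2 : (C 2 : MvPolynomial (Fin 3) k) = 2 := map_ofNat C 2
  have c3 : (C 3 : MvPolynomial (Fin 3) k) = 3 := map_ofNat C 3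
  have hx := expand f hf
  generalize coeff (mm 3 0 0) f = a300 at hx
  generalize coeff (mm 0 3 0) f = a030 at hx
  generalize coeff (mm 0 0 3) f = a003 at hx
  generalize coeff (mm 2 1 0) f = a210 at hx
  generalize coeff (mm 2 0 1) f = a201 at hx
  generalize coeff (mm 1 2 0) f = a120 at hx
  generalize coeff (mm 0 2 1) f = a021 at hx
  generalize coeff (mm 1 0 2) f = a102 at hx
  generalize coeff (mm 0 1 2) f = a012 at hx
  generalize coeff (mm 1 1 1) f = a111 at hx
  have key : monomial (mm 0 1 2) (3 * a003) + monomial (mm 0 2 1) (2 * a012)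
      + monomial (mm 0 3 0) a021 + monomial (mm 1 0 2) a012
      + monomial (mm 1 1 1) (2 * a102 + 2 * a021) + monomial (mm 1 2 0) (a111 + 3 * a030)
      + monomial (mm 2 0 1) a111 + monomial (mm 2 1 0) (a201 + 2 * a120)
      + monomial (mm 3 0 0) a210 = 0 := by
    rw [← heq, hx]
    simp only [mono_mm]
    simp [pderiv_X, c2, c3]
    ring
  have K := fun a b c => congrArg (coeff (mm a b c)) key
  have k1 := K 0 1 2
  have k2 := K 0 2 1
  have k3 := K 0 3 0
  have k5 := K 1 1 1
  have k6 := K 1 2 0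
  have k7 := K 2 0 1
  have k8 := K 2 1 0
  have k9 := K 3 0 0
  simp [coeff_monomial, mm_inj] at k1 k2 k3 k5 k6 k7 k8 k9
  subst k1 k2 k3 k7 k9
  have e1 : a102 = 0 := by simpa using k5
  have e2 : a030 = 0 := by simpa using k6
  have e3 : a201 = -2 * a120 := by linear_combination k8
  refine ⟨a120, a300, ?_⟩
  rw [hx, e1, e2, e3]
  simp only [mono_mm]
  simp [c2]
  ring
end

section
/- Let λ₁, λ₂, λ₃ ∈ k be nonzero, pairwise distinct scalars with λ₁ + λ₂ + λ₃ = 0, and let f ∈ k[x₁,x₂,x₃] be a homogeneous cubic polynomial satisfying λ₁x₁·∂f/∂x₁ + λ₂x₂·∂f/∂x₂ + λ₃x₃·∂f/∂x₃ = 0. Then there exists c ∈ k such that f = 2c·x₁x₂x₃. -/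
open MvPolynomial

theorem coeff_X_mul_pd {k : Type*} [Field k] (i : Fin 3) (f : MvPolynomial (Fin 3) k)
    (m : Fin 3 →₀ ℕ) : coeff m (X i * pderiv i f) = (m i : k) * coeff m f := by
  rw [coeff_X_mul']
  split_ifs with h
  · have hi : m i ≠ 0 := by simpa using h
    have hm : m - Finsupp.single i 1 + Finsupp.single i 1 = m := by
      apply tsub_add_cancel_of_le
      simpa [Finsupp.single_le_iff] using Nat.one_le_iff_ne_zero.mpr hi
    rw [coeff_pderiv, hm]
    have : (((m - Finsupp.single i 1 : Fin 3 →₀ ℕ) i : ℕ) : k) + 1 = m i := by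
      have h2 : (m - Finsupp.single i 1 : Fin 3 →₀ ℕ) i + 1 = m i := by
        simp; omega
      rw [← h2]; push_cast; rfl
    rw [this]; ring
  · have hi : m i = 0 := by simpa using h
    simp [hi]

theorem cubic_case_da {k : Type*} [Field k] [CharZero k]
    (l₁ l₂ l₃ : k) (h₁ : l₁ ≠ 0) (h₂ : l₂ ≠ 0) (h₃ : l₃ ≠ 0)
    (h₁₂ : l₁ ≠ l₂) (h₁₃ : l₁ ≠ l₃) (h₂₃ : l₂ ≠ l₃)
    (hsum : l₁ + l₂ + l₃ = 0)
    (f : MvPolynomial (Fin 3) k) (hf : f.IsHomogeneous 3)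
    (heq : C l₁ * X 0 * pderiv 0 f + C l₂ * X 1 * pderiv 1 f
        + C l₃ * X 2 * pderiv 2 f = 0) :
    ∃ c : k, f = 2 * C c * (X 0 * X 1 * X 2) := by
  let e : Fin 3 →₀ ℕ := Finsupp.single 0 1 + Finsupp.single 1 1 + Finsupp.single 2 1
  refine ⟨coeff e f / 2, ?_⟩
  have hR : (2 * C (coeff e f / 2) * (X 0 * X 1 * X 2) : MvPolynomial (Fin 3) k)
      = monomial e (coeff e f) := by
    have h2 : (2 : MvPolynomial (Fin 3) k) = C 2 := (map_ofNat C 2).symm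
    rw [h2, ← C_mul, mul_div_cancel₀ _ (two_ne_zero' k)]
    simp only [X, monomial_mul, C_mul_monomial, e, mul_one]
  rw [hR]
  ext m
  rw [coeff_monomial]
  split_ifs with hm
  · rw [hm]
  by_contra hc
  have hd := hf hc
  have hd' : m 0 + m 1 + m 2 = 3 := by
    change Finsupp.weight (fun _ => 1) m = 3 at hd
    rw [← Finsupp.degree_eq_weight_one, Finsupp.degree_eq_sum, Fin.sum_univ_three] at hd
    exact hd
  have hk := congrArg (coeff m) heq
  simp only [mul_assoc, coeff_add, coeff_C_mul, coeff_X_mul_pd, coeff_zero] at hk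
  have hk' : l₁ * m 0 + l₂ * m 1 + l₃ * m 2 = 0 := by
    apply (mul_eq_zero.mp (_ : (l₁ * m 0 + l₂ * m 1 + l₃ * m 2) * coeff m f = 0)).resolve_right hc
    linear_combination hk
  have hne : ¬ (m 0 = 1 ∧ m 1 = 1 ∧ m 2 = 1) := by
    rintro ⟨a, b, c⟩
    apply hm
    ext i
    fin_cases i <;> simp [e, a, b, c]
  have h3 : (3 : k) ≠ 0 := three_ne_zero
  generalize m 0 = a at *
  generalize m 1 = b at *
  generalize m 2 = c at *
  have ha : a ≤ 3 := by omega
  have hb : b ≤ 3 := by omega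
  obtain rfl : c = 3 - a - b := by omega
  clear hf heq hR hm hc hd hk
  interval_cases a <;> interval_cases b <;> simp at hd' hne hk' <;> grind
end

section
/- Let f ∈ k[x₁,x₂,x₃] be a homogeneous cubic polynomial satisfying x₁·∂f/∂x₁ + (x₁ + x₂)·∂f/∂x₂ − 2x₃·∂f/∂x₃ = 0. Then there exists c ∈ k such that f = c·x₁²x₃. -/
open MvPolynomial

noncomputable def expo (a b c : ℕ) : Fin 3 →₀ ℕ := Finsupp.equivFunOnFinite.symm ![a, b, c]

lemma expo_self (m : Fin 3 →₀ ℕ) : m = expo (m 0) (m 1) (m 2) := by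
  ext i; fin_cases i <;> simp [expo]

lemma coeff_euler {k : Type*} [Field k] (f : MvPolynomial (Fin 3) k) (i : Fin 3)
    (m : Fin 3 →₀ ℕ) : coeff m (X i * pderiv i f) = (m i : k) * coeff m f := by
  rw [coeff_X_mul']
  split_ifs with h
  · have h1 : 1 ≤ m i := Nat.one_le_iff_ne_zero.mpr (Finsupp.mem_support_iff.mp h)
    rw [coeff_pderiv, tsub_add_cancel_of_le (by simpa using h1)]
    simp [Nat.cast_sub h1, mul_comm]
  · simp [Finsupp.notMem_support_iff.mp h]

theorem cubic_case_dc {k : Type*} [Field k] [CharZero k]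
    (f : MvPolynomial (Fin 3) k) (hf : f.IsHomogeneous 3)
    (heq : X 0 * pderiv 0 f + (X 0 + X 1) * pderiv 1 f - 2 * X 2 * pderiv 2 f = 0) :
    ∃ c : k, f = C c * (X 0 ^ 2 * X 2) := by
  have heq' : X 0 * pderiv 0 f + X 1 * pderiv 1 f + X 0 * pderiv 1 f
      - C 2 * (X 2 * pderiv 2 f) = 0 := by
    rw [← heq, show (C 2 : MvPolynomial (Fin 3) k) = 2 from map_ofNat C 2]; ring
  have key : ∀ m : Fin 3 →₀ ℕ, (m 0 : k) * coeff m f + m 1 * coeff m f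
      + coeff m (X 0 * pderiv 1 f) - 2 * (m 2 * coeff m f) = 0 := by
    intro m
    have := congrArg (coeff m) heq'
    simpa only [coeff_sub, coeff_add, coeff_C_mul, coeff_euler, coeff_zero] using this
  have r0 : ∀ b c : ℕ, ((b : k) - 2 * c) * coeff (expo 0 b c) f = 0 := by
    intro b c
    have := key (expo 0 b c)
    rw [coeff_X_mul', if_neg (by simp [expo])] at this
    simp only [expo, Finsupp.equivFunOnFinite_symm_apply_apply] at this ⊢
    simp at this
    linear_combination this
  have rS : ∀ a b c : ℕ, ((a : k) + 1 + b - 2 * c) * coeff (expo (a+1) b c) f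
      + (b + 1) * coeff (expo a (b+1) c) f = 0 := by
    intro a b c
    have := key (expo (a+1) b c)
    have e : expo (a+1) b c = Finsupp.single 0 1 + expo a b c := by
      ext i; fin_cases i <;> simp [expo, add_comm]
    have e2 : expo a b c + Finsupp.single 1 1 = expo a (b+1) c := by
      ext i; fin_cases i <;> simp [expo]
    have e3 : coeff (expo (a+1) b c) (X 0 * pderiv 1 f)
        = coeff (expo a (b+1) c) f * (b + 1) := by
      rw [e, coeff_X_mul, coeff_pderiv, e2]; simp [expo]
    rw [e3] at this
    have h0 : expo (a+1) b c 0 = a + 1 := by simp [expo]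
    have h1 : expo (a+1) b c 1 = b := by simp [expo]
    have h2 : expo (a+1) b c 2 = c := by simp [expo]
    rw [h0, h1, h2] at this
    push_cast at this
    linear_combination this
  have a1 := r0 3 0
  have a2 := rS 0 2 0
  have a3 := rS 1 1 0
  have a4 := rS 2 0 0
  have b1 := rS 0 1 1
  have b2 := rS 1 0 1
  have c1 := r0 1 2
  have c2 := rS 0 0 2
  have d1 := r0 0 3
  norm_num at a1 a2 a3 a4 b1 b2 c1 c2 d1
  norm_num [a1] at a2
  norm_num [a2] at a3
  norm_num [a3] at a4
  norm_num [c1] at c2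
  refine ⟨coeff (expo 2 0 1) f, ?_⟩
  have hm : (C (coeff (expo 2 0 1) f) * (X 0 ^ 2 * X 2) : MvPolynomial (Fin 3) k)
      = monomial (expo 2 0 1) (coeff (expo 2 0 1) f) := by
    have e : expo 2 0 1 = Finsupp.single 0 2 + Finsupp.single 2 1 := by
      ext i; fin_cases i <;> simp [expo]
    rw [X_pow_eq_monomial, X, monomial_mul, C_mul_monomial, ← e]; simp
  rw [hm]
  ext m
  rw [coeff_monomial]
  split_ifs with h
  · rw [h]
  by_cases hd : m.degree = 3
  · rw [Finsupp.degree_eq_sum, Fin.sum_univ_three] at hd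
    rw [expo_self m] at h ⊢
    generalize m 0 = a at *
    generalize m 1 = b at *
    generalize m 2 = c at *
    have ha : a ≤ 3 := by omega
    have hb : b ≤ 3 := by omega
    obtain rfl : c = 3 - a - b := by omega
    interval_cases a <;> interval_cases b <;> first | omega | assumption | exact absurd rfl h
  · exact hf.coeff_eq_zero hd
end

section
/- Let k be an algebraically closed field of characteristic zero and b a quadratic Poisson bracket on k[x₁,x₂,x₃] determined by homogeneous quadratic polynomials y_{ij} = b(x_i,x_j). Then there exists A ∈ GL(3,k) such that the transformed bracket b^A (with b^A(f,g) = φ_A^{-1}(b(φ_A f, φ_A g)), where φ_A(x_i) = Σ_j A_{ij}x_j) has one of the following normal forms, for some homogeneous cubic f and scalars as indicated: (a) y₁₂ = ∂f/∂x₃, y₂₃ = ∂f/∂x₁, y₃₁ = ∂f/∂x₂ with f an arbitrary cubic form; (b) y₁₂ = 0, y₂₃ = ∂f/∂x₁ − x₁x₂, y₃₁ = ∂f/∂x₂ with f a cubic form in x₁,x₂ only; (ca) y₁₂ = ∂f/∂x₃, y₂₃ = ∂f/∂x₁ − λx₂x₃, y₃₁ = ∂f/∂x₂ with λ ≠ 0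 and f = 2c₁x₁x₂x₃ + c₂x₁³; (cb) y₁₂ = ∂f/∂x₃, y₂₃ = ∂f/∂x₁ + x₁x₃ − ½x₂², y₃₁ = ∂f/∂x₂ with f = −2c₁x₃x₁² + c₁x₁x₂² + c₂x₁³; (da) y₁₂ = ∂f/∂x₃, y₂₃ = ∂f/∂x₁ + λ₂x₂x₃, y₃₁ = ∂f/∂x₂ − λ₁x₁x₃ with λ₁,λ₂,λ₃ nonzero, pairwise distinct, λ₁+λ₂+λ₃ = 0, and f = 2c·x₁x₂x₃; (db) y₁₂ = ∂f/∂x₃, y₂₃ = ∂f/∂x₁ + λx₂x₃, y₃₁ = ∂f/∂x₂ − λx₁x₃ with λ ≠ 0 and f = g(x₁,x₂)x₃ for a quadratic form g; (dc) y₁₂ = ∂f/∂x₃ − (λ/2)x₁², y₂₃ = ∂f/∂x₁ + λx₂x₃, y₃₁ = ∂f/∂x₂ − λx₁x₃ with λ ≠ 0 and f = c·x₁²x₃. -/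
open MvPolynomial

section Cases

variable {k : Type*} [Field k]

/-- Case a) : rank 0, `y₁₂ = ∂f/∂x₃`, `y₂₃ = ∂f/∂x₁`, `y₃₁ = ∂f/∂x₂` for an arbitrary
cubic form `f`. -/
def CaseA (z01 z12 z20 : MvPolynomial (Fin 3) k) : Prop :=
  ∃ f : MvPolynomial (Fin 3) k, f.IsHomogeneous 3 ∧
    z01 = pderiv 2 f ∧ z12 = pderiv 0 f ∧ z20 = pderiv 1 f

/-- Case b) : rank 1, `y₁₂ = 0`, `y₂₃ = ∂f/∂x₁ - x₁x₂`, `y₃₁ = ∂f/∂x₂` for a cubic form `f`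
in the variables `x₁, x₂` only. -/
def CaseB (z01 z12 z20 : MvPolynomial (Fin 3) k) : Prop :=
  ∃ f : MvPolynomial (Fin 3) k, f.IsHomogeneous 3 ∧ pderiv 2 f = 0 ∧
    z01 = 0 ∧ z12 = pderiv 0 f - X 0 * X 1 ∧ z20 = pderiv 1 f

/-- Case ca) : rank 2 diagonalizable, with `f = 2c₁x₁x₂x₃ + c₂x₁³`. -/
def CaseCa (z01 z12 z20 : MvPolynomial (Fin 3) k) : Prop :=
  ∃ lam c₁ c₂ : k, lam ≠ 0 ∧
    ∃ f : MvPolynomial (Fin 3) k, f = 2 * C c₁ * (X 0 * X 1 * X 2) + C c₂ * X 0 ^ 3 ∧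
      z01 = pderiv 2 f ∧ z12 = pderiv 0 f - C lam * (X 1 * X 2) ∧ z20 = pderiv 1 f

/-- Case cb) : rank 2 non-diagonalizable, with `f = -2c₁x₃x₁² + c₁x₁x₂² + c₂x₁³`. -/
def CaseCb (z01 z12 z20 : MvPolynomial (Fin 3) k) : Prop :=
  ∃ c₁ c₂ : k,
    ∃ f : MvPolynomial (Fin 3) k,
      f = -(2 * C c₁) * (X 2 * X 0 ^ 2) + C c₁ * (X 0 * X 1 ^ 2) + C c₂ * X 0 ^ 3 ∧
      z01 = pderiv 2 f ∧
      z12 = pderiv 0 f + X 0 * X 2 - C (2⁻¹ : k) * X 1 ^ 2 ∧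
      z20 = pderiv 1 f

/-- Case da) : rank 3 with pairwise distinct eigenvalues, `f = 2c·x₁x₂x₃`. -/
def CaseDa (z01 z12 z20 : MvPolynomial (Fin 3) k) : Prop :=
  ∃ l₁ l₂ l₃ c : k, l₁ ≠ 0 ∧ l₂ ≠ 0 ∧ l₃ ≠ 0 ∧ l₁ ≠ l₂ ∧ l₁ ≠ l₃ ∧ l₂ ≠ l₃ ∧
    l₁ + l₂ + l₃ = 0 ∧
    ∃ f : MvPolynomial (Fin 3) k, f = 2 * C c * (X 0 * X 1 * X 2) ∧
      z01 = pderiv 2 f ∧ z12 = pderiv 0 f + C l₂ * (X 1 * X 2) ∧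
      z20 = pderiv 1 f - C l₁ * (X 0 * X 2)

/-- Case db) : rank 3 with repeated eigenvalue, diagonalizable, `f = g(x₁,x₂)x₃`. -/
def CaseDb (z01 z12 z20 : MvPolynomial (Fin 3) k) : Prop :=
  ∃ lam : k, lam ≠ 0 ∧
    ∃ g : MvPolynomial (Fin 3) k, g.IsHomogeneous 2 ∧ pderiv 2 g = 0 ∧
      ∃ f : MvPolynomial (Fin 3) k, f = g * X 2 ∧
        z01 = pderiv 2 f ∧ z12 = pderiv 0 f + C lam * (X 1 * X 2) ∧
        z20 = pderiv 1 f - C lam * (X 0 * X 2)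

/-- Case dc) : rank 3 non-diagonalizable, `f = c·x₁²x₃`. -/
def CaseDc (z01 z12 z20 : MvPolynomial (Fin 3) k) : Prop :=
  ∃ lam c : k, lam ≠ 0 ∧
    ∃ f : MvPolynomial (Fin 3) k, f = C c * (X 0 ^ 2 * X 2) ∧
      z01 = pderiv 2 f - C (lam / 2) * X 0 ^ 2 ∧
      z12 = pderiv 0 f + C lam * (X 1 * X 2) ∧
      z20 = pderiv 1 f - C lam * (X 0 * X 2)

end Cases

def MSim {k : Type*} [Field k] (M N : Matrix (Fin 3) (Fin 3) k) : Prop :=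
  ∃ A : Matrix (Fin 3) (Fin 3) k, A.det ≠ 0 ∧ A * M = N * A

theorem MSim.trans {k : Type*} [Field k] {M N P : Matrix (Fin 3) (Fin 3) k}
    (h : MSim M N) (h' : MSim N P) : MSim M P := by
  obtain ⟨A, hA, h1⟩ := h
  obtain ⟨B, hB, h2⟩ := h'
  refine ⟨B * A, by rw [Matrix.det_mul]; exact mul_ne_zero hB hA, ?_⟩
  rw [Matrix.mul_assoc, h1, ← Matrix.mul_assoc, h2, Matrix.mul_assoc]

theorem MSim.refl {k : Type*} [Field k] (M : Matrix (Fin 3) (Fin 3) k) : MSim M M :=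
  ⟨1, by simp, by simp⟩

theorem MSim.trace {k : Type*} [Field k] {M N : Matrix (Fin 3) (Fin 3) k}
    (h : MSim M N) : M.trace = N.trace := by
  obtain ⟨A, hA, h1⟩ := h
  have hu : IsUnit A.det := isUnit_iff_ne_zero.mpr hA
  have : M = A⁻¹ * (N * A) := by
    rw [← h1, ← Matrix.mul_assoc, Matrix.nonsing_inv_mul _ hu, Matrix.one_mul]
  rw [this, Matrix.trace_mul_comm, Matrix.mul_assoc, Matrix.mul_nonsing_inv _ hu, Matrix.mul_one]

def lowT {k : Type*} [Field k] (a b c p q r : k) : Matrix (Fin 3) (Fin 3) k :=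
  !![a, 0, 0; p, b, 0; q, r, c]

def isNF {k : Type*} [Field k] (N : Matrix (Fin 3) (Fin 3) k) : Prop :=
  N = 0 ∨ N = !![0,0,0;0,0,0;1,0,0] ∨ (∃ l : k, l ≠ 0 ∧ N = !![0,0,0;0,-l,0;0,0,l]) ∨
  N = !![0,0,0;1,0,0;0,1,0] ∨
  (∃ a b c : k, a ≠ 0 ∧ b ≠ 0 ∧ c ≠ 0 ∧ a ≠ b ∧ a ≠ c ∧ b ≠ c ∧ a + b + c = 0 ∧
    N = !![a,0,0;0,b,0;0,0,c]) ∨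
  (∃ l : k, l ≠ 0 ∧ N = !![l,0,0;0,l,0;0,0,-2*l]) ∨
  (∃ l : k, l ≠ 0 ∧ N = !![l,0,0;l,l,0;0,0,-2*l])

theorem first_row {k : Type*} [Field k] [IsAlgClosed k] (M : Matrix (Fin 3) (Fin 3) k) :
    ∃ a p q s t u w : k, MSim M !![a,0,0;p,s,t;q,u,w] := by
  obtain ⟨μ, hμ⟩ := Module.End.exists_eigenvalue (Matrix.toLin' M.transpose)
  obtain ⟨v, hv⟩ := hμ.exists_hasEigenvector
  have h1 : Matrix.mulVec M.transpose v = μ • v := by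
    simpa using hv.apply_eq_smul
  rw [Matrix.mulVec_transpose] at h1
  have hA : ∃ A : Matrix (Fin 3) (Fin 3) k, A.det ≠ 0 ∧ A 0 = v := by
    obtain ⟨i, hi⟩ := Function.ne_iff.mp hv.2
    fin_cases i
    · exact ⟨Matrix.of ![v, ![0,1,0], ![0,0,1]], by
        simpa [Matrix.det_fin_three] using hi, rfl⟩
    · exact ⟨Matrix.of ![v, ![1,0,0], ![0,0,1]], by
        simpa [Matrix.det_fin_three] using hi, rfl⟩
    · exact ⟨Matrix.of ![v, ![1,0,0], ![0,1,0]], by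
        simpa [Matrix.det_fin_three] using hi, rfl⟩
  obtain ⟨A, hd, hv0⟩ := hA
  have hu : IsUnit A.det := isUnit_iff_ne_zero.mpr hd
  set N := A * M * A⁻¹ with hN
  have hr : N 0 = Matrix.vecMul (Pi.single 0 1) N := by
    rw [Matrix.single_one_vecMul]; rfl
  have hr2 : N 0 = μ • Pi.single 0 1 := by
    have e : Matrix.vecMul (Pi.single 0 1) A = v := by
      rw [Matrix.single_one_vecMul, ← hv0]; rfl
    have e2 : Matrix.vecMul v A⁻¹ = Pi.single 0 1 := by
      rw [← e, Matrix.vecMul_vecMul, Matrix.mul_nonsing_inv _ hu, Matrix.vecMul_one]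
    rw [hr, hN, ← Matrix.vecMul_vecMul, ← Matrix.vecMul_vecMul, e, h1, Matrix.smul_vecMul, e2]
  refine ⟨μ, N 1 0, N 2 0, N 1 1, N 1 2, N 2 1, N 2 2, A, hd, ?_⟩
  have : N = !![μ,0,0;N 1 0,N 1 1, N 1 2; N 2 0, N 2 1, N 2 2] := by
    ext i j
    fin_cases i
    · fin_cases j <;> simp [hr2]
    · fin_cases j <;> simp
    · fin_cases j <;> simp
  rw [← this, hN, Matrix.mul_assoc (A * M), Matrix.nonsing_inv_mul _ hu, Matrix.mul_one]

theorem triang {k : Type*} [Field k] [IsAlgClosed k] (M : Matrix (Fin 3) (Fin 3) k) :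
    ∃ a b c p q r : k, MSim M (lowT a b c p q r) := by
  obtain ⟨a, p, q, s, t, u, w, h⟩ := first_row M
  by_cases hu : u = 0
  · refine ⟨a, w, s, q, p, t, h.trans ⟨!![1,0,0;0,0,1;0,1,0], ?_, ?_⟩⟩
    · simp [Matrix.det_fin_three]
    · subst hu
      ext i j; fin_cases i <;> fin_cases j <;> simp [lowT]
  · obtain ⟨y, hy⟩ := IsAlgClosed.exists_root
      (Polynomial.C u * Polynomial.X ^ 2 + Polynomial.C (s - w) * Polynomial.X
        + Polynomial.C (-t)) (by rw [Polynomial.degree_quadratic hu]; decide)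
    have hy : u * y ^ 2 + (s - w) * y - t = 0 := by
      simpa [sub_eq_add_neg] using hy
    refine ⟨a, s + y * u, w - u * y, p + y * q, q, u, h.trans ⟨!![1,0,0;0,1,y;0,0,1], ?_, ?_⟩⟩
    · simp [Matrix.det_fin_three]
    · ext i j
      fin_cases i <;> fin_cases j <;> simp [lowT] <;> linear_combination - hy

theorem lowT_eq_swap1 {k : Type*} [Field k] (a b c p q r : k) (h : a ≠ b) :
    ∃ p' q' r', MSim (lowT a b c p q r) (lowT b a c p' q' r') := by
  have h' : b - a ≠ 0 := sub_ne_zero.mpr h.symm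
  refine ⟨0, r, q - r * (p / (b - a)), !![p / (b - a),1,0;1,0,0;0,0,1], ?_, ?_⟩
  · simp [Matrix.det_fin_three]
  · ext i j
    fin_cases i <;> fin_cases j <;> simp [lowT] <;> field_simp <;> ring

theorem lowT_eq_swap2 {k : Type*} [Field k] (a b c p q r : k) (h : b ≠ c) :
    ∃ p' q' r', MSim (lowT a b c p q r) (lowT a c b p' q' r') := by
  have h' : c - b ≠ 0 := sub_ne_zero.mpr h.symm
  refine ⟨q + r / (c - b) * p, p, 0, !![1,0,0;0,r / (c - b),1;0,1,0], ?_, ?_⟩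
  · simp [Matrix.det_fin_three]
  · ext i j
    fin_cases i <;> fin_cases j <;> simp [lowT] <;> field_simp <;> ring

theorem nf_distinct {k : Type*} [Field k] (a b c p q r : k) (hab : a ≠ b) (hac : a ≠ c)
    (hbc : b ≠ c) : MSim (lowT a b c p q r) !![a,0,0;0,b,0;0,0,c] := by
  have h1 : b - a ≠ 0 := sub_ne_zero.mpr hab.symm
  have h2 : c - b ≠ 0 := sub_ne_zero.mpr hbc.symm
  have h3 : c - a ≠ 0 := sub_ne_zero.mpr hac.symm
  refine ⟨!![1,0,0;p/(b-a),1,0;(r/(c-b)*p+q)/(c-a),r/(c-b),1], ?_, ?_⟩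
  · simp [Matrix.det_fin_three]
  · ext i j
    fin_cases i <;> fin_cases j <;> simp [lowT] <;> field_simp <;> ring

theorem nf_two {k : Type*} [Field k] [CharZero k] (a c p q r : k) (hac : a ≠ c)
    (hs : a + a + c = 0) : ∃ N, isNF N ∧ MSim (lowT a a c p q r) N := by
  have hc : c = -2 * a := by linear_combination hs
  subst hc
  have ha : a ≠ 0 := by rintro rfl; simp at hac
  have h1 : MSim (lowT a a (-2*a) p q r) (lowT a a (-2*a) p 0 0) := by
    refine ⟨!![1,0,0;0,1,0; (q - r / (3 * a) * p)/(-3 * a), -r/(3 * a),1], ?_, ?_⟩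
    · simp [Matrix.det_fin_three]
    · ext i j
      fin_cases i <;> fin_cases j <;> simp [lowT] <;> field_simp <;> ring
  by_cases hp : p = 0
  · subst hp
    exact ⟨_, Or.inr <| Or.inr <| Or.inr <| Or.inr <| Or.inr <| Or.inl ⟨a, ha, rfl⟩, h1⟩
  · refine ⟨_, Or.inr <| Or.inr <| Or.inr <| Or.inr <| Or.inr <| Or.inr ⟨a, ha, rfl⟩,
      h1.trans ⟨!![1,0,0;0,a/p,0;0,0,1], ?_, ?_⟩⟩
    · simp [Matrix.det_fin_three, hp, ha]
    · ext i j
      fin_cases i <;> fin_cases j <;> simp [lowT] <;> field_simp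

theorem nf_nilp {k : Type*} [Field k] (p q r : k) :
    ∃ N, isNF N ∧ MSim (lowT 0 0 0 p q r) N := by
  by_cases hp : p = 0
  · subst hp
    by_cases hr : r = 0
    · subst hr
      by_cases hq : q = 0
      · subst hq
        refine ⟨0, Or.inl rfl, 1, by simp, ?_⟩
        ext i j
        fin_cases i <;> fin_cases j <;> simp [lowT]
      · refine ⟨_, Or.inr <| Or.inl rfl, !![q,0,0;0,1,0;0,0,1], ?_, ?_⟩
        · simp [Matrix.det_fin_three, hq]
        · ext i j
          fin_cases i <;> fin_cases j <;> simp [lowT]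
    · refine ⟨_, Or.inr <| Or.inl rfl, !![q,r,0;1,0,0;0,0,1], ?_, ?_⟩
      · simp [Matrix.det_fin_three, hr]
      · ext i j
        fin_cases i <;> fin_cases j <;> simp [lowT]
  · by_cases hr : r = 0
    · subst hr
      refine ⟨_, Or.inr <| Or.inl rfl, !![p,0,0;0,-q/p,1;0,1,0], ?_, ?_⟩
      · simp [Matrix.det_fin_three, hp]
      · ext i j
        fin_cases i <;> fin_cases j <;> simp [lowT] <;> field_simp <;> ring
    · refine ⟨_, Or.inr <| Or.inr <| Or.inr <| Or.inl rfl, !![r*p,0,0;q,r,0;0,0,1], ?_, ?_⟩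
      · simp [Matrix.det_fin_three, hp, hr]
      · ext i j
        fin_cases i <;> fin_cases j <;> simp [lowT]

theorem exists_nf {k : Type*} [Field k] [CharZero k] [IsAlgClosed k]
    (M : Matrix (Fin 3) (Fin 3) k) (ht : M.trace = 0) : ∃ N, isNF N ∧ MSim M N := by
  obtain ⟨a, b, c, p, q, r, h⟩ := triang M
  have hs : a + b + c = 0 := by
    rw [h.trace] at ht
    simpa [lowT, Matrix.trace_fin_three] using ht
  by_cases hab : a = b
  · subst hab
    by_cases hac : a = c
    · subst hac
      have ha : a = 0 := by
        have : (3 : k) * a = 0 := by linear_combination hs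
        simpa using this
      subst ha
      obtain ⟨N, h1, h2⟩ := nf_nilp p q r
      exact ⟨N, h1, h.trans h2⟩
    · obtain ⟨N, h1, h2⟩ := nf_two a c p q r hac hs
      exact ⟨N, h1, h.trans h2⟩
  by_cases hbc : b = c
  · subst hbc
    obtain ⟨p', q', r', h1⟩ := lowT_eq_swap1 a b b p q r hab
    obtain ⟨p'', q'', r'', h2⟩ := lowT_eq_swap2 b a b p' q' r' hab
    obtain ⟨N, h3, h4⟩ := nf_two b a p'' q'' r'' (Ne.symm hab) (by linear_combination hs)
    exact ⟨N, h3, ((h.trans h1).trans h2).trans h4⟩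
  by_cases hac : a = c
  · subst hac
    obtain ⟨p', q', r', h1⟩ := lowT_eq_swap2 a b a p q r hbc
    obtain ⟨N, h3, h4⟩ := nf_two a b p' q' r' hab (by linear_combination hs)
    exact ⟨N, h3, (h.trans h1).trans h4⟩
  have key : ∀ x y p q r : k, x ≠ y → 0 ≠ x → 0 ≠ y → x + y = 0 → MSim M (lowT 0 x y p q r) →
      ∃ N, isNF N ∧ MSim M N := by
    intro x y p q r hxy hx hy hs h
    have hx' : x = -y := by linear_combination hs
    subst hx'
    exact ⟨_, Or.inr <| Or.inr <| Or.inl ⟨y, hy.symm, rfl⟩,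
      h.trans (nf_distinct _ _ _ _ _ _ hx hy hxy)⟩
  by_cases ha : a = 0
  · subst ha
    exact key b c p q r hbc hab hac (by linear_combination hs) h
  by_cases hb : b = 0
  · subst hb
    obtain ⟨p', q', r', h1⟩ := lowT_eq_swap1 a 0 c p q r hab
    exact key a c p' q' r' hac (Ne.symm hab) hbc (by linear_combination hs) (h.trans h1)
  by_cases hc : c = 0
  · subst hc
    obtain ⟨p', q', r', h1⟩ := lowT_eq_swap2 a b 0 p q r hbc
    obtain ⟨p'', q'', r'', h2⟩ := lowT_eq_swap1 a 0 b p' q' r' hac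
    exact key a b p'' q'' r'' hab (Ne.symm hac) (Ne.symm hbc) (by linear_combination hs)
      ((h.trans h1).trans h2)
  exact ⟨_, Or.inr <| Or.inr <| Or.inr <| Or.inr <| Or.inl
    ⟨a, b, c, ha, hb, hc, hab, hac, hbc, hs, rfl⟩, h.trans (nf_distinct _ _ _ _ _ _ hab hac hbc)⟩

section Pol
set_option linter.unusedSectionVars false
set_option linter.unusedSimpArgs false
variable {k : Type*} [Field k] [CharZero k]

theorem hom1_form {g : MvPolynomial (Fin 3) k} (hg : g.IsHomogeneous 1) :
    ∃ a : Fin 3 → k, g = ∑ j, C (a j) * X j := by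
  have h0 : ∀ i, ∃ a, pderiv i g = C a := fun i => by
    have := hg.pderiv (i := i)
    rw [← totalDegree_zero_iff_isHomogeneous, totalDegree_eq_zero_iff_eq_C] at this
    exact ⟨_, this⟩
  choose a ha using h0
  refine ⟨a, ?_⟩
  have := hg.sum_X_mul_pderiv
  simp only [ha, one_smul] at this
  rw [← this]
  exact Finset.sum_congr rfl fun i _ => mul_comm _ _

theorem C_ofNat2 : (C 2 : MvPolynomial (Fin 3) k) = 2 := map_ofNat C 2
theorem C_ofNat3 : (C 3 : MvPolynomial (Fin 3) k) = 3 := map_ofNat C 3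
theorem C_ofNat6 : (C 6 : MvPolynomial (Fin 3) k) = 6 := map_ofNat C 6

theorem C_half_aux (n : k) (hn : n ≠ 0) (g h : MvPolynomial (Fin 3) k) (e : h = C n * g) :
    g = C n⁻¹ * h := by
  rw [e, ← mul_assoc, ← C_mul, inv_mul_cancel₀ hn, C_1, one_mul]

theorem hom_succ {g : MvPolynomial (Fin 3) k} {n : ℕ} (hg : g.IsHomogeneous n) (hn : n ≠ 0) :
    g = C (n : k)⁻¹ * ∑ i, X i * pderiv i g := by
  apply C_half_aux _ (by exact_mod_cast hn)
  rw [hg.sum_X_mul_pderiv, nsmul_eq_mul]; simp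

noncomputable def cub (a b c d e f g h i j : k) : MvPolynomial (Fin 3) k :=
  C a * X 0 ^ 3 + C b * X 1 ^ 3 + C c * X 2 ^ 3 + C d * (X 0 ^ 2 * X 1) + C e * (X 0 ^ 2 * X 2)
   + C f * (X 1 ^ 2 * X 0) + C g * (X 1 ^ 2 * X 2) + C h * (X 2 ^ 2 * X 0) + C i * (X 2 ^ 2 * X 1)
   + C j * (X 0 * X 1 * X 2)

theorem hom3_form {f : MvPolynomial (Fin 3) k} (hf : f.IsHomogeneous 3) :
    ∃ a b c d e g h i j l : k, f = cub a b c d e g h i j l := by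
  have h2 : ∀ i j, ∃ a : Fin 3 → k, pderiv j (pderiv i f) = ∑ l, C (a l) * X l := fun i j =>
    hom1_form (hf.pderiv.pderiv)
  choose a ha using h2
  have h1 : ∀ i, pderiv i f = C (2 : k)⁻¹ * ∑ j, X j * ∑ l, C (a i j l) * X l := fun i => by
    have := hom_succ (hf.pderiv (i := i)) (by norm_num)
    simp only [ha] at this
    exact_mod_cast this
  have h0 := hom_succ hf (by norm_num)
  simp only [h1, Fin.sum_univ_three] at h0
  let t := (3 : k)⁻¹ * 2⁻¹
  refine ⟨t * a 0 0 0, t * a 1 1 1, t * a 2 2 2, t * (a 0 0 1 + a 0 1 0 + a 1 0 0),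
    t * (a 0 0 2 + a 0 2 0 + a 2 0 0), t * (a 1 1 0 + a 1 0 1 + a 0 1 1),
    t * (a 1 1 2 + a 1 2 1 + a 2 1 1), t * (a 2 2 0 + a 2 0 2 + a 0 2 2),
    t * (a 2 2 1 + a 2 1 2 + a 1 2 2),
    t * (a 0 1 2 + a 0 2 1 + a 1 0 2 + a 1 2 0 + a 2 0 1 + a 2 1 0), ?_⟩
  rw [h0]
  simp only [cub, t, C_mul, C_add, Nat.cast_ofNat]
  ring

theorem cub_zero {a b c d e f g h i j : k} (H : cub a b c d e f g h i j = 0) :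
    a = 0 ∧ b = 0 ∧ c = 0 ∧ d = 0 ∧ e = 0 ∧ f = 0 ∧ g = 0 ∧ h = 0 ∧ i = 0 ∧ j = 0 := by
  have E : ∀ x y z : k, a * x ^ 3 + b * y ^ 3 + c * z ^ 3 + d * (x ^ 2 * y) + e * (x ^ 2 * z)
      + f * (y ^ 2 * x) + g * (y ^ 2 * z) + h * (z ^ 2 * x) + i * (z ^ 2 * y)
      + j * (x * y * z) = 0 := fun x y z => by
    have := congrArg (eval ![x, y, z]) H
    simpa [cub] using this
  have h2 : (2 : k) ≠ 0 := two_ne_zero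
  have ha : a = 0 := by simpa using E 1 0 0
  have hb : b = 0 := by simpa using E 0 1 0
  have hc : c = 0 := by simpa using E 0 0 1
  subst ha hb hc
  have hd : d = 0 := mul_left_cancel₀ h2 (by linear_combination E 1 1 0 - E 1 (-1) 0)
  have hf : f = 0 := mul_left_cancel₀ h2 (by linear_combination E 1 1 0 + E 1 (-1) 0)
  have he : e = 0 := mul_left_cancel₀ h2 (by linear_combination E 1 0 1 - E 1 0 (-1))
  have hh : h = 0 := mul_left_cancel₀ h2 (by linear_combination E 1 0 1 + E 1 0 (-1))
  have hg : g = 0 := mul_left_cancel₀ h2 (by linear_combination E 0 1 1 - E 0 1 (-1))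
  have hi : i = 0 := mul_left_cancel₀ h2 (by linear_combination E 0 1 1 + E 0 1 (-1))
  subst hd hf he hh hg hi
  have hj : j = 0 := by linear_combination E 1 1 1
  simp [hj]

/-- gradient lemma -/
theorem grad_of_curl {u0 u1 u2 : MvPolynomial (Fin 3) k} (h0 : u0.IsHomogeneous 2)
    (h1 : u1.IsHomogeneous 2) (h2 : u2.IsHomogeneous 2)
    (c0 : pderiv 1 u2 = pderiv 2 u1) (c1 : pderiv 2 u0 = pderiv 0 u2)
    (c2 : pderiv 0 u1 = pderiv 1 u0) :
    ∃ f : MvPolynomial (Fin 3) k, f.IsHomogeneous 3 ∧ pderiv 0 f = u0 ∧ pderiv 1 f = u1 ∧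
      pderiv 2 f = u2 := by
  have e0 := h0.sum_X_mul_pderiv
  have e1 := h1.sum_X_mul_pderiv
  have e2 := h2.sum_X_mul_pderiv
  simp only [Fin.sum_univ_three, nsmul_eq_mul, Nat.cast_ofNat] at e0 e1 e2
  have h3 : (C (3 : k)⁻¹ : MvPolynomial (Fin 3) k) * 3 = 1 := by
    have : (3 : MvPolynomial (Fin 3) k) = C 3 := (map_ofNat C 3).symm
    rw [this, ← C_mul, inv_mul_cancel₀ (by norm_num), C_1]
  refine ⟨C (3 : k)⁻¹ * (X 0 * u0 + X 1 * u1 + X 2 * u2), ?_, ?_, ?_, ?_⟩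
  · apply IsHomogeneous.C_mul
    exact (((isHomogeneous_X k 0).mul h0).add ((isHomogeneous_X k 1).mul h1)).add
      ((isHomogeneous_X k 2).mul h2)
  · simp [pderiv_mul, pderiv_X]
    rw [c2, ← c1]
    linear_combination C (3 : k)⁻¹ * e0 + u0 * h3
  · simp [pderiv_mul, pderiv_X]
    rw [c0, ← c2]
    linear_combination C (3 : k)⁻¹ * e1 + u1 * h3
  · simp [pderiv_mul, pderiv_X]
    rw [c1, ← c0]
    linear_combination C (3 : k)⁻¹ * e2 + u2 * h3

theorem hXX (a : k) (i j : Fin 3) : (C a * (X i * X j)).IsHomogeneous 2 :=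
  ((isHomogeneous_X k i).mul (isHomogeneous_X k j)).C_mul a

theorem final_case {N : Matrix (Fin 3) (Fin 3) k} (hN : isNF N)
    {u0 u1 u2 : MvPolynomial (Fin 3) k} (h0 : u0.IsHomogeneous 2)
    (h1 : u1.IsHomogeneous 2) (h2 : u2.IsHomogeneous 2)
    (c0 : pderiv 1 u2 - pderiv 2 u1 = ∑ j, C (N 0 j) * X j)
    (c1 : pderiv 2 u0 - pderiv 0 u2 = ∑ j, C (N 1 j) * X j)
    (c2 : pderiv 0 u1 - pderiv 1 u0 = ∑ j, C (N 2 j) * X j)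
    (hJ : u0 * (∑ j, C (N 0 j) * X j) + u1 * (∑ j, C (N 1 j) * X j)
      + u2 * (∑ j, C (N 2 j) * X j) = 0) :
    CaseA u2 u0 u1 ∨ CaseB u2 u0 u1 ∨ CaseCa u2 u0 u1 ∨
      CaseCb u2 u0 u1 ∨ CaseDa u2 u0 u1 ∨ CaseDb u2 u0 u1 ∨ CaseDc u2 u0 u1 := by
  -- general reduction
  have red : ∀ w0 w1 w2 : MvPolynomial (Fin 3) k, w0.IsHomogeneous 2 → w1.IsHomogeneous 2 →
      w2.IsHomogeneous 2 → 
      pderiv 1 w2 - pderiv 2 w1 = ∑ j, C (N 0 j) * X j →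
      pderiv 2 w0 - pderiv 0 w2 = ∑ j, C (N 1 j) * X j →
      pderiv 0 w1 - pderiv 1 w0 = ∑ j, C (N 2 j) * X j →
      w0 * (∑ j, C (N 0 j) * X j) + w1 * (∑ j, C (N 1 j) * X j)
      + w2 * (∑ j, C (N 2 j) * X j) = 0 →
      ∃ f : MvPolynomial (Fin 3) k, f.IsHomogeneous 3 ∧ u0 = pderiv 0 f + w0 ∧
        u1 = pderiv 1 f + w1 ∧ u2 = pderiv 2 f + w2 ∧
        pderiv 0 f * (∑ j, C (N 0 j) * X j) + pderiv 1 f * (∑ j, C (N 1 j) * X j)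
          + pderiv 2 f * (∑ j, C (N 2 j) * X j) = 0 := by
    intro w0 w1 w2 hw0 hw1 hw2 d0 d1 d2 hw
    obtain ⟨f, hf, f0, f1, f2⟩ := grad_of_curl (h0.sub hw0) (h1.sub hw1) (h2.sub hw2)
      (by simp only [map_sub]; linear_combination c0 - d0)
      (by simp only [map_sub]; linear_combination c1 - d1)
      (by simp only [map_sub]; linear_combination c2 - d2)
    refine ⟨f, hf, by rw [f0]; ring, by rw [f1]; ring, by rw [f2]; ring, ?_⟩
    rw [f0, f1, f2]
    linear_combination hJ - hw
  have hz : (0 : MvPolynomial (Fin 3) k).IsHomogeneous 2 := isHomogeneous_zero _ _ _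
  have h22 : (C (2⁻¹ : k) * 2 : MvPolynomial (Fin 3) k) = 1 := by
    have : (2 : MvPolynomial (Fin 3) k) = C 2 := (map_ofNat C 2).symm
    rw [this, ← C_mul, inv_mul_cancel₀ (by norm_num), C_1]
  rcases hN with rfl | rfl | ⟨l, hl, rfl⟩ | rfl | ⟨a, b, c, ha, hb, hc, hab, hac, hbc, hs, rfl⟩ |
    ⟨l, hl, rfl⟩ | ⟨l, hl, rfl⟩
  · left
    obtain ⟨f, hf, f0, f1, f2, -⟩ := red 0 0 0 hz hz hz (by simp) (by simp) (by simp) (by simp)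
    exact ⟨f, hf, by simp [f2], by simp [f0], by simp [f1]⟩
  · right; left
    obtain ⟨f, hf, f0, f1, f2, hD⟩ := red (C (-1) * (X 0 * X 1)) 0 0 (hXX _ _ _) hz hz
      (by simp [Fin.sum_univ_three, pderiv_X]) (by simp [Fin.sum_univ_three, pderiv_X])
      (by simp [Fin.sum_univ_three, pderiv_X]) (by simp [Fin.sum_univ_three])
    have h3 : pderiv 2 f = 0 := by
      simpa [Fin.sum_univ_three] using hD
    refine ⟨f, hf, h3, by rw [f2, h3]; simp, by rw [f0]; simp; ring, by rw [f1]; simp⟩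
  · right; right; left
    obtain ⟨f, hf, f0, f1, f2, hD⟩ := red (C (-l) * (X 1 * X 2)) 0 0 (hXX _ _ _) hz hz
      (by simp [Fin.sum_univ_three, pderiv_X]) (by simp [Fin.sum_univ_three, pderiv_X])
      (by simp [Fin.sum_univ_three, pderiv_X]) (by simp [Fin.sum_univ_three])
    obtain ⟨x0, x1, x2, x3, x4, x5, x6, x7, x8, x9, rfl⟩ := hom3_form hf
    have : cub 0 (-3*l*x1) (3*l*x2) (-l*x3) (l*x4) (-2*l*x5) (-l*x6) (2*l*x7) (l*x8) 0 = 0 := by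
      rw [← hD]
      simp [cub, Fin.sum_univ_three, pderiv_X, C_ofNat2, C_ofNat3, C_ofNat6]
      ring
    have := cub_zero this
    simp [hl] at this
    obtain ⟨rfl, rfl, rfl, rfl, rfl, rfl, rfl, rfl⟩ := this
    refine ⟨l, 2⁻¹ * x9, x0, hl, cub x0 0 0 0 0 0 0 0 0 x9, ?_, by rw [f2]; simp,
      by rw [f0]; simp; ring, by rw [f1]; simp⟩
    simp only [cub, C_mul, C_0]
    linear_combination (- C x9 * (X 0 * X 1 * X 2)) * h22
  · right; right; right; left
    obtain ⟨f, hf, f0, f1, f2, hD⟩ := red (C 1 * (X 0 * X 2) + C (-2⁻¹) * (X 1 * X 1)) 0 0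
      ((hXX _ _ _).add (hXX _ _ _)) hz hz
      (by simp [Fin.sum_univ_three, pderiv_X]) (by simp [Fin.sum_univ_three, pderiv_X])
      (by simp [Fin.sum_univ_three, pderiv_X]; linear_combination X 1 * h22) 
      (by simp [Fin.sum_univ_three])
    obtain ⟨x0, x1, x2, x3, x4, x5, x6, x7, x8, x9, rfl⟩ := hom3_form hf
    have : cub x3 x6 0 (2*x5+x4) x9 (3*x1+x9) (2*x8) x8 (3*x2) (2*x6+2*x7) = 0 := by
      rw [← hD]
      simp [cub, Fin.sum_univ_three, pderiv_X, C_ofNat2, C_ofNat3, C_ofNat6]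
      ring
    have := cub_zero this
    simp at this
    obtain ⟨rfl, rfl, h4, rfl, h5, rfl, rfl, h6⟩ := this
    have h4 : x4 = -2 * x5 := by linear_combination h4
    simp at h5 h6
    subst h4 h5 h6
    refine ⟨x5, x0, _, ?_, by rw [f2, add_zero],
      by rw [f0]; simp; ring, by rw [f1]; simp⟩
    simp [cub, C_ofNat2]
    ring
  · right; right; right; right; left
    obtain ⟨f, hf, f0, f1, f2, hD⟩ := red (C b * (X 1 * X 2)) (C (-a) * (X 0 * X 2)) 0
      (hXX _ _ _) (hXX _ _ _) hz
      (by simp [Fin.sum_univ_three, pderiv_X]) (by simp [Fin.sum_univ_three, pderiv_X])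
      (by
        have : c = -a-b := by linear_combination hs
        simp [Fin.sum_univ_three, pderiv_X, this]; ring)
      (by simp [Fin.sum_univ_three]; ring)
    obtain ⟨x0, x1, x2, x3, x4, x5, x6, x7, x8, x9, rfl⟩ := hom3_form hf
    have : cub (3*a*x0) (3*b*x1) (3*c*x2) ((2*a+b)*x3) ((2*a+c)*x4) ((2*b+a)*x5) ((2*b+c)*x6)
        ((2*c+a)*x7) ((2*c+b)*x8) ((a+b+c)*x9) = 0 := by
      rw [← hD]
      simp [cub, Fin.sum_univ_three, pderiv_X, C_ofNat2, C_ofNat3, C_ofNat6]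
      ring
    have := cub_zero this
    have n1 : 2*a+b ≠ 0 := fun h => hac (by linear_combination h - hs)
    have n2 : 2*a+c ≠ 0 := fun h => hab (by linear_combination h - hs)
    have n3 : 2*b+a ≠ 0 := fun h => hbc (by linear_combination h - hs)
    have n4 : 2*b+c ≠ 0 := fun h => hab (by linear_combination hs - h)
    have n5 : 2*c+a ≠ 0 := fun h => hbc (by linear_combination hs - h)
    have n6 : 2*c+b ≠ 0 := fun h => hac (by linear_combination hs - h)
    simp [ha, hb, hc, n1, n2, n3, n4, n5, n6] at this
    obtain ⟨rfl, rfl, rfl, rfl, rfl, rfl, rfl, rfl, rfl, -⟩ := this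
    refine ⟨a, b, c, 2⁻¹ * x9, ha, hb, hc, hab, hac, hbc, hs, cub 0 0 0 0 0 0 0 0 0 x9, ?_,
      by rw [f2]; simp, by rw [f0], by rw [f1]; simp; ring⟩
    simp only [cub, C_mul, C_0]
    linear_combination (- C x9 * (X 0 * X 1 * X 2)) * h22
  · right; right; right; right; right; left
    obtain ⟨f, hf, f0, f1, f2, hD⟩ := red (C l * (X 1 * X 2)) (C (-l) * (X 0 * X 2)) 0
      (hXX _ _ _) (hXX _ _ _) hz
      (by simp [Fin.sum_univ_three, pderiv_X]) (by simp [Fin.sum_univ_three, pderiv_X])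
      (by simp [Fin.sum_univ_three, pderiv_X, C_ofNat2]; ring)
      (by simp [Fin.sum_univ_three]; ring)
    obtain ⟨x0, x1, x2, x3, x4, x5, x6, x7, x8, x9, rfl⟩ := hom3_form hf
    have : cub (3*l*x0) (3*l*x1) (-6*l*x2) (3*l*x3) 0 (3*l*x5) 0
        (-3*l*x7) (-3*l*x8) 0 = 0 := by
      rw [← hD]
      simp [cub, Fin.sum_univ_three, pderiv_X, C_ofNat2, C_ofNat3, C_ofNat6]
      ring
    have := cub_zero this
    simp [hl] at this
    obtain ⟨rfl, rfl, rfl, rfl, rfl, rfl, rfl⟩ := this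
    refine ⟨l, hl, C x4 * (X 0 * X 0) + C x6 * (X 1 * X 1) + C x9 * (X 0 * X 1),
      ((hXX _ _ _).add (hXX _ _ _)).add (hXX _ _ _), by simp [pderiv_X], _, ?_,
      by rw [f2, add_zero], by rw [f0], by rw [f1]; simp; ring⟩
    simp [cub]; ring
  · right; right; right; right; right; right
    obtain ⟨f, hf, f0, f1, f2, hD⟩ := red (C l * (X 1 * X 2)) (C (-l) * (X 0 * X 2))
      (C (-(l*2⁻¹)) * (X 0 * X 0))
      (hXX _ _ _) (hXX _ _ _) (hXX _ _ _)
      (by simp [Fin.sum_univ_three, pderiv_X])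
      (by simp [Fin.sum_univ_three, pderiv_X]; linear_combination C l * X 0 * h22)
      (by simp [Fin.sum_univ_three, pderiv_X, C_ofNat2]; ring)
      (by simp [Fin.sum_univ_three, C_ofNat2]; linear_combination C l * C l * X 0 ^ 2 * X 2 * h22)
    obtain ⟨x0, x1, x2, x3, x4, x5, x6, x7, x8, x9, rfl⟩ := hom3_form hf
    have : cub (3*l*x0+l*x3) (3*l*x1) (-6*l*x2) (3*l*x3+2*l*x5) (l*x9) (3*l*x5+3*l*x1) 0
        (-3*l*x7+l*x8) (-3*l*x8) (2*l*x6) = 0 := by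
      rw [← hD]
      simp [cub, Fin.sum_univ_three, pderiv_X, C_ofNat2, C_ofNat3, C_ofNat6]
      ring
    have := cub_zero this
    simp [hl] at this
    obtain ⟨e0, rfl, rfl, e3, rfl, e5, e7, rfl, rfl⟩ := this
    simp [hl] at e5 e7
    subst e5 e7
    simp [hl] at e3
    subst e3
    simp [hl] at e0
    subst e0
    refine ⟨l, x4, hl, _, ?_,
      by rw [f2, div_eq_mul_inv]; simp; ring, by rw [f0], by rw [f1]; simp; ring⟩
    simp [cub]
end Pol

section Tr
variable {k : Type*} [Field k]

theorem linSubst_C (A : Matrix (Fin 3) (Fin 3) k) (c : k) : linSubst A (C c) = C c := by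
  simp [linSubst]

theorem linSubst_hom (A : Matrix (Fin 3) (Fin 3) k) {f : MvPolynomial (Fin 3) k} {n : ℕ}
    (hf : f.IsHomogeneous n) : (linSubst A f).IsHomogeneous n := by
  have := hf.aeval (fun i => ∑ j, C (A i j) * X j) (n := 1)
    (fun i => IsHomogeneous.sum _ _ _ fun j _ => isHomogeneous_C_mul_X _ _)
  rw [one_mul] at this
  exact this

theorem pderiv_linSubst (B : Matrix (Fin 3) (Fin 3) k) (l : Fin 3)
    (f : MvPolynomial (Fin 3) k) :
    pderiv l (linSubst B f) = ∑ i, C (B i l) * linSubst B (pderiv i f) := by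
  induction f using MvPolynomial.induction_on with
  | C a => simp [linSubst_C]
  | add p q hp hq => simp only [map_add, hp, hq, mul_add, Finset.sum_add_distrib]
  | mul_X p j hp =>
    have hX : pderiv l (linSubst B (X j)) = C (B j l) := by
      simp [linSubst, pderiv_X, Pi.single_apply]
    have hs : ∑ i, C (B i l) * (linSubst B p * linSubst B (pderiv i (X j : MvPolynomial (Fin 3) k)))
        = linSubst B p * C (B j l) := by
      rw [Finset.sum_eq_single j]
      · simp; ring
      · intro b _ hb
        simp [pderiv_X_of_ne hb.symm]
      · simp
    simp only [map_mul, pderiv_mul, hp, hX, map_add, mul_add, Finset.sum_add_distrib, hs,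
      Finset.sum_mul]
    simp only [mul_assoc]

theorem qB_lin (A : Matrix (Fin 3) (Fin 3) k) (y : Fin 3 → Fin 3 → MvPolynomial (Fin 3) k)
    (i j : Fin 3) : qBracket y (linSubst A (X i)) (linSubst A (X j)) =
      ∑ p, ∑ q, y p q * C (A i p) * C (A j q) := by
  have hX : ∀ l j, pderiv l (linSubst A (X j)) = C (A j l) := fun l j => by
    simp [linSubst, pderiv_X, Pi.single_apply]
  simp only [qBracket, hX]

/-- divergence of transformed bracket -/
theorem div_tr (A : Matrix (Fin 3) (Fin 3) k) (hA : IsUnit A.det)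
    (y : Fin 3 → Fin 3 → MvPolynomial (Fin 3) k) (i : Fin 3) :
    ∑ j, pderiv j (linSubst A⁻¹ (∑ p, ∑ q, y p q * C (A i p) * C (A j q))) =
      linSubst A⁻¹ (∑ p, C (A i p) * ∑ q, pderiv q (y p q)) := by
  have hB : ∀ l q, ∑ j, C (A⁻¹ l j) * C (A j q) =
      (C (if l = q then 1 else 0) : MvPolynomial (Fin 3) k) := fun l q => by
    have := congrFun (congrFun (Matrix.nonsing_inv_mul A hA) l) q
    rw [Matrix.mul_apply, Matrix.one_apply] at this
    rw [← this]; simp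
  have step : ∀ j, pderiv j (linSubst A⁻¹ (∑ p, ∑ q, y p q * C (A i p) * C (A j q))) =
      ∑ l, ∑ p, ∑ q, (C (A⁻¹ l j) * C (A j q)) *
        (C (A i p) * linSubst A⁻¹ (pderiv l (y p q))) := fun j => by
    rw [pderiv_linSubst]
    refine Finset.sum_congr rfl fun l _ => ?_
    simp only [map_sum, Finset.mul_sum]
    refine Finset.sum_congr rfl fun p _ => Finset.sum_congr rfl fun q _ => ?_
    simp [pderiv_mul, linSubst_C]
    ring
  simp only [step]
  rw [Finset.sum_comm]
  have : ∀ l : Fin 3, ∑ j, ∑ p, ∑ q, (C (A⁻¹ l j) * C (A j q)) *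
        (C (A i p) * linSubst A⁻¹ (pderiv l (y p q))) =
      ∑ p, C (A i p) * linSubst A⁻¹ (pderiv l (y p l)) := fun l => by
    rw [Finset.sum_comm]
    refine Finset.sum_congr rfl fun p _ => ?_
    rw [Finset.sum_comm]
    simp only [← Finset.sum_mul, hB]
    simp
  simp only [this]
  rw [Finset.sum_comm]
  simp only [map_sum, map_mul, linSubst_C, Finset.mul_sum]

theorem linSubst_inv (A : Matrix (Fin 3) (Fin 3) k) (hA : IsUnit A.det)
    (f : MvPolynomial (Fin 3) k) : linSubst A⁻¹ (linSubst A f) = f := by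
  have : (linSubst A⁻¹).comp (linSubst A) = AlgHom.id k (MvPolynomial (Fin 3) k) := by
    apply MvPolynomial.algHom_ext
    intro i
    have e : ∀ (B : Matrix (Fin 3) (Fin 3) k) j, linSubst B (X j) = ∑ l, C (B j l) * X l :=
      fun B j => by simp [linSubst]
    have hB : ∀ q, ∑ j, C (A i j) * C (A⁻¹ j q) =
        (C (if i = q then 1 else 0) : MvPolynomial (Fin 3) k) := fun q => by
      have := congrFun (congrFun (Matrix.mul_nonsing_inv A hA) i) q
      rw [Matrix.mul_apply, Matrix.one_apply] at this
      rw [← this]; simp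
    simp only [AlgHom.comp_apply, e, map_sum, map_mul, linSubst_C, Finset.mul_sum, ← mul_assoc]
    rw [Finset.sum_comm]
    simp only [← Finset.sum_mul, hB]
    simp
  exact DFunLike.congr_fun this f

theorem pderiv_comm3 (i j : Fin 3) (f : MvPolynomial (Fin 3) k) :
    pderiv i (pderiv j f) = pderiv j (pderiv i f) := by
  induction f using MvPolynomial.induction_on with
  | C a => simp
  | add p q hp hq => simp only [map_add, hp, hq]
  | mul_X p l hp =>
    simp only [pderiv_mul, map_add, hp, pderiv_X, Pi.single_apply]
    split_ifs <;> simp <;> ring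

end Tr

/-- Classification of quadratic Poisson brackets on the polynomial algebra in three
variables over an algebraically closed field of characteristic zero: up to a linear change
of variables, every such bracket has one of the normal forms a), b), ca), cb), da), db),
dc). -/
theorem classification_quadratic_poisson {k : Type*} [Field k] [CharZero k] [IsAlgClosed k]
    (y : Fin 3 → Fin 3 → MvPolynomial (Fin 3) k)
    (hhom : ∀ i j, (y i j).IsHomogeneous 2)
    (hskew : ∀ i j, y j i = - y i j)
    (hdiag : ∀ i, y i i = 0)
    (hJac : ∀ f g h : MvPolynomial (Fin 3) k,
        qBracket y (qBracket y f g) h + qBracket y (qBracket y g h) f +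
          qBracket y (qBracket y h f) g = 0) :
    ∃ A : Matrix (Fin 3) (Fin 3) k, IsUnit A.det ∧
      (fun z01 z12 z20 =>
          CaseA z01 z12 z20 ∨ CaseB z01 z12 z20 ∨ CaseCa z01 z12 z20 ∨
            CaseCb z01 z12 z20 ∨ CaseDa z01 z12 z20 ∨ CaseDb z01 z12 z20 ∨
              CaseDc z01 z12 z20)
        (linSubst A⁻¹ (qBracket y (linSubst A (X 0)) (linSubst A (X 1))))
        (linSubst A⁻¹ (qBracket y (linSubst A (X 1)) (linSubst A (X 2))))
        (linSubst A⁻¹ (qBracket y (linSubst A (X 2)) (linSubst A (X 0)))) := by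
  have s10 := hskew 0 1
  have s21 := hskew 1 2
  have s02 := hskew 2 0
  have d0 := hdiag 0
  have d1 := hdiag 1
  have d2 := hdiag 2
  -- divergence vector
  have hM : ∀ i, ∃ a : Fin 3 → k, ∑ q, pderiv q (y i q) = ∑ j, C (a j) * X j := fun i =>
    hom1_form (IsHomogeneous.sum _ _ _ fun q _ => (hhom i q).pderiv)
  choose M hM using hM
  have hJ0 : y 1 2 * (∑ q, pderiv q (y 0 q)) + y 2 0 * (∑ q, pderiv q (y 1 q)) +
      y 0 1 * (∑ q, pderiv q (y 2 q)) = 0 := by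
    have h := hJac (X 0) (X 1) (X 2)
    simp [qBracket, Fin.sum_univ_three, pderiv_X, s10, s21, s02, d0, d1, d2] at h ⊢
    linear_combination h
  have htr : (Matrix.of M).trace = 0 := by
    have h : (C ((Matrix.of M).trace) : MvPolynomial (Fin 3) k) =
        ∑ i, pderiv i (∑ q, pderiv q (y i q)) := by
      simp only [hM]
      simp [Fin.sum_univ_three, pderiv_X, Matrix.trace_fin_three]
    have hc : ∀ i j : Fin 3, ∀ f : MvPolynomial (Fin 3) k,
        pderiv i (pderiv j f) = pderiv j (pderiv i f) := fun i j f => pderiv_comm3 i j f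
    rw [← C_eq_zero (R := k) (σ := Fin 3), h]
    simp only [Fin.sum_univ_three, s10, s21, s02, d0, d1, d2, map_add, map_neg, map_zero]
    rw [hc 1 0, hc 2 0, hc 2 1]
    ring
  obtain ⟨N, hN, A, hA, hAN⟩ := exists_nf (Matrix.of M) htr
  have hu : IsUnit A.det := isUnit_iff_ne_zero.mpr hA
  refine ⟨A, hu, ?_⟩
  let z : Fin 3 → Fin 3 → MvPolynomial (Fin 3) k := fun i j =>
    linSubst A⁻¹ (∑ p, ∑ q, y p q * C (A i p) * C (A j q))
  have hz : ∀ i j, linSubst A⁻¹ (qBracket y (linSubst A (X i)) (linSubst A (X j))) = z i j :=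
    fun i j => by rw [qB_lin]
  simp only [hz]
  have hzh : ∀ i j, (z i j).IsHomogeneous 2 := fun i j => by
    apply linSubst_hom
    refine IsHomogeneous.sum _ _ _ fun p _ => IsHomogeneous.sum _ _ _ fun q _ => ?_
    have := ((hhom p q).C_mul (A i p)).C_mul (A j q)
    convert this using 1
    ring
  have zs : ∀ i j, z j i = - z i j := fun i j => by
    simp only [z]
    rw [← map_neg]
    congr 1
    simp only [Fin.sum_univ_three, s10, s21, s02, d0, d1, d2]
    ring
  have zd : ∀ i, z i i = 0 := fun i => by
    simp only [z]
    rw [← map_zero (linSubst A⁻¹)]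
    congr 1
    simp only [Fin.sum_univ_three, s10, s21, s02, d0, d1, d2]
    ring
  have hv : ∀ i, linSubst A⁻¹ (∑ p, C (A i p) * ∑ q, pderiv q (y p q)) =
      ∑ j, C (N i j) * X j := fun i => by
    have e1 : ∑ p, C (A i p) * ∑ q, pderiv q (y p q) =
        linSubst A (∑ j, C (N i j) * X j) := by
      have e2 : ∀ j, ∑ p, A i p * M p j = ∑ p, N i p * A p j := fun j => by
        have := congrFun (congrFun hAN i) j
        simpa [Matrix.mul_apply] using this
      have e3 : ∀ j, ∑ p, (C (A i p) * C (M p j) : MvPolynomial (Fin 3) k) =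
          ∑ p, C (N i p) * C (A p j) := fun j => by
        have := congrArg (C : k → MvPolynomial (Fin 3) k) (e2 j)
        simpa using this
      simp only [hM, map_sum, map_mul, linSubst_C]
      have e4 : ∀ j, linSubst A (X j) = ∑ l, C (A j l) * X l := fun j => by simp [linSubst]
      simp only [e4]
      have a0 := e3 0
      have a1 := e3 1
      have a2 := e3 2
      simp only [Fin.sum_univ_three] at a0 a1 a2 ⊢
      linear_combination X 0 * a0 + X 1 * a1 + X 2 * a2
    rw [e1]
    simp only [map_sum, map_mul, linSubst_C, linSubst_inv A hu]
  have hdiv : ∀ i, ∑ j, pderiv j (z i j) = ∑ j, C (N i j) * X j := fun i => by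
    rw [← hv i]
    exact div_tr A hu y i
  have g0 := hdiv 0
  have g1 := hdiv 1
  have g2 := hdiv 2
  rw [Fin.sum_univ_three] at g0 g1 g2
  apply final_case hN (hzh 1 2) (hzh 2 0) (hzh 0 1)
  · rw [← g0, zd, zs 2 0]; simp; ring
  · rw [← g1, zd, zs 0 1]; simp; ring
  · rw [← g2, zd, zs 1 2]; simp; ring
  · rw [← hv 0, ← hv 1, ← hv 2]
    simp only [z]
    simp only [← map_mul, ← map_add]
    refine (congrArg (linSubst A⁻¹) ?_).trans (map_zero _)
    have hdet : (C A.det : MvPolynomial (Fin 3) k) * (y 1 2 * (∑ q, pderiv q (y 0 q)) +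
      y 2 0 * (∑ q, pderiv q (y 1 q)) + y 0 1 * (∑ q, pderiv q (y 2 q))) = 0 := by
        rw [hJ0, mul_zero]
    rw [← hdet, Matrix.det_fin_three]
    rw [Fin.sum_univ_three (fun p => C (A 0 p) * ∑ q, pderiv q (y p q)),
      Fin.sum_univ_three (fun p => C (A 1 p) * ∑ q, pderiv q (y p q)),
      Fin.sum_univ_three (fun p => C (A 2 p) * ∑ q, pderiv q (y p q))]
    generalize ∑ q, pderiv q (y 0 q) = v0
    generalize ∑ q, pderiv q (y 1 q) = v1
    generalize ∑ q, pderiv q (y 2 q) = v2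
    simp only [Fin.sum_univ_three, s10, s21, s02, d0, d1, d2, C_add, C_sub, C_mul]
    ring
end

section
/- Let k be a field of characteristic zero, V a finite-dimensional k-vector space, and I ⊆ V⊗V a subspace such that the quadratic algebra (V,I) is weakly Koszul, i.e. for every m ≥ 3, writing I^m_i = V^{⊗(i−1)} ⊗ I ⊗ V^{⊗(m−1−i)} ⊆ V^{⊗m} (1 ≤ i ≤ m−1), one has I^m_1 ∩ (I^m_2 + I^m_3 + ⋯ + I^m_{m−1}) = I^m_1 ∩ I^m_2 + I^m_1 ∩ (I^m_3 + ⋯ + I^m_{m−1}). Let R = k[[ħ]], V_R = V⊗_k R, and let I_ħ ⊆ V_R ⊗_R V_R be an R-submodule that is a direct summand and reduces to I modulo ħ. If I³_ħ = V_R ⊗ I_ħ + I_ħ ⊗ V_R is a direct summand of V_R^{⊗3}, then for every m ≥ 2 the R-submodule I^m_ħ = Σ_{i=1}^{m−1} V_R^{⊗(i−1)} ⊗ I_ħ ⊗ V_R^{⊗(m−1−i)} is a direct summand of V_R^{⊗m}. -/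
set_option synthInstance.maxHeartbeats 1000000
set_option maxHeartbeats 1000000

open TensorProduct

section PosSub

variable (S : Type*) (M : Type*) [CommRing S] [AddCommGroup M] [Module S M]

/-- The degree-one component `M ⊆ T(M)` of the tensor algebra, i.e. the range of the
canonical inclusion. -/
noncomputable def deg1 : Submodule S (TensorAlgebra S M) :=
  LinearMap.range (TensorAlgebra.ι S (M := M))

/-- The canonical (injective) map `M ⊗ M → T(M)` given by multiplication. -/
noncomputable def mul2 : M ⊗[S] M →ₗ[S] TensorAlgebra S M :=
  LinearMap.mul' S (TensorAlgebra S M) ∘ₗ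
    TensorProduct.map (TensorAlgebra.ι S) (TensorAlgebra.ι S)

/-- The submodule `M^{⊗a} ⊗ J ⊗ M^{⊗b}` of `M^{⊗(a+b+2)}`, realized inside the tensor
algebra `T(M)` as the product of submodules `(deg1)^a * J * (deg1)^b`.  For `1 ≤ i ≤ m-1`,
the submodule `I^m_i` of the paper is `posSub J (i-1) (m-1-i)`. -/
noncomputable def posSub (J : Submodule S (M ⊗[S] M)) (a b : ℕ) :
    Submodule S (TensorAlgebra S M) :=
  deg1 S M ^ a * Submodule.map (mul2 S M) J * deg1 S M ^ b

/-- `N` is a splitting (direct summand) submodule of the submodule `A`. -/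
def IsSummandIn {T : Type*} [AddCommGroup T] [Module S T] (N A : Submodule S T) : Prop :=
  ∃ C : Submodule S T, C ≤ A ∧ N ⊓ C = ⊥ ∧ N ⊔ C = A

end PosSub

/-- The quadratic algebra `(V, I)` is weakly Koszul: for all `m ≥ 3`,
`I^m_1 ⊓ (I^m_2 + ⋯ + I^m_{m-1}) = I^m_1 ⊓ I^m_2 + I^m_1 ⊓ (I^m_3 + ⋯ + I^m_{m-1})`. -/
def WeaklyKoszul (k V : Type*) [Field k] [AddCommGroup V] [Module k V]
    (I : Submodule k (V ⊗[k] V)) : Prop :=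
  ∀ m : ℕ, 3 ≤ m →
    posSub k V I 0 (m - 2) ⊓ (∑ i ∈ Finset.Icc 2 (m - 1), posSub k V I (i - 1) (m - 1 - i)) =
      posSub k V I 0 (m - 2) ⊓ posSub k V I 1 (m - 3) ⊔
        posSub k V I 0 (m - 2) ⊓
          (∑ i ∈ Finset.Icc 3 (m - 1), posSub k V I (i - 1) (m - 1 - i))

/-- The canonical `k`-linear inclusion `V ⊗[k] V → V_R ⊗[R] V_R`, `v ⊗ w ↦ (1⊗v) ⊗ (1⊗w)`,
where `R = k[[ħ]]` and `V_R = R ⊗[k] V`. -/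
noncomputable def up2 (k V : Type*) [Field k] [AddCommGroup V] [Module k V] :
    V ⊗[k] V →ₗ[k]
      (PowerSeries k ⊗[k] V) ⊗[PowerSeries k] (PowerSeries k ⊗[k] V) :=
  TensorProduct.lift (LinearMap.mk₂ k
    (fun v w => ((1 : PowerSeries k) ⊗ₜ[k] v) ⊗ₜ[PowerSeries k] ((1 : PowerSeries k) ⊗ₜ[k] w))
    (by intro m₁ m₂ n; simp [TensorProduct.tmul_add, TensorProduct.add_tmul])
    (by intro c m n; simp [TensorProduct.tmul_smul, TensorProduct.smul_tmul'])
    (by intro m n₁ n₂; simp [TensorProduct.tmul_add])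
    (by intro c m n; simp [TensorProduct.tmul_smul]))


section Aux

variable {R M ι : Type*} [CommRing R] [AddCommGroup M] [Module R M]

theorem aux_B_one (b : Module.Basis ι R M) : b.tensorAlgebra 1 = 1 := by
  simp [Module.Basis.tensorAlgebra, FreeAlgebra.basisFreeMonoid]
  rfl

theorem aux_ind (b : Module.Basis ι R M) {p : TensorAlgebra R M → Prop}
    (h0 : p 0) (ha : ∀ x y, p x → p y → p (x + y)) (hs : ∀ (c : R) x, p x → p (c • x))
    (hb : ∀ w, p (b.tensorAlgebra w)) (x : TensorAlgebra R M) : p x := by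
  have hx := b.tensorAlgebra.mem_span x
  induction hx using Submodule.span_induction with
  | mem x h => obtain ⟨w, rfl⟩ := h; exact hb w
  | zero => exact h0
  | add x y _ _ h1 h2 => exact ha x y h1 h2
  | smul c x _ h => exact hs c x h

theorem aux_B_mul (b : Module.Basis ι R M) (u w : FreeMonoid ι) :
    b.tensorAlgebra (u * w) = b.tensorAlgebra u * b.tensorAlgebra w := by
  simp [Module.Basis.tensorAlgebra, FreeAlgebra.basisFreeMonoid, FreeAlgebra.equivMonoidAlgebraFreeMonoid]

theorem aux_B_of (b : Module.Basis ι R M) (i : ι) :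
    b.tensorAlgebra (FreeMonoid.of i) = TensorAlgebra.ι R (b i) := by
  simp [Module.Basis.tensorAlgebra, FreeAlgebra.basisFreeMonoid, FreeAlgebra.equivMonoidAlgebraFreeMonoid]

open Classical in
noncomputable def auxL (b : Module.Basis ι R M) (i : ι) :
    TensorAlgebra R M →ₗ[R] TensorAlgebra R M :=
  b.tensorAlgebra.constr R (fun w => if w.toList.head? = some i then
    b.tensorAlgebra (FreeMonoid.ofList w.toList.tail) else 0)

open Classical in
noncomputable def auxR (b : Module.Basis ι R M) (i : ι) :
    TensorAlgebra R M →ₗ[R] TensorAlgebra R M :=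
  b.tensorAlgebra.constr R (fun w => if w.toList.getLast? = some i then
    b.tensorAlgebra (FreeMonoid.ofList w.toList.dropLast) else 0)

open Classical in
theorem auxL_mul (b : Module.Basis ι R M) (i j : ι) (t : TensorAlgebra R M) :
    auxL b i (TensorAlgebra.ι R (b j) * t) = if j = i then t else 0 := by
  have : (auxL b i) ∘ₗ LinearMap.mulLeft R (TensorAlgebra.ι R (b j)) =
      if j = i then LinearMap.id else 0 := by
    apply b.tensorAlgebra.ext
    intro w
    rw [LinearMap.comp_apply, LinearMap.mulLeft_apply, ← aux_B_of, ← aux_B_mul, auxL,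
      Module.Basis.constr_basis]
    split_ifs <;> simp_all
  have h := LinearMap.congr_fun this t
  rw [LinearMap.comp_apply, LinearMap.mulLeft_apply] at h
  rw [h]
  split_ifs <;> simp

open Classical in
theorem auxR_mul (b : Module.Basis ι R M) (i j : ι) (t : TensorAlgebra R M) :
    auxR b i (t * TensorAlgebra.ι R (b j)) = if j = i then t else 0 := by
  have : (auxR b i) ∘ₗ LinearMap.mulRight R (TensorAlgebra.ι R (b j)) =
      if j = i then LinearMap.id else 0 := by
    apply b.tensorAlgebra.ext
    intro w
    rw [LinearMap.comp_apply, LinearMap.mulRight_apply, ← aux_B_of, ← aux_B_mul, auxR,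
      Module.Basis.constr_basis]
    split_ifs <;> simp_all
  have h := LinearMap.congr_fun this t
  rw [LinearMap.comp_apply, LinearMap.mulRight_apply] at h
  rw [h]
  split_ifs <;> simp

theorem auxL_one (b : Module.Basis ι R M) (i : ι) : auxL b i 1 = 0 := by
  rw [← aux_B_one b, auxL, Module.Basis.constr_basis]; simp

theorem auxR_one (b : Module.Basis ι R M) (i : ι) : auxR b i 1 = 0 := by
  rw [← aux_B_one b, auxR, Module.Basis.constr_basis]; simp

theorem auxL_decomp [Fintype ι] (b : Module.Basis ι R M) (x : TensorAlgebra R M) :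
    ∃ r : R, x = algebraMap R _ r + ∑ i, TensorAlgebra.ι R (b i) * auxL b i x := by
  classical
  refine aux_ind b (p := fun x => ∃ r : R, x = algebraMap R _ r + ∑ i, TensorAlgebra.ι R (b i) * auxL b i x) ⟨0, by simp⟩ ?_ ?_ ?_ x
  · intro x y hx hy
    obtain ⟨r, hr⟩ := hx
    obtain ⟨s, hs⟩ := hy
    refine ⟨r + s, ?_⟩
    simp only [map_add, mul_add, Finset.sum_add_distrib]
    nth_rewrite 1 [hr, hs]
    abel
  · intro c x hx
    obtain ⟨r, hr⟩ := hx
    refine ⟨c * r, ?_⟩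
    simp only [map_smul, mul_smul_comm, ← Finset.smul_sum, map_mul, ← Algebra.smul_def, ← smul_add]
    rw [← hr]
  · intro w
    induction w using FreeMonoid.inductionOn' with
    | one => exact ⟨1, by simp [aux_B_one, auxL_one]⟩
    | of_mul i w _ => refine ⟨0, ?_⟩; simp [aux_B_mul, aux_B_of, auxL_mul]

theorem auxR_decomp [Fintype ι] (b : Module.Basis ι R M) (x : TensorAlgebra R M) :
    ∃ r : R, x = algebraMap R _ r + ∑ i, auxR b i x * TensorAlgebra.ι R (b i) := by
  classical
  refine aux_ind b (p := fun x => ∃ r : R, x = algebraMap R _ r + ∑ i, auxR b i x * TensorAlgebra.ι R (b i)) ⟨0, by simp⟩ ?_ ?_ ?_ x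
  · intro x y hx hy
    obtain ⟨r, hr⟩ := hx
    obtain ⟨s, hs⟩ := hy
    refine ⟨r + s, ?_⟩
    simp only [map_add, add_mul, Finset.sum_add_distrib]
    nth_rewrite 1 [hr, hs]
    abel
  · intro c x hx
    obtain ⟨r, hr⟩ := hx
    refine ⟨c * r, ?_⟩
    simp only [map_smul, smul_mul_assoc, ← Finset.smul_sum, map_mul, ← Algebra.smul_def, ← smul_add]
    rw [← hr]
  · intro w
    rcases List.eq_nil_or_concat w.toList with h | ⟨l, i, h⟩
    · have : w = 1 := h
      subst this
      exact ⟨1, by simp [aux_B_one, auxR_one]⟩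
    · have : w = FreeMonoid.ofList l * FreeMonoid.of i := by
        apply FreeMonoid.toList.injective; rw [h]; simp
      subst this
      refine ⟨0, ?_⟩; simp [aux_B_mul, aux_B_of, auxR_mul]


def AuxSat (h : R) {T : Type*} [AddCommGroup T] [Module R T] (N : Submodule R T) : Prop :=
  ∀ x, h • x ∈ N → x ∈ N

theorem auxL_mem [Fintype ι] (b : Module.Basis ι R M) (N : Submodule R (TensorAlgebra R M))
    {y : TensorAlgebra R M} (hy : y ∈ deg1 R M * N) :
    (∀ i, auxL b i y ∈ N) ∧ y = ∑ i, TensorAlgebra.ι R (b i) * auxL b i y := by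
  classical
  induction hy using Submodule.mul_induction_on' with
  | mem_mul_mem m hm n hn =>
    obtain ⟨v, rfl⟩ := hm
    have hv0 : TensorAlgebra.ι R v = ∑ i, b.repr v i • TensorAlgebra.ι R (b i) := by
      conv_lhs => rw [← b.sum_repr v]
      rw [map_sum]
      simp only [map_smul]
    have hv : ∀ i, auxL b i (TensorAlgebra.ι R v * n) = b.repr v i • n := by
      intro i
      rw [hv0]
      simp [Finset.sum_mul, auxL_mul]
    simp only [hv]
    refine ⟨fun i => N.smul_mem _ hn, ?_⟩
    rw [hv0]
    simp [Finset.sum_mul]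
  | add x _ y _ hx hy =>
    refine ⟨fun i => by rw [map_add]; exact N.add_mem (hx.1 i) (hy.1 i), ?_⟩
    simp only [map_add, mul_add, Finset.sum_add_distrib]
    rw [← hx.2, ← hy.2]

theorem auxR_mem [Fintype ι] (b : Module.Basis ι R M) (N : Submodule R (TensorAlgebra R M))
    {y : TensorAlgebra R M} (hy : y ∈ N * deg1 R M) :
    (∀ i, auxR b i y ∈ N) ∧ y = ∑ i, auxR b i y * TensorAlgebra.ι R (b i) := by
  classical
  induction hy using Submodule.mul_induction_on' with
  | mem_mul_mem n hn m hm =>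
    obtain ⟨v, rfl⟩ := hm
    have hv0 : TensorAlgebra.ι R v = ∑ i, b.repr v i • TensorAlgebra.ι R (b i) := by
      conv_lhs => rw [← b.sum_repr v]
      rw [map_sum]
      simp only [map_smul]
    have hv : ∀ i, auxR b i (n * TensorAlgebra.ι R v) = b.repr v i • n := by
      intro i
      rw [hv0]
      simp [Finset.mul_sum, auxR_mul]
    simp only [hv]
    refine ⟨fun i => N.smul_mem _ hn, ?_⟩
    rw [hv0]
    simp [Finset.mul_sum]
  | add x _ y _ hx hy =>
    refine ⟨fun i => by rw [map_add]; exact N.add_mem (hx.1 i) (hy.1 i), ?_⟩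
    simp only [map_add, add_mul, Finset.sum_add_distrib]
    rw [← hx.2, ← hy.2]

theorem satL [Fintype ι] (b : Module.Basis ι R M) (h : R)
    (hreg : ∀ x : TensorAlgebra R M, h • x = 0 → x = 0)
    (N : Submodule R (TensorAlgebra R M)) (hN : AuxSat h N) : AuxSat h (deg1 R M * N) := by
  intro x hx
  obtain ⟨h1, h2⟩ := auxL_mem b N hx
  obtain ⟨r, hr⟩ := auxL_decomp b x
  have h0 : algebraMap R (TensorAlgebra R M) r = 0 := by
    apply hreg
    have h3 : h • x = h • algebraMap R (TensorAlgebra R M) r + h • x := by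
      conv_rhs => rw [h2]
      conv_lhs => rw [hr]
      simp only [map_smul, mul_smul_comm, ← Finset.smul_sum, smul_add]
    simpa using h3
  rw [hr, h0, zero_add]
  refine Submodule.sum_mem _ fun i _ => Submodule.mul_mem_mul ⟨_, rfl⟩ (hN _ ?_)
  rw [← map_smul]; exact h1 i

theorem satR [Fintype ι] (b : Module.Basis ι R M) (h : R)
    (hreg : ∀ x : TensorAlgebra R M, h • x = 0 → x = 0)
    (N : Submodule R (TensorAlgebra R M)) (hN : AuxSat h N) : AuxSat h (N * deg1 R M) := by
  intro x hx
  obtain ⟨h1, h2⟩ := auxR_mem b N hx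
  obtain ⟨r, hr⟩ := auxR_decomp b x
  have h0 : algebraMap R (TensorAlgebra R M) r = 0 := by
    apply hreg
    have h3 : h • x = h • algebraMap R (TensorAlgebra R M) r + h • x := by
      conv_rhs => rw [h2]
      conv_lhs => rw [hr]
      simp only [map_smul, smul_mul_assoc, ← Finset.smul_sum, smul_add]
    simpa using h3
  rw [hr, h0, zero_add]
  refine Submodule.sum_mem _ fun i _ => Submodule.mul_mem_mul (hN _ ?_) ⟨_, rfl⟩
  rw [← map_smul]; exact h1 i

theorem sat_one [Fintype ι] (b : Module.Basis ι R M) (h : R)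
    (hreg : ∀ x : TensorAlgebra R M, h • x = 0 → x = 0) :
    AuxSat h (1 : Submodule R (TensorAlgebra R M)) := by
  intro x hx
  obtain ⟨s, hs⟩ := Submodule.mem_one.1 hx
  obtain ⟨r, hr⟩ := auxL_decomp b x
  have : ∀ i, auxL b i x = 0 := by
    intro i
    apply hreg
    rw [← map_smul, ← hs, Algebra.algebraMap_eq_smul_one, map_smul, auxL_one, smul_zero]
  simp only [this, mul_zero, Finset.sum_const_zero, add_zero] at hr
  exact Submodule.mem_one.2 ⟨r, hr.symm⟩

theorem satL_pow [Fintype ι] (b : Module.Basis ι R M) (h : R)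
    (hreg : ∀ x : TensorAlgebra R M, h • x = 0 → x = 0) (n : ℕ)
    (N : Submodule R (TensorAlgebra R M)) (hN : AuxSat h N) : AuxSat h (deg1 R M ^ n * N) := by
  induction n with
  | zero => simpa using hN
  | succ n ih => rw [pow_succ', mul_assoc]; exact satL b h hreg _ ih

theorem satR_pow [Fintype ι] (b : Module.Basis ι R M) (h : R)
    (hreg : ∀ x : TensorAlgebra R M, h • x = 0 → x = 0) (n : ℕ)
    (N : Submodule R (TensorAlgebra R M)) (hN : AuxSat h N) : AuxSat h (N * deg1 R M ^ n) := by
  induction n with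
  | zero => simpa using hN
  | succ n ih => rw [pow_succ, ← mul_assoc]; exact satR b h hreg _ ih

theorem sat_pow [Fintype ι] (b : Module.Basis ι R M) (h : R)
    (hreg : ∀ x : TensorAlgebra R M, h • x = 0 → x = 0) (n : ℕ) : AuxSat h (deg1 R M ^ n) := by
  simpa using satL_pow b h hreg n _ (sat_one b h hreg)

theorem map_mul2_top : Submodule.map (mul2 R M) ⊤ = deg1 R M ^ 2 := by
  apply le_antisymm
  · rw [Submodule.map_le_iff_le_comap, ← TensorProduct.span_tmul_eq_top, Submodule.span_le]
    rintro _ ⟨v, w, rfl⟩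
    rw [pow_two]
    exact Submodule.mul_mem_mul ⟨v, rfl⟩ ⟨w, rfl⟩
  · rw [pow_two, Submodule.mul_le]
    rintro _ ⟨v, rfl⟩ _ ⟨w, rfl⟩
    exact ⟨v ⊗ₜ w, trivial, by simp [mul2]⟩

noncomputable def auxP [Fintype ι] (b : Module.Basis ι R M) (p : M ⊗[R] M →ₗ[R] M ⊗[R] M) :
    TensorAlgebra R M →ₗ[R] TensorAlgebra R M :=
  ∑ i, ∑ j, LinearMap.mulLeft R (mul2 R M (p (b i ⊗ₜ b j))) ∘ₗ auxL b j ∘ₗ auxL b i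

theorem auxP_mul [Fintype ι] (b : Module.Basis ι R M) (p : M ⊗[R] M →ₗ[R] M ⊗[R] M)
    (u : M ⊗[R] M) (t : TensorAlgebra R M) :
    auxP b p (mul2 R M u * t) = mul2 R M (p u) * t := by
  classical
  have : (auxP b p) ∘ₗ LinearMap.mulRight R t ∘ₗ mul2 R M =
      LinearMap.mulRight R t ∘ₗ mul2 R M ∘ₗ p := by
    apply (b.tensorProduct b).ext
    rintro ⟨i, j⟩
    simp [auxP, mul2, mul_assoc, auxL_mul, apply_ite]
  exact LinearMap.congr_fun this u

theorem auxP_id [Fintype ι] (b : Module.Basis ι R M)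
    (x : TensorAlgebra R M) (hx : x ∈ deg1 R M ^ 2 * ⊤) : auxP b LinearMap.id x = x := by
  rw [← map_mul2_top] at hx
  induction hx using Submodule.mul_induction_on' with
  | mem_mul_mem m hm n hn => obtain ⟨u, -, rfl⟩ := hm; rw [auxP_mul]; rfl
  | add x _ y _ hx hy => rw [map_add, hx, hy]

theorem auxP_mem [Fintype ι] (b : Module.Basis ι R M) (p : M ⊗[R] M →ₗ[R] M ⊗[R] M)
    (J K : Submodule R (M ⊗[R] M)) (N : Submodule R (TensorAlgebra R M)) (hp : ∀ u ∈ J, p u ∈ K)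
    (x : TensorAlgebra R M) (hx : x ∈ J.map (mul2 R M) * N) :
    auxP b p x ∈ K.map (mul2 R M) * N := by
  induction hx using Submodule.mul_induction_on' with
  | mem_mul_mem m hm n hn =>
    obtain ⟨u, hu, rfl⟩ := hm; rw [auxP_mul]
    exact Submodule.mul_mem_mul ⟨_, hp u hu, rfl⟩ hn
  | add x _ y _ hx hy => rw [map_add]; exact Submodule.add_mem _ hx hy

theorem mul2_inj [Fintype ι] (b : Module.Basis ι R M) :
    Function.Injective (mul2 R M) := by
  classical
  let s : TensorAlgebra R M →ₗ[R] M ⊗[R] M := ∑ i, ∑ j,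
    (LinearMap.toSpanSingleton R _ (b i ⊗ₜ[R] b j)) ∘ₗ
      TensorAlgebra.algebraMapInv.toLinearMap ∘ₗ auxL b j ∘ₗ auxL b i
  have : s ∘ₗ mul2 R M = LinearMap.id := by
    apply (b.tensorProduct b).ext
    rintro ⟨i, j⟩
    have h2 : ∀ l m, auxL b m (auxL b l (TensorAlgebra.ι R (b i) * TensorAlgebra.ι R (b j))) =
        if i = l then if j = m then 1 else 0 else 0 := by
      intro l m
      rw [auxL_mul]
      split_ifs with h1 h2
      · rw [← mul_one (TensorAlgebra.ι R (b j)), auxL_mul, if_pos h2]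
      · rw [← mul_one (TensorAlgebra.ι R (b j)), auxL_mul, if_neg h2]
      · simp
    simp [s, mul2, h2, apply_ite]
  exact Function.LeftInverse.injective (LinearMap.congr_fun this)

theorem sat_J [Fintype ι] (b : Module.Basis ι R M) (h : R)
    (hreg : ∀ x : TensorAlgebra R M, h • x = 0 → x = 0)
    (J C : Submodule R (M ⊗[R] M)) (hJ : IsCompl J C) : AuxSat h (J.map (mul2 R M)) := by
  intro x hx
  have hx2 : x ∈ deg1 R M ^ 2 := by
    apply sat_pow b h hreg
    rw [← map_mul2_top]
    exact Submodule.map_mono le_top hx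
  rw [← map_mul2_top] at hx2
  obtain ⟨u, -, rfl⟩ := hx2
  obtain ⟨v, hv, hvu⟩ := hx
  have hinj := mul2_inj b
  rw [← map_smul] at hvu
  have := hinj hvu
  subst this
  have hu : u ∈ J ⊔ C := by rw [hJ.sup_eq_top]; trivial
  obtain ⟨j, hj, c, hc, rfl⟩ := Submodule.mem_sup.1 hu
  have h1 : h • c ∈ J := by
    have := J.sub_mem hv (J.smul_mem h hj)
    simpa [smul_add] using this
  have h2 : h • c = 0 := by
    have : h • c ∈ J ⊓ C := ⟨h1, C.smul_mem _ hc⟩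
    rwa [hJ.inf_eq_bot, Submodule.mem_bot] at this
  have h3 : mul2 R M c = 0 := by
    apply hreg; rw [← map_smul, h2, map_zero]
  rw [map_add, h3, add_zero]
  exact ⟨j, hj, rfl⟩

theorem sat_mix [Fintype ι] (b : Module.Basis ι R M) (h : R)
    (hreg : ∀ x : TensorAlgebra R M, h • x = 0 → x = 0)
    (J C : Submodule R (M ⊗[R] M)) (hJ : IsCompl J C) (n : ℕ)
    (S : Submodule R (TensorAlgebra R M)) (hS : AuxSat h S) (hSn : S ≤ deg1 R M ^ n) :
    AuxSat h (J.map (mul2 R M) * deg1 R M ^ n ⊔ deg1 R M ^ 2 * S) := by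
  intro x hx
  have hJW : J.map (mul2 R M) ≤ deg1 R M ^ 2 := by
    rw [← map_mul2_top]; exact Submodule.map_mono le_top
  have hx2 : x ∈ deg1 R M ^ 2 * ⊤ := by
    apply satL_pow b h hreg 2 ⊤ (fun _ _ => trivial)
    refine (sup_le ?_ ?_ : _ ≤ deg1 R M ^ 2 * ⊤) hx
    · exact mul_le_mul' hJW le_top
    · exact mul_le_mul' le_rfl le_top
  let q : M ⊗[R] M →ₗ[R] M ⊗[R] M := J.subtype ∘ₗ J.projectionOnto C hJ
  have hqJ : ∀ u ∈ J, q u = u := fun u hu => by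
    simp only [q, LinearMap.comp_apply]
    rw [Submodule.projectionOnto_apply_left hJ ⟨u, hu⟩]; rfl
  let p := LinearMap.id - q
  have hpq : auxP b p x + auxP b q x = x := by
    conv_rhs => rw [← auxP_id b x hx2]
    simp only [auxP, p, LinearMap.sum_apply, ← Finset.sum_add_distrib]
    simp [sub_mul]
  rw [← hpq]
  obtain ⟨a, ha, c, hc, hac⟩ := Submodule.mem_sup.1 hx
  apply Submodule.add_mem
  · apply Submodule.mem_sup_right
    apply satL_pow b h hreg 2 S hS
    rw [← map_smul, ← hac, map_add]
    apply Submodule.add_mem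
    · have := auxP_mem b p J ⊥ _ (fun u hu => by simp [p, hqJ u hu]) a ha
      simp at this
      rw [this]; exact Submodule.zero_mem _
    · rw [← map_mul2_top] at hc ⊢
      exact auxP_mem b p ⊤ ⊤ _ (fun _ _ => trivial) c hc
  · apply Submodule.mem_sup_left
    apply satR_pow b h hreg n _ (sat_J b h hreg J C hJ)
    rw [← map_smul, ← hac, map_add]
    have hq : ∀ u, q u ∈ J := fun u => by simp [q]
    apply Submodule.add_mem
    · exact auxP_mem b q J J _ (fun u _ => hq u) a ha
    · rw [← map_mul2_top] at hc
      exact mul_le_mul' le_rfl hSn (auxP_mem b q ⊤ J _ (fun u _ => hq u) c hc)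

end Aux

section AuxB

theorem aux_lift {R T T' : Type*} [CommRing R] [AddCommGroup T] [Module R T] [AddCommGroup T']
    [Module R T'] (π : T →ₗ[R] T') (h : R) (hh : ∀ x, π (h • x) = 0)
    (hker : ∀ x, π x = 0 → ∃ y, x = h • y) (A B : Submodule R T) (hs : AuxSat h (A ⊔ B))
    (z : T') (hz : z ∈ A.map π ⊓ B.map π) : ∃ c ∈ A ⊓ B, π c = z := by
  obtain ⟨⟨a, ha, rfl⟩, ⟨c, hc, hac⟩⟩ := hz
  obtain ⟨y, hy⟩ := hker (a - c) (by rw [map_sub, hac, sub_self])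
  have : y ∈ A ⊔ B := by
    apply hs
    rw [← hy]
    exact Submodule.sub_mem _ (Submodule.mem_sup_left ha) (Submodule.mem_sup_right hc)
  obtain ⟨y1, h1, y2, h2, rfl⟩ := Submodule.mem_sup.1 this
  refine ⟨a - h • y1, ⟨A.sub_mem ha (A.smul_mem _ h1), ?_⟩, ?_⟩
  · have : a - h • y1 = c + h • y2 := by
      rw [smul_add] at hy
      rw [sub_eq_iff_eq_add] at hy ⊢
      rw [hy]; abel
    rw [this]
    exact B.add_mem hc (B.smul_mem _ h2)
  · rw [map_sub, hh, sub_zero]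

theorem aux_step {R T T' : Type*} [CommRing R] [AddCommGroup T] [Module R T] [AddCommGroup T']
    [Module R T'] (π : T →ₗ[R] T') (h : R) (hh : ∀ x, π (h • x) = 0)
    (hker : ∀ x, π x = 0 → ∃ y, x = h • y) (J1 J2 S3 : Submodule R T)
    (h1 : AuxSat h J1) (h12 : AuxSat h (J1 ⊔ J2)) (h13 : AuxSat h (J1 ⊔ S3))
    (h2 : AuxSat h (J2 ⊔ S3))
    (hd : J1.map π ⊓ (J2 ⊔ S3).map π ≤ J1.map π ⊓ J2.map π ⊔ J1.map π ⊓ S3.map π) :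
    AuxSat h (J1 ⊔ (J2 ⊔ S3)) := by
  intro x hx
  obtain ⟨a, ha, e, he, hae⟩ := Submodule.mem_sup.1 hx
  have hz : π a ∈ J1.map π ⊓ (J2 ⊔ S3).map π := by
    refine ⟨⟨a, ha, rfl⟩, ⟨-e, Submodule.neg_mem _ he, ?_⟩⟩
    have := hh x
    rw [← hae, map_add] at this
    rw [map_neg]
    exact (eq_neg_of_add_eq_zero_left this).symm
  obtain ⟨u, hu, v, hv, huv⟩ := Submodule.mem_sup.1 (hd hz)
  obtain ⟨c, hc, rfl⟩ := aux_lift π h hh hker J1 J2 h12 u hu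
  obtain ⟨d, hd, rfl⟩ := aux_lift π h hh hker J1 S3 h13 v hv
  obtain ⟨g, hg⟩ := hker (a - (c + d)) (by rw [map_sub, map_add, huv, sub_self])
  have hgJ : g ∈ J1 := by
    apply h1
    rw [← hg]
    exact J1.sub_mem ha (J1.add_mem hc.1 hd.1)
  have hxg : x - g ∈ J2 ⊔ S3 := by
    apply h2
    have : h • (x - g) = (c + d) + e := by
      rw [smul_sub, ← hae, ← hg]; abel
    rw [this]
    exact Submodule.add_mem _ (Submodule.add_mem _ (Submodule.mem_sup_left hc.2)
      (Submodule.mem_sup_right hd.2)) he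
  have : x = g + (x - g) := by abel
  rw [this]
  exact Submodule.add_mem _ (Submodule.mem_sup_left hgJ) (Submodule.mem_sup_right hxg)

def auxS {R T : Type*} [CommRing R] [Ring T] [Algebra R T] (J W : Submodule R T) :
    ℕ → Submodule R T
  | 0 => ⊥
  | n + 1 => J * W ^ n ⊔ W * auxS J W n

theorem auxS_sum {R T : Type*} [CommRing R] [Ring T] [Algebra R T] (J W : Submodule R T)
    (n c : ℕ) : ∑ i ∈ Finset.Icc (c + 1) (c + n), W ^ (i - 1) * J * W ^ (c + n - i) =
      W ^ c * auxS J W n := by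
  induction n generalizing c with
  | zero => simp [auxS]
  | succ n ih =>
    have : Finset.Icc (c + 1) (c + (n + 1)) =
        insert (c + 1) (Finset.Icc (c + 1 + 1) (c + 1 + n)) := by
      ext i; simp; omega
    rw [this, Finset.sum_insert (by simp)]
    have h2 : c + (n + 1) = c + 1 + n := by omega
    rw [h2, ih (c + 1)]
    have h3 : c + 1 + n - (c + 1) = n := by omega
    rw [h3, Nat.add_sub_cancel, auxS, Submodule.mul_sup, pow_succ]
    simp only [mul_assoc]
    rfl

theorem auxS_map {R T T' : Type*} [CommRing R] [Ring T] [Algebra R T] [Ring T'] [Algebra R T']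
    (π : T →ₐ[R] T') (J W : Submodule R T) (n : ℕ) :
    (auxS J W n).map π.toLinearMap = auxS (J.map π.toLinearMap) (W.map π.toLinearMap) n := by
  induction n with
  | zero => simp [auxS]
  | succ n ih => simp only [auxS, Submodule.map_sup, Submodule.map_mul, Submodule.map_pow, ih]

theorem aux_rs_mul_pow {R k T : Type*} [CommRing R] [CommRing k] [Algebra R k] [Ring T]
    [Algebra R T] [Algebra k T] [IsScalarTower R k T] (J W : Submodule k T) (n : ℕ) :
    (J * W ^ n).restrictScalars R = J.restrictScalars R * (W.restrictScalars R) ^ n := by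
  induction n with
  | zero => simp
  | succ n ih => rw [pow_succ, ← mul_assoc, Submodule.restrictScalars_mul, ih, pow_succ, mul_assoc]

theorem aux_rs_sup {R k T : Type*} [CommRing R] [CommRing k] [Algebra R k] [Ring T]
    [Algebra R T] [Algebra k T] [IsScalarTower R k T] (J W : Submodule k T) :
    (J ⊔ W).restrictScalars R = J.restrictScalars R ⊔ W.restrictScalars R := by
  ext x
  simp [Submodule.mem_sup]

theorem auxS_rs {R k T : Type*} [CommRing R] [CommRing k] [Algebra R k] [Ring T]
    [Algebra R T] [Algebra k T] [IsScalarTower R k T] (J W : Submodule k T) (n : ℕ) :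
    (auxS J W n).restrictScalars R = auxS (J.restrictScalars R) (W.restrictScalars R) n := by
  induction n with
  | zero => simp [auxS]
  | succ n ih => rw [auxS, aux_rs_sup, aux_rs_mul_pow, Submodule.restrictScalars_mul, ih, auxS]

theorem auxS_le {R M : Type*} [CommRing R] [AddCommGroup M] [Module R M]
    (J : Submodule R (M ⊗[R] M)) (n : ℕ) :
    auxS (J.map (mul2 R M)) (deg1 R M) n ≤ deg1 R M ^ (n + 1) := by
  induction n with
  | zero => simp [auxS]
  | succ n ih =>
    rw [auxS]
    refine sup_le ?_ ?_
    · rw [show n + 1 + 1 = 2 + n by omega, pow_add, ← map_mul2_top]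
      exact mul_le_mul' (Submodule.map_mono le_top) le_rfl
    · rw [pow_succ' _ (n + 1)]
      exact mul_le_mul' le_rfl ih

theorem aux_main {R M ι T' : Type*} [CommRing R] [AddCommGroup M] [Module R M] [Fintype ι]
    (b : Module.Basis ι R M) (h : R) (hreg : ∀ x : TensorAlgebra R M, h • x = 0 → x = 0)
    [AddCommGroup T'] [Module R T'] (π : TensorAlgebra R M →ₗ[R] T') (hh : ∀ x, π (h • x) = 0)
    (hker : ∀ x, π x = 0 → ∃ y, x = h • y)
    (J C : Submodule R (M ⊗[R] M)) (hJ : IsCompl J C)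
    (h2 : AuxSat h (auxS (J.map (mul2 R M)) (deg1 R M) 2))
    (hd : ∀ n, (J.map (mul2 R M) * deg1 R M ^ (n + 1)).map π ⊓
        (deg1 R M * auxS (J.map (mul2 R M)) (deg1 R M) (n + 1)).map π ≤
      (J.map (mul2 R M) * deg1 R M ^ (n + 1)).map π ⊓
        (deg1 R M * (J.map (mul2 R M) * deg1 R M ^ n)).map π ⊔
      (J.map (mul2 R M) * deg1 R M ^ (n + 1)).map π ⊓
        (deg1 R M * (deg1 R M * auxS (J.map (mul2 R M)) (deg1 R M) n)).map π) (n : ℕ) :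
    AuxSat h (auxS (J.map (mul2 R M)) (deg1 R M) n) := by
  induction n using Nat.strong_induction_on with
  | _ n ih =>
  match n with
  | 0 => intro x hx; simpa [auxS] using hreg x (by simpa [auxS] using hx)
  | 1 => simpa [auxS] using sat_J b h hreg J C hJ
  | 2 => exact h2
  | n + 3 =>
    have key := hd (n + 1)
    have e2 := satL b h hreg _ (ih (n + 2) (by omega))
    rw [auxS]
    rw [auxS, Submodule.mul_sup] at key e2 ⊢
    refine aux_step π h hh hker _ _ _ (satR_pow b h hreg _ _ (sat_J b h hreg J C hJ)) ?_ ?_ e2 key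
    · have := satR_pow b h hreg (n + 1) _ h2
      simp only [auxS, Submodule.sup_mul, pow_one, pow_zero, mul_one,
        Submodule.mul_bot, sup_bot_eq] at this
      rw [pow_succ' _ (n + 1)]
      simpa only [mul_assoc] using this
    · have := sat_mix b h hreg J C hJ (n + 2) _ (ih (n + 1) (by omega)) (auxS_le J (n + 1))
      rw [pow_two, mul_assoc] at this
      exact this

end AuxB

section AuxC

variable {R k M V ι : Type*} [CommRing R] [CommRing k] [Algebra R k] [AddCommGroup M] [Module R M]
  [AddCommGroup V] [Module k V] [Module R V] [IsScalarTower R k V]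

noncomputable def auxπ (f : M →ₗ[R] V) : TensorAlgebra R M →ₐ[R] TensorAlgebra k V :=
  TensorAlgebra.lift R ((TensorAlgebra.ι k (M := V)).restrictScalars R ∘ₗ f)

theorem auxπ_ι (f : M →ₗ[R] V) (m : M) :
    auxπ (k := k) f (TensorAlgebra.ι R m) = TensorAlgebra.ι k (f m) := by
  simp [auxπ]

theorem auxπ_B (b : Module.Basis ι R M) (b' : Module.Basis ι k V) (f : M →ₗ[R] V)
    (hf : ∀ i, f (b i) = b' i) (w : FreeMonoid ι) :
    auxπ f (b.tensorAlgebra w) = b'.tensorAlgebra w := by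
  induction w using FreeMonoid.inductionOn' with
  | one => simp [aux_B_one]
  | of_mul i w ih => rw [aux_B_mul, map_mul, ih, aux_B_mul, aux_B_of, aux_B_of, auxπ_ι, hf]

theorem auxπ_repr (b : Module.Basis ι R M) (b' : Module.Basis ι k V) (f : M →ₗ[R] V)
    (hf : ∀ i, f (b i) = b' i) (w : FreeMonoid ι) (x : TensorAlgebra R M) :
    b'.tensorAlgebra.repr (auxπ f x) w = algebraMap R k (b.tensorAlgebra.repr x w) := by
  classical
  refine aux_ind b (p := fun x => b'.tensorAlgebra.repr (auxπ f x) w =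
    algebraMap R k (b.tensorAlgebra.repr x w)) (by simp) ?_ ?_ ?_ x
  · intro x y hx hy
    simp only [map_add, Finsupp.add_apply, hx, hy]
  · intro c x hx
    have : auxπ f (c • x) = algebraMap R k c • auxπ (k := k) f x := by
      rw [map_smul, algebraMap_smul]
    rw [this, map_smul, map_smul, Finsupp.smul_apply, Finsupp.smul_apply, hx, smul_eq_mul,
      smul_eq_mul, map_mul]
  · intro u
    rw [auxπ_B b b' f hf, Module.Basis.repr_self, Module.Basis.repr_self,
      Finsupp.single_apply, Finsupp.single_apply]
    split_ifs <;> simp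

theorem auxπ_ker (b : Module.Basis ι R M) (b' : Module.Basis ι k V) (f : M →ₗ[R] V)
    (hf : ∀ i, f (b i) = b' i) (h : R) (hker : ∀ r : R, algebraMap R k r = 0 → ∃ s, r = h * s)
    (x : TensorAlgebra R M) (hx : auxπ (k := k) f x = 0) : ∃ y, x = h • y := by
  have h1 : ∀ w, ∃ s, b.tensorAlgebra.repr x w = h * s := by
    intro w
    apply hker
    rw [← auxπ_repr b b' f hf, hx]; simp
  choose s hs using h1
  refine ⟨(b.tensorAlgebra.repr x).sum fun w _ => s w • b.tensorAlgebra w, ?_⟩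
  conv_lhs => rw [← b.tensorAlgebra.linearCombination_repr x, Finsupp.linearCombination_apply]
  simp only [Finsupp.sum, Finset.smul_sum, smul_smul, hs]

theorem auxπ_deg1 (f : M →ₗ[R] V) (hfs : Function.Surjective f) :
    (deg1 R M).map (auxπ (k := k) f).toLinearMap = (deg1 k V).restrictScalars R := by
  ext x
  constructor
  · rintro ⟨_, ⟨m, rfl⟩, rfl⟩
    exact ⟨f m, (auxπ_ι f m).symm⟩
  · rintro ⟨v, rfl⟩
    obtain ⟨m, rfl⟩ := hfs v
    exact ⟨_, ⟨m, rfl⟩, auxπ_ι f m⟩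

theorem auxC_main [Fintype ι] (b : Module.Basis ι R M) (b' : Module.Basis ι k V) (f : M →ₗ[R] V)
    (hf : ∀ i, f (b i) = b' i) (hfs : Function.Surjective f)
    (h : R) (hh : algebraMap R k h = 0) (hker : ∀ r : R, algebraMap R k r = 0 → ∃ s, r = h * s)
    (hreg : ∀ x : TensorAlgebra R M, h • x = 0 → x = 0)
    (J C : Submodule R (M ⊗[R] M)) (hJ : IsCompl J C) (I : Submodule k (V ⊗[k] V))
    (hI : (J.map (mul2 R M)).map (auxπ (k := k) f).toLinearMap =
      (I.map (mul2 k V)).restrictScalars R)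
    (hd : ∀ n, I.map (mul2 k V) * deg1 k V ^ (n + 1) ⊓
        deg1 k V * auxS (I.map (mul2 k V)) (deg1 k V) (n + 1) ≤
      I.map (mul2 k V) * deg1 k V ^ (n + 1) ⊓ deg1 k V * (I.map (mul2 k V) * deg1 k V ^ n) ⊔
      I.map (mul2 k V) * deg1 k V ^ (n + 1) ⊓
        deg1 k V * (deg1 k V * auxS (I.map (mul2 k V)) (deg1 k V) n))
    (h2 : AuxSat h (auxS (J.map (mul2 R M)) (deg1 R M) 2)) (n : ℕ) :
    AuxSat h (auxS (J.map (mul2 R M)) (deg1 R M) n) := by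
  refine aux_main b h hreg (auxπ (k := k) f).toLinearMap ?_ (auxπ_ker b b' f hf h hker)
    J C hJ h2 ?_ n
  · intro x
    rw [map_smul, ← algebraMap_smul k, hh, zero_smul]
  · intro n
    simp only [Submodule.map_mul, Submodule.map_pow, auxS_map, hI, auxπ_deg1 f hfs, ← auxS_rs,
      ← aux_rs_mul_pow, ← Submodule.restrictScalars_mul]
    have := hd n
    intro x hx
    rw [Submodule.mem_sup]
    obtain ⟨y, hy, z, hz, e⟩ := Submodule.mem_sup.1 (this hx)
    exact ⟨y, hy, z, hz, e⟩

end AuxC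

section AuxD

theorem aux_summand {R T : Type*} [CommRing R] [IsDomain R] [IsDiscreteValuationRing R]
    [AddCommGroup T] [Module R T] (h : R) (hirr : Irreducible h) (N A : Submodule R T)
    (hNA : N ≤ A) (hA : A.FG) (hN : AuxSat h N) : IsSummandIn R N A := by
  have hA' : Module.Finite R A := Module.Finite.iff_fg.2 hA
  let N' := N.comap A.subtype
  have htf : Module.IsTorsionFree R (A ⧸ N') := by
    apply Module.IsTorsionFree.of_smul_eq_zero
    intro r q hq
    by_cases hr : r = 0
    · exact Or.inl hr
    right
    obtain ⟨n, u, rfl⟩ := IsDiscreteValuationRing.eq_unit_mul_pow_irreducible hr hirr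
    obtain ⟨a, rfl⟩ := N'.mkQ_surjective q
    rw [← map_smul, Submodule.mkQ_apply, Submodule.Quotient.mk_eq_zero] at hq
    rw [Submodule.mkQ_apply, Submodule.Quotient.mk_eq_zero]
    have h1 : h ^ n • (a : T) ∈ N := by
      have h2 : ((u : R) * h ^ n) • (a : T) ∈ N := hq
      have := N.smul_mem (↑u⁻¹ : R) h2
      rwa [smul_smul, ← mul_assoc, Units.inv_mul, one_mul] at this
    change (a : T) ∈ N
    clear hq hr
    induction n with
    | zero => simpa using h1
    | succ n ih =>
      apply ih
      apply hN
      rwa [smul_smul, ← pow_succ']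
  obtain ⟨s, hs⟩ := N'.mkQ.exists_rightInverse_of_surjective N'.range_mkQ
  refine ⟨(LinearMap.range s).map A.subtype, Submodule.map_subtype_le _ _, ?_, ?_⟩
  · rw [eq_bot_iff]
    rintro _ ⟨h1, ⟨_, ⟨q, rfl⟩, rfl⟩⟩
    have h2 : N'.mkQ (s q) = 0 := by
      rw [Submodule.mkQ_apply, Submodule.Quotient.mk_eq_zero]; exact h1
    have h3 : N'.mkQ (s q) = q := LinearMap.congr_fun hs q
    rw [h2] at h3
    rw [← h3]; simp
  · apply le_antisymm (sup_le hNA (Submodule.map_subtype_le _ _))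
    intro a ha
    let a' : A := ⟨a, ha⟩
    have h1 : a' - s (N'.mkQ a') ∈ N' := by
      rw [← Submodule.Quotient.mk_eq_zero, ← Submodule.mkQ_apply, map_sub, sub_eq_zero]
      exact (LinearMap.congr_fun hs _).symm
    refine Submodule.mem_sup.2 ⟨_, h1, s (N'.mkQ a'), ⟨_, ⟨_, rfl⟩, rfl⟩, ?_⟩
    simp [a']

theorem sat_of_summand {R T : Type*} [CommRing R]
    [AddCommGroup T] [Module R T] (h : R) (hreg : ∀ x : T, h • x = 0 → x = 0)
    (N A : Submodule R T) (hA : AuxSat h A) (hN : IsSummandIn R N A) : AuxSat h N := by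
  obtain ⟨C, -, h1, rfl⟩ := hN
  intro x hx
  obtain ⟨n, hn, c, hc, rfl⟩ := Submodule.mem_sup.1 (hA x (Submodule.mem_sup_left hx))
  have h2 : h • c ∈ N ⊓ C := by
    refine ⟨?_, C.smul_mem _ hc⟩
    simpa [smul_add] using N.sub_mem hx (N.smul_mem h hn)
  rw [h1, Submodule.mem_bot] at h2
  rw [hreg c h2, add_zero]; exact hn

theorem auxS_posSub {R M : Type*} [CommRing R] [AddCommGroup M] [Module R M]
    (J : Submodule R (M ⊗[R] M)) (n c m : ℕ) (hm : m - 1 = c + n) :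
    ∑ i ∈ Finset.Icc (c + 1) (m - 1), posSub R M J (i - 1) (m - 1 - i) =
      deg1 R M ^ c * auxS (J.map (mul2 R M)) (deg1 R M) n := by
  rw [← auxS_sum, hm]; rfl

theorem aux_wk {k V : Type*} [Field k] [AddCommGroup V] [Module k V]
    (I : Submodule k (V ⊗[k] V)) (hwk : WeaklyKoszul k V I) (n : ℕ) :
    I.map (mul2 k V) * deg1 k V ^ (n + 1) ⊓
        deg1 k V * auxS (I.map (mul2 k V)) (deg1 k V) (n + 1) ≤
      I.map (mul2 k V) * deg1 k V ^ (n + 1) ⊓ deg1 k V * (I.map (mul2 k V) * deg1 k V ^ n) ⊔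
      I.map (mul2 k V) * deg1 k V ^ (n + 1) ⊓
        deg1 k V * (deg1 k V * auxS (I.map (mul2 k V)) (deg1 k V) n) := by
  have h := hwk (n + 3) (by omega)
  rw [auxS_posSub I (n + 1) 1 (n + 3) (by omega), auxS_posSub I n 2 (n + 3) (by omega)] at h
  have e1 : n + 3 - 2 = n + 1 := by omega
  have e2 : n + 3 - 3 = n := by omega
  rw [e1, e2] at h
  simp only [posSub, pow_zero, one_mul, pow_one] at h
  rw [mul_assoc, pow_two, mul_assoc] at h
  exact h.le

theorem aux_final {k V : Type*} [Field k] [AddCommGroup V] [Module k V]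
    [FiniteDimensional k V] [Algebra (PowerSeries k) k] [Module (PowerSeries k) V]
    [IsScalarTower (PowerSeries k) k V] [IsScalarTower k (PowerSeries k) V]
    (hc : ∀ r : PowerSeries k, algebraMap (PowerSeries k) k r = PowerSeries.constantCoeff r)
    (I : Submodule k (V ⊗[k] V)) (hwk : WeaklyKoszul k V I)
    (Ih : Submodule (PowerSeries k)
      ((PowerSeries k ⊗[k] V) ⊗[PowerSeries k] (PowerSeries k ⊗[k] V)))
    (hsplit : ∃ C, IsCompl Ih C)
    (hred : Ih ⊔ Submodule.map ((PowerSeries.X : PowerSeries k) • LinearMap.id) ⊤ =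
      Submodule.span (PowerSeries k) (up2 k V '' (I : Set (V ⊗[k] V))) ⊔
        Submodule.map ((PowerSeries.X : PowerSeries k) • LinearMap.id) ⊤)
    (h3 : IsSummandIn (PowerSeries k)
      (posSub (PowerSeries k) (PowerSeries k ⊗[k] V) Ih 1 0 ⊔
        posSub (PowerSeries k) (PowerSeries k ⊗[k] V) Ih 0 1)
      (deg1 (PowerSeries k) (PowerSeries k ⊗[k] V) ^ 3)) :
    ∀ m : ℕ, 2 ≤ m →
      IsSummandIn (PowerSeries k)
        (∑ i ∈ Finset.Icc 1 (m - 1),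
          posSub (PowerSeries k) (PowerSeries k ⊗[k] V) Ih (i - 1) (m - 1 - i))
        (deg1 (PowerSeries k) (PowerSeries k ⊗[k] V) ^ m) := by
  obtain ⟨C, hC⟩ := hsplit
  let b' := Module.finBasis k V
  let b := Algebra.TensorProduct.basis (PowerSeries k) b'
  let f : PowerSeries k ⊗[k] V →ₗ[PowerSeries k] V :=
    LinearMap.liftBaseChange (PowerSeries k) (LinearMap.id : V →ₗ[k] V)
  have hf1 : ∀ v : V, f (1 ⊗ₜ v) = v := fun v => by simp [f]
  have hf : ∀ i, f (b i) = b' i := fun i => by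
    simp only [b, Algebra.TensorProduct.basis_apply, hf1]
  have hfs : Function.Surjective f := fun v => ⟨1 ⊗ₜ v, hf1 v⟩
  have hX : algebraMap (PowerSeries k) k PowerSeries.X = 0 := by rw [hc]; simp
  have hker : ∀ r : PowerSeries k, algebraMap (PowerSeries k) k r = 0 →
      ∃ s, r = PowerSeries.X * s := by
    intro r hr
    rw [hc] at hr
    exact PowerSeries.X_dvd_iff.2 hr
  have hreg : ∀ x : TensorAlgebra (PowerSeries k) (PowerSeries k ⊗[k] V),
      (PowerSeries.X : PowerSeries k) • x = 0 → x = 0 := by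
    intro x hx
    apply b.tensorAlgebra.ext_elem
    intro w
    have := congrArg (fun y => b.tensorAlgebra.repr y w) hx
    simp only [map_smul, map_zero, Finsupp.smul_apply, smul_eq_mul, Finsupp.zero_apply] at this ⊢
    exact (mul_eq_zero.1 this).resolve_left PowerSeries.X_ne_zero
  let L := (auxπ (k := k) f).toLinearMap ∘ₗ mul2 (PowerSeries k) (PowerSeries k ⊗[k] V)
  have hL : ∀ v, L (up2 k V v) = mul2 k V v := by
    intro v
    induction v using TensorProduct.induction_on with
    | zero => simp
    | add x y hx hy => rw [map_add, map_add, map_add, hx, hy]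
    | tmul v w =>
      have e : up2 k V (v ⊗ₜ[k] w) =
        ((1 : PowerSeries k) ⊗ₜ[k] v) ⊗ₜ[PowerSeries k] ((1 : PowerSeries k) ⊗ₜ[k] w) := rfl
      rw [e]
      simp [L, mul2, auxπ_ι, hf1]
  have hLX : ∀ x, L ((PowerSeries.X : PowerSeries k) • x) = 0 := by
    intro x
    rw [map_smul, ← algebraMap_smul k, hX, zero_smul]
  have hXb : (Submodule.map ((PowerSeries.X : PowerSeries k) • LinearMap.id) ⊤ :
      Submodule (PowerSeries k)
      ((PowerSeries k ⊗[k] V) ⊗[PowerSeries k] (PowerSeries k ⊗[k] V))).map L = ⊥ := by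
    rw [eq_bot_iff]
    rintro _ ⟨_, ⟨x, -, rfl⟩, rfl⟩
    exact hLX x
  have hI : (Ih.map (mul2 (PowerSeries k) (PowerSeries k ⊗[k] V))).map
      (auxπ (k := k) f).toLinearMap = (I.map (mul2 k V)).restrictScalars (PowerSeries k) := by
    have h1 := congrArg (Submodule.map L) hred
    rw [Submodule.map_sup, Submodule.map_sup, hXb, sup_bot_eq, sup_bot_eq, Submodule.map_span,
      Set.image_image] at h1
    rw [← Submodule.map_comp]
    refine h1.trans (le_antisymm ?_ ?_)
    · rw [Submodule.span_le]
      rintro _ ⟨v, hv, rfl⟩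
      exact ⟨v, hv, (hL v).symm⟩
    · rintro _ ⟨v, hv, rfl⟩
      exact Submodule.subset_span ⟨v, hv, hL v⟩
  have h2 : AuxSat (PowerSeries.X : PowerSeries k)
      (auxS (Ih.map (mul2 (PowerSeries k) (PowerSeries k ⊗[k] V)))
        (deg1 (PowerSeries k) (PowerSeries k ⊗[k] V)) 2) := by
    have := sat_of_summand _ hreg _ _ (sat_pow b _ hreg 3) h3
    rw [sup_comm] at this
    simpa [auxS, posSub] using this
  have key := auxC_main b b' f hf hfs PowerSeries.X hX hker hreg Ih C hC I hI (aux_wk I hwk) h2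
  intro m hm
  obtain ⟨n, rfl⟩ : ∃ n, m = n + 1 := ⟨m - 1, by omega⟩
  have hsum := auxS_posSub Ih n 0 (n + 1) (by omega)
  rw [zero_add, pow_zero, one_mul] at hsum
  rw [hsum]
  refine aux_summand PowerSeries.X PowerSeries.X_irreducible _ _ (auxS_le Ih n) ?_ (key n)
  apply Submodule.FG.pow
  rw [deg1, LinearMap.range_eq_map]
  exact Submodule.FG.map _ (Module.Finite.fg_top)

end AuxD

/-- Proposition 1.1: if `(V, I)` is weakly Koszul and `I_ħ` is a deformation of `I` over
`R = k[[ħ]]` (a splitting submodule of `V_R ⊗ V_R` reducing to `I` mod `ħ`) such that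
`I³_ħ = V_R ⊗ I_ħ + I_ħ ⊗ V_R` is a splitting submodule of `V_R^{⊗3}`, then every
`I^m_ħ = ∑ᵢ V_R^{⊗(i-1)} ⊗ I_ħ ⊗ V_R^{⊗(m-1-i)}` is a splitting submodule of
`V_R^{⊗m}`. -/
theorem weakly_koszul_deformation_splitting
    {k V : Type*} [Field k] [CharZero k] [AddCommGroup V] [Module k V]
    [FiniteDimensional k V]
    (I : Submodule k (V ⊗[k] V)) (hwk : WeaklyKoszul k V I)
    (Ih : Submodule (PowerSeries k)
      ((PowerSeries k ⊗[k] V) ⊗[PowerSeries k] (PowerSeries k ⊗[k] V)))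
    -- `I_ħ` is a direct summand of `V_R ⊗ V_R`
    (hsplit : ∃ C, IsCompl Ih C)
    -- `I_ħ` reduces to `I` modulo `ħ`
    (hred : Ih ⊔ Submodule.map ((PowerSeries.X : PowerSeries k) • LinearMap.id) ⊤ =
      Submodule.span (PowerSeries k) (up2 k V '' (I : Set (V ⊗[k] V))) ⊔
        Submodule.map ((PowerSeries.X : PowerSeries k) • LinearMap.id) ⊤)
    -- `I³_ħ = V_R ⊗ I_ħ + I_ħ ⊗ V_R` is a splitting submodule of `V_R^{⊗3}`
    (h3 : IsSummandIn (PowerSeries k)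
      (posSub (PowerSeries k) (PowerSeries k ⊗[k] V) Ih 1 0 ⊔
        posSub (PowerSeries k) (PowerSeries k ⊗[k] V) Ih 0 1)
      (deg1 (PowerSeries k) (PowerSeries k ⊗[k] V) ^ 3)) :
    ∀ m : ℕ, 2 ≤ m →
      IsSummandIn (PowerSeries k)
        (∑ i ∈ Finset.Icc 1 (m - 1),
          posSub (PowerSeries k) (PowerSeries k ⊗[k] V) Ih (i - 1) (m - 1 - i))
        (deg1 (PowerSeries k) (PowerSeries k ⊗[k] V) ^ m) := by

  letI : Algebra (PowerSeries k) k := (PowerSeries.constantCoeff (R := k)).toAlgebra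
  letI : Module (PowerSeries k) V := Module.compHom V (PowerSeries.constantCoeff (R := k))
  haveI : IsScalarTower (PowerSeries k) k V := ⟨fun r c v => by
    change (PowerSeries.constantCoeff r * c) • v = PowerSeries.constantCoeff r • (c • v)
    rw [mul_smul]⟩
  haveI : IsScalarTower k (PowerSeries k) V := ⟨fun c r v => by
    change PowerSeries.constantCoeff (c • r) • v = c • (PowerSeries.constantCoeff r • v)
    rw [smul_smul]; simp⟩
  exact aux_final (fun _ => rfl) I hwk Ih hsplit hred h3
end

section
/- Let k be a field of characteristic zero, V a finite-dimensional k-vector space, and (V,I) a Koszul quadratic algebra, i.e. for every m the lattice of subspaces I^m_1, …, I^m_{m−1} of V^{⊗m} generated under sums and intersections is distributive, where I^m_i = V^{⊗(i−1)}⊗I⊗V^{⊗(m−1−i)}. Let R = k[[ħ]] and let I_ħ ⊆ V_R⊗_R V_R (V_R = V⊗_k R) be a deformation of I, meaning: I_ħ is a direct summand reducing to I modulo ħ, and every I^m_ħ = Σ_i V_R^{⊗(i−1)}⊗I_ħ⊗V_R^{⊗(m−1−i)} is a direct summand of V_R^{⊗m}. Define the dual submodule I*_ħ ⊆ V*_R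 ⊗_R V*_R as the annihilator of I_ħ, i.e. all λ with λ(I_ħ) = 0. Then (V*, I*_ħ) is a deformation of the dual quadratic algebra (V*, I*) where I* = {λ ∈ V*⊗V* : λ(I) = 0}: I*_ħ is a direct summand reducing to I* modulo ħ, and every (I*)^m_ħ is a direct summand of (V*_R)^{⊗m}. -/
set_option synthInstance.maxHeartbeats 1000000
set_option maxHeartbeats 1000000

open TensorProduct

/-- Membership in the sublattice generated by a set of elements of a lattice under
(finite) suprema and infima. -/
inductive LatticeGen {α : Type*} [Lattice α] (s : Set α) : α → Prop
  | base {x : α} : x ∈ s → LatticeGen s x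
  | sup {x y : α} : LatticeGen s x → LatticeGen s y → LatticeGen s (x ⊔ y)
  | inf {x y : α} : LatticeGen s x → LatticeGen s y → LatticeGen s (x ⊓ y)

/-- The quadratic algebra `(V, I)` is Koszul: for every `m` the sublattice of subspaces of
`V^{⊗m}` generated by `I^m_1, …, I^m_{m-1}` under sums and intersections is
distributive. -/
def KoszulQuadratic (k V : Type*) [Field k] [AddCommGroup V] [Module k V]
    (I : Submodule k (V ⊗[k] V)) : Prop :=
  ∀ m : ℕ, ∀ X Y Z : Submodule k (TensorAlgebra k V),
    LatticeGen {p | ∃ i, 1 ≤ i ∧ i ≤ m - 1 ∧ p = posSub k V I (i - 1) (m - 1 - i)} X →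
    LatticeGen {p | ∃ i, 1 ≤ i ∧ i ≤ m - 1 ∧ p = posSub k V I (i - 1) (m - 1 - i)} Y →
    LatticeGen {p | ∃ i, 1 ≤ i ∧ i ≤ m - 1 ∧ p = posSub k V I (i - 1) (m - 1 - i)} Z →
    X ⊓ (Y ⊔ Z) = X ⊓ Y ⊔ X ⊓ Z

/-- `J_ħ ⊆ V_R ⊗ V_R` is a deformation over `R = k[[ħ]]` of the quadratic algebra `(W, J)`:
it is a splitting submodule reducing to `J` modulo `ħ`, and all the submodules
`J^m_ħ = ∑ᵢ V_R^{⊗(i-1)} ⊗ J_ħ ⊗ V_R^{⊗(m-1-i)}` are splitting submodules of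
`V_R^{⊗m}`. -/
def IsQuadraticDeformation (k W : Type*) [Field k] [AddCommGroup W] [Module k W]
    (J : Submodule k (W ⊗[k] W))
    (Jh : Submodule (PowerSeries k)
      ((PowerSeries k ⊗[k] W) ⊗[PowerSeries k] (PowerSeries k ⊗[k] W))) : Prop :=
  (∃ C, IsCompl Jh C) ∧
  (Jh ⊔ Submodule.map ((PowerSeries.X : PowerSeries k) • LinearMap.id) ⊤ =
    Submodule.span (PowerSeries k) (up2 k W '' (J : Set (W ⊗[k] W))) ⊔
      Submodule.map ((PowerSeries.X : PowerSeries k) • LinearMap.id) ⊤) ∧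
  (∀ m : ℕ, 2 ≤ m →
    IsSummandIn (PowerSeries k)
      (∑ i ∈ Finset.Icc 1 (m - 1),
        posSub (PowerSeries k) (PowerSeries k ⊗[k] W) Jh (i - 1) (m - 1 - i))
      (deg1 (PowerSeries k) (PowerSeries k ⊗[k] W) ^ m))

/-- The canonical `R`-linear map `R ⊗[k] V* →ₗ[R] (V_R)*` (base change of linear
functionals). -/
noncomputable def dualUp (k V : Type*) [Field k] [AddCommGroup V] [Module k V] :
    PowerSeries k ⊗[k] Module.Dual k V →ₗ[PowerSeries k]
      Module.Dual (PowerSeries k) (PowerSeries k ⊗[k] V) :=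
  LinearMap.liftBaseChange (PowerSeries k)
    { toFun := fun φ =>
        (TensorProduct.AlgebraTensorModule.rid k (PowerSeries k) (PowerSeries k)).toLinearMap
          ∘ₗ LinearMap.baseChange (PowerSeries k) φ
      map_add' := by
        intro φ ψ
        ext v
        simp [LinearMap.baseChange_add]
      map_smul' := by
        intro c φ
        apply LinearMap.ext
        intro x
        induction x using TensorProduct.induction_on with
        | zero => simp
        | tmul r v =>
            simp only [LinearMap.coe_comp, LinearEquiv.coe_coe, Function.comp_apply,
              LinearMap.baseChange_tmul, LinearMap.smul_apply]
            rw [TensorProduct.AlgebraTensorModule.rid_tmul,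
              TensorProduct.AlgebraTensorModule.rid_tmul, RingHom.id_apply, smul_assoc]
        | add a b ha hb => simp only [map_add, LinearMap.add_apply, ha, hb] }


section Coord

@[reducible] def QWord (κ : Type) : ℕ → Type
  | 0 => Unit
  | n+1 => κ × QWord κ n

instance QWord.fintype (κ : Type) [Fintype κ] : ∀ n, Fintype (QWord κ n)
  | 0 => inferInstanceAs (Fintype Unit)
  | n+1 => @instFintypeProd κ (QWord κ n) _ (QWord.fintype κ n)

variable {S : Type*} [CommRing S] {κ P : Type}

def qshift (N : Submodule S (P → S)) : Submodule S (κ × P → S) where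
  carrier := {x | ∀ c, (fun w => x (c, w)) ∈ N}
  add_mem' := fun ha hb c => N.add_mem (ha c) (hb c)
  zero_mem' := fun _ => N.zero_mem
  smul_mem' := fun r _ ha c => N.smul_mem r (ha c)

def qhead (J : Submodule S (κ × κ → S)) : Submodule S (κ × κ × P → S) where
  carrier := {x | ∀ p, (fun cd : κ × κ => x (cd.1, cd.2, p)) ∈ J}
  add_mem' := fun ha hb c => J.add_mem (ha c) (hb c)
  zero_mem' := fun _ => J.zero_mem
  smul_mem' := fun r _ ha c => J.smul_mem r (ha c)

def qW (J : Submodule S (κ × κ → S)) : ∀ n, Submodule S (QWord κ n → S)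
  | 0 => ⊤
  | 1 => ⊤
  | n+2 => qhead J ⊓ qshift (qW J (n+1))

def qQ (J : Submodule S (κ × κ → S)) : ∀ n, Submodule S (QWord κ n → S)
  | 0 => ⊥
  | 1 => ⊥
  | n+2 => qhead J ⊔ qshift (qQ J (n+1))

theorem mem_qshift {N : Submodule S (P → S)} {x : κ × P → S} :
    x ∈ qshift N ↔ ∀ c, (fun w => x (c, w)) ∈ N := Iff.rfl

theorem mem_qhead {J : Submodule S (κ × κ → S)} {x : κ × κ × P → S} :
    x ∈ qhead J ↔ ∀ p, (fun cd : κ × κ => x (cd.1, cd.2, p)) ∈ J := Iff.rfl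

theorem qshift_inf (N N' : Submodule S (P → S)) :
    (qshift (N ⊓ N') : Submodule S (κ × P → S)) = qshift N ⊓ qshift N' := by
  ext x; simp only [mem_qshift, Submodule.mem_inf]; exact forall_and

/-- orthogonal complement -/
def qperp [Fintype P] (N : Submodule S (P → S)) : Submodule S (P → S) where
  carrier := {x | ∀ y ∈ N, ∑ p, x p * y p = 0}
  add_mem' := fun ha hb y hy => by
    simp only [Pi.add_apply, add_mul, Finset.sum_add_distrib, ha y hy, hb y hy, add_zero]
  zero_mem' := fun y _ => by simp
  smul_mem' := fun r x ha y hy => by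
    simp only [Pi.smul_apply, smul_eq_mul, mul_assoc, ← Finset.mul_sum, ha y hy, mul_zero]

theorem mem_qperp [Fintype P] {N : Submodule S (P → S)} {x : P → S} :
    x ∈ qperp N ↔ ∀ y ∈ N, ∑ p, x p * y p = 0 := Iff.rfl

theorem qperp_anti [Fintype P] {N N' : Submodule S (P → S)} (h : N ≤ N') :
    qperp N' ≤ qperp N := fun _ hx y hy => hx y (h hy)

theorem qperp_qshift [Fintype κ] [Fintype P] (N : Submodule S (P → S)) :
    qperp (qshift N : Submodule S (κ × P → S)) = qshift (qperp N) := by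
  classical
  ext x
  simp only [mem_qshift, mem_qperp]
  constructor
  · intro h c y hy
    have := h (fun q => if q.1 = c then y q.2 else 0) (by
      intro c'
      by_cases hc : c' = c
      · simpa [hc] using hy
      · simp only [hc, if_false]; exact N.zero_mem)
    rw [Fintype.sum_prod_type, Finset.sum_eq_single c] at this
    · simpa using this
    · intro c' _ hc; simp [hc]
    · simp
  · intro h y hy
    rw [Fintype.sum_prod_type]
    exact Finset.sum_eq_zero fun c _ => h c _ (hy c)

theorem qsum3 [Fintype κ] [Fintype P] (f : κ × κ × P → S) :
    ∑ q, f q = ∑ p, ∑ cd : κ × κ, f (cd.1, cd.2, p) := by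
  rw [Finset.sum_comm]
  rw [Fintype.sum_prod_type, Fintype.sum_prod_type]
  refine Finset.sum_congr rfl fun c _ => ?_
  rw [Fintype.sum_prod_type]

theorem qperp_qhead [Fintype κ] [Fintype P] (J : Submodule S (κ × κ → S)) :
    qperp (qhead J : Submodule S (κ × κ × P → S)) = qhead (qperp J) := by
  classical
  ext x
  simp only [mem_qhead, mem_qperp]
  constructor
  · intro h p y hy
    have := h (fun q => if q.2.2 = p then y (q.1, q.2.1) else 0) (by
      intro p'
      by_cases hc : p' = p
      · simpa [hc] using hy
      · simp only [hc, if_false]; exact J.zero_mem)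
    rw [qsum3, Finset.sum_eq_single p] at this
    · simpa using this
    · intro c' _ hc; simp [hc]
    · simp
  · intro h y hy
    rw [qsum3]
    exact Finset.sum_eq_zero fun c _ => h c _ (hy c)

theorem qperp_top [Fintype P] : qperp (⊤ : Submodule S (P → S)) = ⊥ := by
  classical
  rw [eq_bot_iff]
  intro x hx
  ext p
  have := hx (Pi.single p 1) trivial
  simpa [Pi.single_apply] using this

theorem qperp_inf_field {k : Type*} [Field k] [Fintype P] (A B : Submodule k (P → k)) :
    qperp (A ⊓ B) ≤ qperp A ⊔ qperp B := by
  classical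
  intro x hx
  have key : ∀ (N : Submodule k (P → k)) (y : P → k),
      dotProductEquiv k P y ∈ N.dualAnnihilator ↔ y ∈ qperp N := by
    intro N y
    rw [Submodule.mem_dualAnnihilator, mem_qperp]
    rfl
  have h := (key _ x).2 hx
  rw [Subspace.dualAnnihilator_inf_eq, Submodule.mem_sup] at h
  obtain ⟨f, hf, g, hg, hfg⟩ := h
  obtain ⟨a, rfl⟩ := (dotProductEquiv k P).surjective f
  obtain ⟨b, rfl⟩ := (dotProductEquiv k P).surjective g
  rw [← map_add] at hfg
  have := (dotProductEquiv k P).injective hfg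
  rw [← this]
  exact Submodule.add_mem_sup ((key _ _).1 hf) ((key _ _).1 hg)

theorem qperp_qW_field {k : Type*} [Field k] [Fintype κ] (J : Submodule k (κ × κ → k)) :
    ∀ n, qperp (qW J n) ≤ qQ (qperp J) n
  | 0 => qperp_top.le
  | 1 => qperp_top.le
  | n+2 => by
    refine (qperp_inf_field _ _).trans ?_
    refine sup_le_sup (qperp_qhead J).le ?_
    refine (qperp_qshift _).le.trans ?_
    intro x hx c
    exact qperp_qW_field J (n+1) (hx c)

theorem qQ_le_qperp [Fintype κ] (J : Submodule S (κ × κ → S)) :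
    ∀ n, qQ (qperp J) n ≤ qperp (qW J n)
  | 0 => bot_le
  | 1 => bot_le
  | n+2 => by
    refine sup_le ?_ ?_
    · exact (qperp_qhead J).ge.trans (qperp_anti inf_le_left)
    · refine le_trans ?_ ((qperp_qshift _).ge.trans (qperp_anti inf_le_right))
      intro x hx c
      exact qQ_le_qperp J (n+1) (hx c)

end Coord

section Red
variable {k : Type*} [Field k] {κ P : Type}

noncomputable def qred (x : P → PowerSeries k) : P → k := fun p => PowerSeries.constantCoeff (x p)

def qsat {S : Type*} [CommRing S] {P : Type} (t : S) (N : Submodule S (P → S)) : Prop :=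
  ∀ x, t • x ∈ N → x ∈ N

theorem qred_add (x y : P → PowerSeries k) : qred (x + y) = qred x + qred y := by
  ext p; simp [qred]
theorem qred_sub (x y : P → PowerSeries k) : qred (x - y) = qred x - qred y := by
  ext p; simp [qred]
theorem qred_X (x : P → PowerSeries k) : qred ((PowerSeries.X : PowerSeries k) • x) = 0 := by
  ext p; simp [qred]
theorem qred_eq_zero {x : P → PowerSeries k} (h : qred x = 0) :
    ∃ z, x = (PowerSeries.X : PowerSeries k) • z := by
  have : ∀ p, ∃ z, x p = PowerSeries.X * z := fun p =>
    (PowerSeries.X_dvd_iff (φ := x p)).2 (congrFun h p)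
  choose z hz using this
  exact ⟨z, funext hz⟩
theorem qred_eq {x y : P → PowerSeries k} (h : qred x = qred y) :
    ∃ z, x - y = (PowerSeries.X : PowerSeries k) • z :=
  qred_eq_zero (by rw [qred_sub, h, sub_self])

noncomputable def qlift (x : P → k) : P → PowerSeries k := fun p => PowerSeries.C (x p)
theorem qred_qlift (x : P → k) : qred (qlift x) = x := by
  ext p; simp [qred, qlift]

/-- every element of `N'` lifts to `N` -/
def qLifts (N : Submodule (PowerSeries k) (P → PowerSeries k)) (N' : Submodule k (P → k)) : Prop :=
  ∀ x ∈ N', ∃ y ∈ N, qred y = x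

def qInto (N : Submodule (PowerSeries k) (P → PowerSeries k)) (N' : Submodule k (P → k)) : Prop :=
  ∀ x ∈ N, qred x ∈ N'

theorem qnak [Fintype P] (N M : Submodule (PowerSeries k) (P → PowerSeries k))
    (hN : qsat PowerSeries.X N) (hle : M ≤ N) (h : ∀ x ∈ N, ∃ y ∈ M, qred y = qred x) :
    N ≤ M := by
  refine Submodule.le_of_le_smul_of_le_jacobson_bot
    (I := Ideal.span {(PowerSeries.X : PowerSeries k)}) (IsNoetherian.noetherian N) ?_ ?_
  · rw [IsLocalRing.jacobson_eq_maximalIdeal _ bot_ne_top, Ideal.span_le,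
      Set.singleton_subset_iff]
    simp [IsLocalRing.mem_maximalIdeal, PowerSeries.isUnit_iff_constantCoeff]
  · intro x hx
    obtain ⟨y, hy, hxy⟩ := h x hx
    obtain ⟨z, hz⟩ := qred_eq hxy.symm
    have hzN : z ∈ N := hN z (hz ▸ N.sub_mem hx (hle hy))
    rw [← add_sub_cancel y x, hz]
    exact Submodule.add_mem_sup hy
      (Submodule.smul_mem_smul (Ideal.mem_span_singleton_self _) hzN)

theorem qsat_exists_isCompl [Fintype P] (N : Submodule (PowerSeries k) (P → PowerSeries k))
    (hN : qsat PowerSeries.X N) : ∃ C, IsCompl N C := by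
  have : Module.IsTorsionFree (PowerSeries k) ((P → PowerSeries k) ⧸ N) := by
    have h1 : ∀ (n : ℕ) (x : P → PowerSeries k),
        (PowerSeries.X : PowerSeries k) ^ n • x ∈ N → x ∈ N := by
      intro n
      induction n with
      | zero => intro x hx; simpa using hx
      | succ n ih => intro x hx; exact hN _ (ih _ (by rwa [smul_smul, ← pow_succ]))
    rw [Module.isTorsionFree_iff_smul_eq_zero]
    intro r m hrm
    obtain ⟨x, rfl⟩ := N.mkQ_surjective m
    by_cases hr : r = 0
    · exact Or.inl hr
    right
    rw [← map_smul, Submodule.mkQ_apply, Submodule.Quotient.mk_eq_zero] at hrm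
    rw [Submodule.mkQ_apply, Submodule.Quotient.mk_eq_zero]
    obtain ⟨n, u, hu⟩ := IsDiscreteValuationRing.eq_unit_mul_pow_irreducible hr
      (PowerSeries.X_irreducible (R := k))
    apply h1 n
    rw [hu, mul_smul] at hrm
    have := N.smul_mem ((u⁻¹ : (PowerSeries k)ˣ) : PowerSeries k) hrm
    simpa [smul_smul] using this
  obtain ⟨s, hs⟩ := Module.projective_lifting_property N.mkQ LinearMap.id N.mkQ_surjective
  have hs' : ∀ q, N.mkQ (s q) = q := fun q => LinearMap.congr_fun hs q
  refine ⟨LinearMap.range s, ?_⟩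
  rw [isCompl_iff, disjoint_iff, codisjoint_iff]
  constructor
  · rw [eq_bot_iff]
    rintro x ⟨hx, q, rfl⟩
    have h0 : N.mkQ (s q) = 0 := by
      rw [Submodule.mkQ_apply, Submodule.Quotient.mk_eq_zero]; exact hx
    rw [hs'] at h0
    simp [h0]
  · rw [eq_top_iff]
    intro x _
    rw [← sub_add_cancel x (s (N.mkQ x))]
    refine Submodule.add_mem_sup ?_ ⟨_, rfl⟩
    rw [← Submodule.Quotient.mk_eq_zero, ← Submodule.mkQ_apply, map_sub, hs', sub_self]

theorem qsat_qshift {N : Submodule (PowerSeries k) (P → PowerSeries k)}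
    (h : qsat PowerSeries.X N) :
    qsat PowerSeries.X (qshift N : Submodule _ (κ × P → PowerSeries k)) :=
  fun _ hx c => h _ (hx c)

theorem qsat_qhead {J : Submodule (PowerSeries k) (κ × κ → PowerSeries k)}
    (h : qsat PowerSeries.X J) :
    qsat PowerSeries.X (qhead J : Submodule _ (κ × κ × P → PowerSeries k)) :=
  fun _ hx c => h _ (hx c)

theorem qsat_inf {N N' : Submodule (PowerSeries k) (P → PowerSeries k)}
    (h : qsat PowerSeries.X N) (h' : qsat PowerSeries.X N') : qsat PowerSeries.X (N ⊓ N') :=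
  fun _ hx => ⟨h _ hx.1, h' _ hx.2⟩

theorem qsat_qW {J : Submodule (PowerSeries k) (κ × κ → PowerSeries k)}
    (h : qsat PowerSeries.X J) : ∀ n, qsat PowerSeries.X (qW J n)
  | 0 => fun _ _ => trivial
  | 1 => fun _ _ => trivial
  | n+2 => qsat_inf (qsat_qhead h) (qsat_qshift (qsat_qW h (n+1)))

theorem qInto_qW {J : Submodule (PowerSeries k) (κ × κ → PowerSeries k)}
    {J' : Submodule k (κ × κ → k)} (h : qInto J J') : ∀ n, qInto (qW J n) (qW J' n)
  | 0 => fun _ _ => trivial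
  | 1 => fun _ _ => trivial
  | n+2 => fun _ hx => ⟨fun p => h _ (hx.1 p), fun c => qInto_qW h (n+1) _ (hx.2 c)⟩

theorem qsat_sum3 {J : Submodule (PowerSeries k) (κ × κ → PowerSeries k)}
    (h : qsat PowerSeries.X (qQ J 3)) :
    qsat PowerSeries.X (qhead J ⊔ qshift (qhead J) :
      Submodule _ (κ × κ × κ × P → PowerSeries k)) := by
  intro x hx
  obtain ⟨a, ha, b, hb, hab⟩ := Submodule.mem_sup.1 hx
  have key : ∀ p : P, ∃ a' b' : κ × κ × κ × Unit → PowerSeries k,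
      a' ∈ (qhead J : Submodule _ (κ × κ × κ × Unit → PowerSeries k)) ∧
      b' ∈ qshift (κ := κ) (qhead J : Submodule _ (κ × κ × Unit → PowerSeries k)) ∧
      a' + b' = fun q => x (q.1, q.2.1, q.2.2.1, p) := by
    intro p
    have h1 : (fun q : κ × κ × κ × Unit => x (q.1, q.2.1, q.2.2.1, p)) ∈ qQ J 3 := by
      apply h
      refine Submodule.mem_sup.2 ⟨fun q => a (q.1, q.2.1, q.2.2.1, p), ?_,
        fun q => b (q.1, q.2.1, q.2.2.1, p), ?_, ?_⟩
      · intro q; exact ha (q.1, p)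
      · intro c
        refine Submodule.mem_sup_left ?_
        intro q; exact hb c p
      · funext q; exact congrFun hab (q.1, q.2.1, q.2.2.1, p)
    obtain ⟨a', ha', b', hb', hab'⟩ := Submodule.mem_sup.1 h1
    refine ⟨a', b', ha', fun c => ?_, hab'⟩
    have h2 := hb' c
    obtain ⟨u, hu, v, hv, huv⟩ := Submodule.mem_sup.1 h2
    have hv0 : v = 0 := by
      funext q
      have := hv q.1
      exact congrFun ((Submodule.mem_bot _).1 this) q.2
    have huv' : u = fun w => b' (c, w) := by
      rw [← huv, hv0]; funext q; exact (add_zero _).symm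
    rw [← huv']; exact hu
  choose a' b' ha' hb' hab' using key
  refine Submodule.mem_sup.2 ⟨fun q => a' q.2.2.2 (q.1, q.2.1, q.2.2.1, ()), ?_,
    fun q => b' q.2.2.2 (q.1, q.2.1, q.2.2.1, ()), ?_, ?_⟩
  · intro q; exact ha' q.2 (q.1, ())
  · intro c p; exact hb' p c ()
  · funext q; exact congrFun (hab' q.2.2.2) (q.1, q.2.1, q.2.2.1, ())

theorem qlift_qshift {N : Submodule (PowerSeries k) (P → PowerSeries k)}
    {N' : Submodule k (P → k)} (h : qLifts N N') :
    qLifts (qshift N : Submodule _ (κ × P → PowerSeries k)) (qshift N') := by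
  intro x hx
  choose y hy hyx using fun c => h _ (hx c)
  exact ⟨fun q => y q.1 q.2, hy, funext fun q => congrFun (hyx q.1) q.2⟩

theorem qlift_qhead {J : Submodule (PowerSeries k) (κ × κ → PowerSeries k)}
    {J' : Submodule k (κ × κ → k)} (h : qLifts J J') :
    qLifts (qhead J : Submodule _ (κ × κ × P → PowerSeries k)) (qhead J') := by
  intro x hx
  choose y hy hyx using fun c => h _ (hx c)
  exact ⟨fun q => y q.2.2 (q.1, q.2.1), hy, funext fun q => congrFun (hyx q.2.2) (q.1, q.2.1)⟩

theorem qlift_sup {A B : Submodule (PowerSeries k) (P → PowerSeries k)}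
    {A' B' : Submodule k (P → k)} (h : qLifts A A') (h' : qLifts B B') :
    qLifts (A ⊔ B) (A' ⊔ B') := by
  intro x hx
  obtain ⟨a, ha, b, hb, rfl⟩ := Submodule.mem_sup.1 hx
  obtain ⟨a', ha', rfl⟩ := h a ha
  obtain ⟨b', hb', rfl⟩ := h' b hb
  exact ⟨a' + b', Submodule.add_mem_sup ha' hb', qred_add _ _⟩

theorem qlift_qQ {J : Submodule (PowerSeries k) (κ × κ → PowerSeries k)}
    {J' : Submodule k (κ × κ → k)} (h : qLifts J J') : ∀ n, qLifts (qQ J n) (qQ J' n)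
  | 0 => fun x hx => ⟨0, Submodule.zero_mem _, by
      rw [(Submodule.mem_bot _).1 hx]; ext; simp [qred]⟩
  | 1 => fun x hx => ⟨0, Submodule.zero_mem _, by
      rw [(Submodule.mem_bot _).1 hx]; ext; simp [qred]⟩
  | n+2 => qlift_sup (qlift_qhead h) (qlift_qshift (qlift_qQ h (n+1)))

theorem qproj {J : Submodule (PowerSeries k) (P → PowerSeries k)} (h : ∃ C, IsCompl J C) :
    ∃ π : (P → PowerSeries k) →ₗ[PowerSeries k] (P → PowerSeries k),
      (∀ x, π x ∈ J) ∧ ∀ x ∈ J, π x = x := by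
  obtain ⟨C, hC⟩ := h
  refine ⟨J.subtype ∘ₗ Submodule.projectionOnto J C hC, fun x => by simp, fun x hx => ?_⟩
  have := Submodule.projectionOnto_apply_left hC ⟨x, hx⟩
  exact congrArg Subtype.val this

theorem qproj_sum [Fintype P] [DecidableEq P]
    (π : (P → PowerSeries k) →ₗ[PowerSeries k] (P → PowerSeries k)) (u : P → PowerSeries k) (q : P) :
    π u q = ∑ e, u e * π (Pi.single e 1) q := by
  rw [LinearMap.pi_apply_eq_sum_univ π u, Finset.sum_apply]
  refine Finset.sum_congr rfl fun e _ => ?_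
  rw [Pi.smul_apply, smul_eq_mul]
  have : (fun j => if e = j then (1 : PowerSeries k) else 0) = Pi.single e 1 := by
    funext j; simp [Pi.single_apply, eq_comm]
  rw [this]

theorem qred_proj {J : Submodule (PowerSeries k) (P → PowerSeries k)} {J' : Submodule k (P → k)}
    (hl : qLifts J J')
    (π : (P → PowerSeries k) →ₗ[PowerSeries k] (P → PowerSeries k))
    (h2 : ∀ x ∈ J, π x = x) (u : P → PowerSeries k) (hu : qred u ∈ J') :
    qred (π u) = qred u := by
  obtain ⟨u', hu', he⟩ := hl _ hu
  obtain ⟨z, hz⟩ := qred_eq he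
  have : u = u' - (PowerSeries.X : PowerSeries k) • z := by rw [← hz]; abel
  rw [this, map_sub, map_smul, h2 u' hu', qred_sub, qred_sub, qred_X, qred_X]

theorem qlift_mixed [Fintype κ] {J : Submodule (PowerSeries k) (κ × κ → PowerSeries k)}
    {J' : Submodule k (κ × κ → k)} (hc : ∃ C, IsCompl J C) (hl : qLifts J J')
    {N : Submodule (PowerSeries k) (P → PowerSeries k)}
    {N' : Submodule k (P → k)} (h : qLifts N N') :
    qLifts (qshift (qshift N) ⊓ qhead J : Submodule _ (κ × κ × P → PowerSeries k))
      (qshift (qshift N') ⊓ qhead J') := by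
  classical
  obtain ⟨π, h1, h2⟩ := qproj hc
  rintro x ⟨hx1, hx2⟩
  obtain ⟨y, hy, rfl⟩ := qlift_qshift (κ := κ) (qlift_qshift (κ := κ) h) x hx1
  refine ⟨fun q => π (fun cd => y (cd.1, cd.2, q.2.2)) (q.1, q.2.1), ⟨?_, ?_⟩, ?_⟩
  · intro c d
    have : (fun w => π (fun cd => y (cd.1, cd.2, w)) (c, d)) =
        ∑ e : κ × κ, (π (Pi.single e 1) (c, d)) • (fun w => y (e.1, e.2, w)) := by
      funext w
      rw [qproj_sum, Finset.sum_apply]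
      exact Finset.sum_congr rfl fun e _ => mul_comm _ _
    change (fun w => π (fun cd => y (cd.1, cd.2, w)) (c, d)) ∈ N
    rw [this]
    exact N.sum_mem fun e _ => N.smul_mem _ (hy e.1 e.2)
  · intro p; exact h1 (fun cd => y (cd.1, cd.2, p))
  · funext q
    exact congrFun (qred_proj hl π h2 (fun cd => y (cd.1, cd.2, q.2.2)) (hx2 q.2.2)) (q.1, q.2.1)

theorem qlift_inf_of_distrib [Fintype P]
    {A B Y D : Submodule (PowerSeries k) (P → PowerSeries k)} {A' B' Y' : Submodule k (P → k)}
    (hAB : A ⊔ B = D)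
    (hYs : qsat PowerSeries.X Y) (hDs : qsat PowerSeries.X D)
    (hA : qInto A A') (hB : qInto B B') (hY : qInto Y Y')
    (hYA : qLifts (Y ⊓ A) (Y' ⊓ A')) (hYB : qLifts (Y ⊓ B) (Y' ⊓ B'))
    (hd : Y' ⊓ (A' ⊔ B') ≤ Y' ⊓ A' ⊔ Y' ⊓ B') :
    qLifts (Y ⊓ A ⊓ B) (Y' ⊓ A' ⊓ B') := by
  subst hAB
  have hN : Y ⊓ (A ⊔ B) ≤ Y ⊓ A ⊔ Y ⊓ B := by
    refine qnak _ _ (qsat_inf hYs hDs) (sup_le (inf_le_inf_left _ le_sup_left)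
      (inf_le_inf_left _ le_sup_right)) ?_
    rintro x ⟨hxY, hx⟩
    refine qlift_sup hYA hYB _ (hd ⟨hY x hxY, ?_⟩)
    obtain ⟨a, ha, b, hb, rfl⟩ := Submodule.mem_sup.1 hx
    rw [qred_add]
    exact Submodule.add_mem_sup (hA a ha) (hB b hb)
  rintro w ⟨⟨hwY, hwA⟩, hwB⟩
  obtain ⟨a, ha, haw⟩ := hYA w ⟨hwY, hwA⟩
  obtain ⟨b, hb, hbw⟩ := hYB w ⟨hwY, hwB⟩
  obtain ⟨u, hu⟩ := qred_eq (haw.trans hbw.symm)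
  have huN : u ∈ Y ⊓ (A ⊔ B) := by
    refine qsat_inf hYs hDs u ?_
    rw [← hu]
    exact ⟨Y.sub_mem ha.1 hb.1, Submodule.sub_mem _ (Submodule.mem_sup_left ha.2)
      (Submodule.mem_sup_right hb.2)⟩
  obtain ⟨u1, hu1, u2, hu2, rfl⟩ := Submodule.mem_sup.1 (hN huN)
  have he : a - (PowerSeries.X : PowerSeries k) • u1 = b + (PowerSeries.X : PowerSeries k) • u2 := by
    rw [smul_add] at hu
    rw [sub_eq_iff_eq_add, add_assoc, add_comm (_ • u2), ← hu]; abel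
  refine ⟨a - (PowerSeries.X : PowerSeries k) • u1,
    ⟨Submodule.sub_mem _ ha (Submodule.smul_mem _ _ hu1), ?_⟩, ?_⟩
  · rw [he]
    exact B.add_mem hb.2 (B.smul_mem _ hu2.2)
  · rw [qred_sub, qred_X, sub_zero, haw]

theorem qlift_qW [Fintype κ] {J : Submodule (PowerSeries k) (κ × κ → PowerSeries k)}
    {J' : Submodule k (κ × κ → k)} (hc : ∃ C, IsCompl J C) (hs : qsat PowerSeries.X J)
    (hl : qLifts J J') (hi : qInto J J')
    (h3 : qsat PowerSeries.X (qQ J 3))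
    (hd : ∀ n, (qshift (qshift (qW J' (n+1))) ⊓ (qhead J' ⊔ qshift (qhead J')) :
      Submodule k (κ × κ × QWord κ (n+1) → k)) ≤
        qshift (qshift (qW J' (n+1))) ⊓ qhead J' ⊔
        qshift (qshift (qW J' (n+1))) ⊓ qshift (qhead J')) :
    ∀ n, qLifts (qW J n) (qW J' n)
  | 0 => fun x _ => ⟨qlift x, trivial, qred_qlift x⟩
  | 1 => fun x _ => ⟨qlift x, trivial, qred_qlift x⟩
  | 2 => fun x hx => by
    obtain ⟨y, hy, e⟩ := qlift_qhead (P := QWord κ 0) hl x hx.1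
    exact ⟨y, ⟨hy, fun _ => trivial⟩, e⟩
  | n+3 => by
    have ih1 := qlift_qW hc hs hl hi h3 hd (n+1)
    have ih2 := qlift_qW hc hs hl hi h3 hd (n+2)
    have := qlift_inf_of_distrib (P := κ × κ × QWord κ (n+1))
      (Y := qshift (qshift (qW J (n+1)))) (A := qhead J)
      (B := qshift (qhead J (P := QWord κ n))) (A' := qhead J')
      (B' := qshift (qhead J' (P := QWord κ n))) (Y' := qshift (qshift (qW J' (n+1)))) rfl
      (qsat_qshift (qsat_qshift (qsat_qW hs _))) (qsat_sum3 h3)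
      (fun x hx p => hi _ (hx p)) (fun x hx c p => hi _ (hx c p))
      (fun x hx c d => qInto_qW hi _ _ (hx c d)) (qlift_mixed hc hl ih1)
      (by
        intro x hx
        obtain ⟨y, hy, e⟩ := qlift_qshift (κ := κ) ih2 x (fun c => ⟨hx.2 c, hx.1 c⟩)
        exact ⟨y, ⟨fun c => (hy c).2, fun c => (hy c).1⟩, e⟩)
      (hd n)
    intro x hx
    obtain ⟨y, hy, e⟩ := this x ⟨⟨fun c d => (hx.2 c).2 d, hx.1⟩, fun c => (hx.2 c).1⟩
    exact ⟨y, ⟨hy.1.2, fun c => ⟨hy.2 c, hy.1.1 c⟩⟩, e⟩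

theorem qred_dot [Fintype P] (x y : P → PowerSeries k) :
    PowerSeries.constantCoeff (∑ p, x p * y p) = ∑ p, qred x p * qred y p := by
  simp [qred, map_sum]

theorem qInto_perp [Fintype P] {N : Submodule (PowerSeries k) (P → PowerSeries k)}
    {N' : Submodule k (P → k)} (h : qLifts N N') : qInto (qperp N) (qperp N') := by
  intro x hx y hy
  obtain ⟨y', hy', rfl⟩ := h y hy
  rw [← qred_dot, hx y' hy', map_zero]

theorem qlift_perp [Fintype P] {J : Submodule (PowerSeries k) (P → PowerSeries k)}
    {J' : Submodule k (P → k)} (hc : ∃ C, IsCompl J C) (hi : qInto J J') :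
    qLifts (qperp J) (qperp J') := by
  classical
  obtain ⟨π, h1, h2⟩ := qproj hc
  intro x hx
  refine ⟨qlift x - fun e => ∑ f, qlift x f * π (Pi.single e 1) f, ?_, ?_⟩
  · intro y hy
    have hy' : ∀ f, y f = ∑ e, y e * π (Pi.single e 1) f := fun f => by
      rw [← qproj_sum, h2 y hy]
    simp only [Pi.sub_apply, sub_mul, Finset.sum_sub_distrib]
    rw [sub_eq_zero]
    conv_lhs => enter [2, f]; rw [hy' f, Finset.mul_sum]
    rw [Finset.sum_comm]
    refine Finset.sum_congr rfl fun e _ => ?_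
    rw [Finset.sum_mul]
    exact Finset.sum_congr rfl fun f _ => by ring
  · rw [qred_sub, qred_qlift]
    convert sub_zero x using 2
    funext e
    change PowerSeries.constantCoeff (∑ f, qlift x f * π (Pi.single e 1) f) = 0
    rw [qred_dot, qred_qlift]
    exact hx _ (hi _ (h1 _))

theorem qsat_perp [Fintype P] (N : Submodule (PowerSeries k) (P → PowerSeries k)) :
    qsat PowerSeries.X (qperp N) := by
  intro x hx y hy
  have := hx y hy
  simp only [Pi.smul_apply, smul_eq_mul, mul_assoc, ← Finset.mul_sum] at this
  exact (mul_eq_zero.1 this).resolve_left PowerSeries.X_ne_zero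

theorem qmain [Fintype κ] {J : Submodule (PowerSeries k) (κ × κ → PowerSeries k)}
    {J' : Submodule k (κ × κ → k)} (hc : ∃ C, IsCompl J C) (hs : qsat PowerSeries.X J)
    (hl : qLifts J J') (hi : qInto J J')
    (h3 : qsat PowerSeries.X (qQ J 3))
    (hd : ∀ n, (qshift (qshift (qW J' (n+1))) ⊓ (qhead J' ⊔ qshift (qhead J')) :
      Submodule k (κ × κ × QWord κ (n+1) → k)) ≤
        qshift (qshift (qW J' (n+1))) ⊓ qhead J' ⊔
        qshift (qshift (qW J' (n+1))) ⊓ qshift (qhead J')) (n : ℕ) :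
    ∃ C, IsCompl (qQ (qperp J) n) C := by
  have : qQ (qperp J) n = qperp (qW J n) := by
    refine le_antisymm (qQ_le_qperp J n) (qnak _ _ (qsat_perp _) (qQ_le_qperp J n) ?_)
    intro x hx
    exact qlift_qQ (qlift_perp hc hi) n _
      (qperp_qW_field J' n (qInto_perp (qlift_qW hc hs hl hi h3 hd n) x hx))
  rw [this]
  exact qsat_exists_isCompl _ (qsat_perp _)

theorem qsat_of_isCompl {J : Submodule (PowerSeries k) (P → PowerSeries k)}
    (hc : ∃ C, IsCompl J C) : qsat PowerSeries.X J := by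
  obtain ⟨π, h1, h2⟩ := qproj hc
  intro x hx
  have h := h2 _ hx
  rw [map_smul] at h
  have : π x = x := by
    funext p
    exact mul_left_cancel₀ PowerSeries.X_ne_zero (congrFun h p)
  rw [← this]; exact h1 _

end Red

section Transfer

open Module

variable {S M : Type*} [CommRing S] [AddCommGroup M] [Module S M] {κ : Type} [Fintype κ]

noncomputable def qPhi (b : Basis κ S M) : ∀ n, (QWord κ n → S) →ₗ[S] TensorAlgebra S M
  | 0 => Algebra.linearMap S (TensorAlgebra S M) ∘ₗ LinearMap.proj ()
  | n+1 => ∑ c, LinearMap.mulLeft S (TensorAlgebra.ι S (b c)) ∘ₗ qPhi b n ∘ₗ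
      LinearMap.funLeft S S (fun w : QWord κ n => ((c, w) : κ × QWord κ n))

theorem qPhi_succ (b : Basis κ S M) (n : ℕ) (x : QWord κ (n+1) → S) :
    qPhi b (n+1) x = ∑ c, TensorAlgebra.ι S (b c) * qPhi b n (fun w => x (c, w)) := by
  simp only [qPhi, LinearMap.sum_apply]
  rfl

def qword {κ : Type} : ∀ n, QWord κ n → FreeMonoid κ
  | 0, _ => 1
  | n+1, w => FreeMonoid.of w.1 * qword n w.2

theorem qword_inj : ∀ n, Function.Injective (qword (κ := κ) n)
  | 0 => fun _ _ _ => rfl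
  | n+1 => fun x y h => by
    have h' : (x.1 :: FreeMonoid.toList (qword n x.2)) = y.1 :: FreeMonoid.toList (qword n y.2) := h
    injection h' with h1 h2
    exact Prod.ext h1 (qword_inj n h2)

theorem qbasis_mul (b : Basis κ S M) (c : κ) (w : FreeMonoid κ) :
    b.tensorAlgebra (FreeMonoid.of c * w) = TensorAlgebra.ι S (b c) * b.tensorAlgebra w := by
  have h1 : (MonoidAlgebra.single (FreeMonoid.of c * w) (1 : S)) =
      MonoidAlgebra.single (FreeMonoid.of c) 1 * MonoidAlgebra.single w 1 := by
    rw [MonoidAlgebra.single_mul_single, one_mul]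
  have h2 : FreeAlgebra.equivMonoidAlgebraFreeMonoid.symm
      (MonoidAlgebra.single (FreeMonoid.of c) (1 : S)) = FreeAlgebra.ι S c := by
    rw [AlgEquiv.symm_apply_eq]
    simp [FreeAlgebra.equivMonoidAlgebraFreeMonoid]
  simp only [Basis.tensorAlgebra, FreeAlgebra.basisFreeMonoid, Basis.map_apply]
  change (TensorAlgebra.equivFreeAlgebra b).symm (FreeAlgebra.equivMonoidAlgebraFreeMonoid.symm
      (MonoidAlgebra.single (FreeMonoid.of c * w) 1)) = TensorAlgebra.ι S (b c) *
      (TensorAlgebra.equivFreeAlgebra b).symm (FreeAlgebra.equivMonoidAlgebraFreeMonoid.symm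
        (MonoidAlgebra.single w 1))
  rw [h1, map_mul, map_mul, h2, TensorAlgebra.equivFreeAlgebra_symm_ι]

theorem qbasis_one (b : Basis κ S M) : b.tensorAlgebra (1 : FreeMonoid κ) = 1 := by
  simp [Basis.tensorAlgebra, FreeAlgebra.basisFreeMonoid]
  rfl

theorem qPhi_eq (b : Basis κ S M) : ∀ n (x : QWord κ n → S),
    qPhi b n x = ∑ w, x w • b.tensorAlgebra (qword n w)
  | 0, x => by
    change algebraMap S _ (x ()) = ∑ w : Unit, x w • b.tensorAlgebra (qword 0 w)
    rw [Fintype.sum_unique]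
    change _ = x () • b.tensorAlgebra 1
    rw [qbasis_one, Algebra.algebraMap_eq_smul_one]
  | n+1, x => by
    rw [qPhi_succ]
    refine Eq.trans ?_ (Fintype.sum_prod_type (γ := TensorAlgebra S M) (α₁ := κ)
      (α₂ := QWord κ n) (fun w => x w • b.tensorAlgebra (qword (n+1) w))).symm
    refine Finset.sum_congr rfl fun c _ => ?_
    rw [qPhi_eq b n, Finset.mul_sum]
    refine Finset.sum_congr rfl fun w _ => ?_
    change _ = _ • b.tensorAlgebra (FreeMonoid.of c * qword n w)
    rw [qbasis_mul, mul_smul_comm]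

theorem qPhi_inj (b : Basis κ S M) (n : ℕ) : Function.Injective (qPhi b n) := by
  rw [← LinearMap.ker_eq_bot, LinearMap.ker_eq_bot']
  intro x hx
  rw [qPhi_eq] at hx
  have := (b.tensorAlgebra.linearIndependent.comp _ (qword_inj n))
  rw [Fintype.linearIndependent_iff] at this
  exact funext (this x hx)

theorem qdeg1_mul (b : Basis κ S M) (n : ℕ) (N : Submodule S (QWord κ n → S)) :
    deg1 S M * N.map (qPhi b n) = Submodule.map (qPhi b (n+1)) (qshift N) := by
  apply le_antisymm
  · rw [Submodule.mul_le]
    rintro _ ⟨v, rfl⟩ _ ⟨x, hx, rfl⟩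
    refine ⟨fun q => b.repr v q.1 * x q.2, fun c => N.smul_mem (b.repr v c) hx, ?_⟩
    rw [qPhi_succ]
    conv_rhs => rw [← b.sum_repr v, map_sum, Finset.sum_mul]
    refine Finset.sum_congr rfl fun c _ => ?_
    change _ * qPhi b n (b.repr v c • x) = _
    rw [map_smul, map_smul, mul_smul_comm, smul_mul_assoc]
  · rintro _ ⟨x, hx, rfl⟩
    rw [qPhi_succ]
    exact Submodule.sum_mem _ fun c _ => Submodule.mul_mem_mul ⟨_, rfl⟩ ⟨_, hx c, rfl⟩

theorem qdeg1_pow (b : Basis κ S M) : ∀ n, deg1 S M ^ n = Submodule.map (qPhi b n) ⊤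
  | 0 => by
    rw [pow_zero]
    ext x
    simp only [Submodule.mem_one, Submodule.mem_map, Submodule.mem_top, true_and]
    constructor
    · rintro ⟨y, rfl⟩; exact ⟨fun _ => y, rfl⟩
    · rintro ⟨y, rfl⟩; exact ⟨y (), rfl⟩
  | n+1 => by
    rw [pow_succ', qdeg1_pow b n, qdeg1_mul]
    congr 1
    exact eq_top_iff.2 fun _ _ _ => trivial

/-- coordinates on `M ⊗ M` -/
noncomputable def qco (b : Basis κ S M) : M ⊗[S] M ≃ₗ[S] (κ × κ → S) :=
  (b.tensorProduct b).equivFun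

theorem qco_symm (b : Basis κ S M) (y : κ × κ → S) :
    (qco b).symm y = ∑ c, ∑ d, y (c, d) • (b c ⊗ₜ[S] b d) := by
  rw [qco, Basis.equivFun_symm_apply, Fintype.sum_prod_type]
  simp [Basis.tensorProduct_apply]

noncomputable def qC (b : Basis κ S M) (J : Submodule S (M ⊗[S] M)) : Submodule S (κ × κ → S) :=
  J.comap (qco b).symm.toLinearMap

theorem qPhi_head (b : Basis κ S M) (n : ℕ) (y : κ × κ → S) (z : QWord κ n → S) :
    qPhi b (n+2) (fun q : κ × κ × QWord κ n => y (q.1, q.2.1) * z q.2.2) =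
      mul2 S M ((qco b).symm y) * qPhi b n z := by
  rw [qPhi_succ, qco_symm, map_sum, Finset.sum_mul]
  refine Finset.sum_congr rfl fun c _ => ?_
  rw [qPhi_succ, map_sum, Finset.sum_mul, Finset.mul_sum]
  refine Finset.sum_congr rfl fun d _ => ?_
  change _ * (_ * qPhi b n (y (c, d) • z)) = _
  rw [map_smul, map_smul]
  simp [mul2, mul_assoc]

theorem qposSub_zero (b : Basis κ S M) (J : Submodule S (M ⊗[S] M)) (n : ℕ) :
    posSub S M J 0 n = Submodule.map (qPhi b (n+2)) (qhead (qC b J)) := by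
  classical
  rw [posSub, pow_zero, one_mul, qdeg1_pow b]
  apply le_antisymm
  · rw [Submodule.mul_le]
    rintro _ ⟨t, ht, rfl⟩ _ ⟨z, -, rfl⟩
    refine ⟨fun q : κ × κ × QWord κ n => qco b t (q.1, q.2.1) * z q.2.2, fun p => ?_, ?_⟩
    · have : (fun cd : κ × κ => qco b t (cd.1, cd.2) * z p) = z p • qco b t := by
        funext cd; exact mul_comm _ _
      change (fun cd : κ × κ => qco b t (cd.1, cd.2) * z p) ∈ qC b J
      rw [this]
      refine Submodule.smul_mem _ _ ?_
      change (qco b).symm (qco b t) ∈ J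
      rwa [LinearEquiv.symm_apply_apply]
    · rw [qPhi_head, LinearEquiv.symm_apply_apply]
  · rintro _ ⟨x, hx, rfl⟩
    have hx' : x = ∑ p : QWord κ n, (fun q : κ × κ × QWord κ n =>
        (fun cd : κ × κ => x (cd.1, cd.2, p)) (q.1, q.2.1) * (Pi.single p 1 : QWord κ n → S) q.2.2) := by
      funext q
      rw [Finset.sum_apply, Finset.sum_eq_single q.2.2]
      · simp
      · intro p _ hp
        simp [Pi.single_apply, hp.symm]
      · simp
    rw [hx', map_sum]
    refine Submodule.sum_mem _ fun p _ => ?_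
    have := qPhi_head b n (fun cd : κ × κ => x (cd.1, cd.2, p)) (Pi.single p 1)
    rw [this]
    exact Submodule.mul_mem_mul ⟨_, hx p, rfl⟩ ⟨_, trivial, rfl⟩

theorem qposSub_succ (J : Submodule S (M ⊗[S] M)) (a n : ℕ) :
    posSub S M J (a+1) n = deg1 S M * posSub S M J a n := by
  simp only [posSub, pow_succ', mul_assoc]

theorem qposSub_pow (J : Submodule S (M ⊗[S] M)) (a n : ℕ) :
    posSub S M J a n = deg1 S M ^ a * posSub S M J 0 n := by
  simp only [posSub, pow_zero, one_mul, mul_assoc]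

theorem qsum_range (b : Basis κ S M) (J : Submodule S (M ⊗[S] M)) : ∀ n,
    ∑ i ∈ Finset.range (n+1), posSub S M J i (n - i) =
      Submodule.map (qPhi b (n+2)) (qQ (qC b J) (n+2))
  | 0 => by
    rw [Finset.sum_range_one, qposSub_zero b]
    congr 1
    refine le_antisymm le_sup_left (sup_le le_rfl ?_)
    intro x hx
    have : x = 0 := funext fun q => congrFun ((Submodule.mem_bot _).1 (hx q.1)) q.2
    rw [this]; exact Submodule.zero_mem _
  | n+1 => by
    rw [Finset.sum_range_succ']
    have : ∀ i ∈ Finset.range (n+1), posSub S M J (i+1) (n+1-(i+1)) =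
        deg1 S M * posSub S M J i (n - i) := by
      intro i _
      rw [qposSub_succ, Nat.add_sub_add_right]
    rw [Finset.sum_congr rfl this, ← Finset.mul_sum, qsum_range b J n, qdeg1_mul]
    change _ = Submodule.map (qPhi b (n+3)) (qhead (qC b J) ⊔ qshift (qQ (qC b J) (n+2)))
    rw [Submodule.map_sup, ← qposSub_zero b J (n+1), add_comm]
    rfl

theorem qsum_Icc (b : Basis κ S M) (J : Submodule S (M ⊗[S] M)) (m : ℕ) (hm : 2 ≤ m) :
    ∑ i ∈ Finset.Icc 1 (m - 1), posSub S M J (i - 1) (m - 1 - i) =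
      Submodule.map (qPhi b m) (qQ (qC b J) m) := by
  obtain ⟨n, rfl⟩ := Nat.exists_eq_add_of_le' hm
  rw [← qsum_range b J n]
  symm
  refine Finset.sum_bij (fun i _ => i + 1) ?_ ?_ ?_ ?_
  · intro i hi; simp at hi ⊢; omega
  · intro i _ j _ h; simpa using h
  · intro i hi
    simp at hi
    exact ⟨i - 1, by simp; omega, by omega⟩
  · intro i hi
    congr 1
    omega

theorem qinf_pow (b : Basis κ S M) : ∀ (a n : ℕ) (A B : Submodule S (QWord κ n → S)),
    deg1 S M ^ a * (A ⊓ B).map (qPhi b n) =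
      deg1 S M ^ a * A.map (qPhi b n) ⊓ deg1 S M ^ a * B.map (qPhi b n)
  | 0, n, A, B => by
    simp only [pow_zero, one_mul]
    exact Submodule.map_inf _ (qPhi_inj b n)
  | a+1, n, A, B => by
    simp only [pow_succ, mul_assoc, qdeg1_mul]
    rw [qshift_inf]
    exact qinf_pow b a (n+1) _ _

theorem qgen (b : Basis κ S M) (J : Submodule S (M ⊗[S] M)) : ∀ (n a m : ℕ), n + 2 + a = m →
    LatticeGen {p | ∃ i, 1 ≤ i ∧ i ≤ m - 1 ∧ p = posSub S M J (i - 1) (m - 1 - i)}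
      (deg1 S M ^ a * (qW (qC b J) (n+2)).map (qPhi b (n+2)))
  | 0, a, m, h => by
    refine LatticeGen.base ⟨a + 1, by omega, by omega, ?_⟩
    have h1 : m - 1 - (a+1) = 0 := by omega
    rw [h1, Nat.add_sub_cancel, qposSub_pow, qposSub_zero b]
    congr 2
    exact le_antisymm inf_le_left (le_inf le_rfl fun _ _ _ => trivial)
  | n+1, a, m, h => by
    change LatticeGen _ (deg1 S M ^ a * Submodule.map (qPhi b (n+3))
      (qhead (qC b J) ⊓ qshift (qW (qC b J) (n+2))))
    rw [qinf_pow]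
    refine LatticeGen.inf (LatticeGen.base ⟨a + 1, by omega, by omega, ?_⟩) ?_
    · have h1 : m - 1 - (a+1) = n + 1 := by omega
      rw [h1, Nat.add_sub_cancel, qposSub_pow, qposSub_zero b]
    · have := qgen b J n (a+1) m (by omega)
      rw [pow_succ, mul_assoc, qdeg1_mul] at this
      exact this

end Transfer

theorem qkoszul {k V : Type*} [Field k] [AddCommGroup V] [Module k V] {κ : Type} [Fintype κ]
    (b : Module.Basis κ k V) (I : Submodule k (V ⊗[k] V)) (hK : KoszulQuadratic k V I) :
    ∀ n, (qshift (qshift (qW (qC b I) (n+1))) ⊓ (qhead (qC b I) ⊔ qshift (qhead (qC b I))) :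
      Submodule k (κ × κ × QWord κ (n+1) → k)) ≤
        qshift (qshift (qW (qC b I) (n+1))) ⊓ qhead (qC b I) ⊔
        qshift (qshift (qW (qC b I) (n+1))) ⊓ qshift (qhead (qC b I))
  | 0 => by
    have : (qshift (qshift (qW (qC b I) (0+1))) : Submodule k (κ × κ × QWord κ 1 → k)) = ⊤ :=
      eq_top_iff.2 fun _ _ _ _ => trivial
    rw [this]; simp
  | n+1 => by
    have e0 := qgen b I n 2 (n+4) (by omega)
    rw [pow_two, mul_assoc, qdeg1_mul, qdeg1_mul] at e0
    have e1 : LatticeGen {p | ∃ i, 1 ≤ i ∧ i ≤ n+4 - 1 ∧ p = posSub k V I (i - 1) (n+4 - 1 - i)}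
        (Submodule.map (qPhi b (n+4)) (qhead (qC b I))) := by
      rw [← qposSub_zero b I (n+2)]
      exact LatticeGen.base ⟨1, by omega, by omega, rfl⟩
    have e2 : LatticeGen {p | ∃ i, 1 ≤ i ∧ i ≤ n+4 - 1 ∧ p = posSub k V I (i - 1) (n+4 - 1 - i)}
        (Submodule.map (qPhi b (n+4)) (qshift (qhead (P := QWord κ (n+1)) (qC b I)))) := by
      rw [← qdeg1_mul, ← qposSub_zero b I (n+1), ← qposSub_succ]
      exact LatticeGen.base ⟨2, by omega, by omega, rfl⟩
    have h := hK (n+4) _ _ _ e0 e1 e2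
    rw [← Submodule.map_sup, ← Submodule.map_inf _ (qPhi_inj b (n+4)),
      ← Submodule.map_inf _ (qPhi_inj b (n+4)), ← Submodule.map_inf _ (qPhi_inj b (n+4)),
      ← Submodule.map_sup] at h
    exact (Submodule.map_injective_of_injective (qPhi_inj b (n+4)) h).le

theorem qC_isCompl {S M : Type*} [CommRing S] [AddCommGroup M] [Module S M] {κ : Type} [Fintype κ]
    (b : Module.Basis κ S M) (J : Submodule S (M ⊗[S] M)) :
    (∃ C, IsCompl J C) ↔ ∃ C, IsCompl (qC b J) C := by
  let e : Submodule S (κ × κ → S) ≃o Submodule S (M ⊗[S] M) :=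
    Submodule.orderIsoMapComap (qco b).symm
  have he : e (qC b J) = J := e.apply_symm_apply J
  constructor
  · rintro ⟨C, hC⟩
    refine ⟨e.symm C, ?_⟩
    rw [e.isCompl_iff, he, e.apply_symm_apply]; exact hC
  · rintro ⟨C, hC⟩
    refine ⟨e C, ?_⟩
    rw [e.isCompl_iff, he] at hC; exact hC

theorem qsummand_iff {S M : Type*} [CommRing S] [AddCommGroup M] [Module S M] {κ : Type}
    [Fintype κ] (b : Module.Basis κ S M) (J : Submodule S (M ⊗[S] M)) (m : ℕ) (hm : 2 ≤ m) :
    IsSummandIn S (∑ i ∈ Finset.Icc 1 (m - 1), posSub S M J (i - 1) (m - 1 - i)) (deg1 S M ^ m) ↔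
      ∃ C, IsCompl (qQ (qC b J) m) C := by
  rw [qsum_Icc b J m hm, qdeg1_pow b]
  have hinj := Submodule.map_injective_of_injective (qPhi_inj b m)
  constructor
  · rintro ⟨C, hC, h1, h2⟩
    obtain ⟨C', rfl⟩ : ∃ C', Submodule.map (qPhi b m) C' = C :=
      ⟨C.comap (qPhi b m), by
        rw [Submodule.map_comap_eq, inf_eq_right, ← Submodule.map_top]; exact hC⟩
    refine ⟨C', ?_⟩
    rw [isCompl_iff, disjoint_iff, codisjoint_iff]
    constructor
    · apply hinj
      rw [Submodule.map_inf _ (qPhi_inj b m), h1, Submodule.map_bot]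
    · apply hinj
      rw [Submodule.map_sup, h2]
  · rintro ⟨C, hC⟩
    rw [isCompl_iff, disjoint_iff, codisjoint_iff] at hC
    refine ⟨C.map (qPhi b m), Submodule.map_mono le_top, ?_, ?_⟩
    · rw [← Submodule.map_inf _ (qPhi_inj b m), hC.1, Submodule.map_bot]
    · rw [← Submodule.map_sup, hC.2]

theorem qC_dual {S M M' : Type*} [CommRing S] [AddCommGroup M] [Module S M]
    [AddCommGroup M'] [Module S M'] {κ : Type} [Fintype κ] [DecidableEq κ]
    (b : Module.Basis κ S M) (b' : Module.Basis κ S M') (f : M' →ₗ[S] Module.Dual S M)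
    (hf : ∀ c d, f (b' c) (b d) = if c = d then 1 else 0) (J : Submodule S (M ⊗[S] M)) :
    qC b' (Submodule.comap (TensorProduct.dualDistrib S M M ∘ₗ TensorProduct.map f f)
      J.dualAnnihilator) = qperp (qC b J) := by
  have key : ∀ x y : κ × κ → S,
      TensorProduct.dualDistrib S M M (TensorProduct.map f f ((qco b').symm x)) ((qco b).symm y)
        = ∑ p, x p * y p := by
    intro x y
    rw [qco_symm, qco_symm, Fintype.sum_prod_type]
    simp only [map_sum, LinearMap.sum_apply, map_smul, LinearMap.smul_apply,
      TensorProduct.map_tmul, TensorProduct.dualDistrib_apply, hf, smul_eq_mul]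
    refine Finset.sum_congr rfl fun c _ => Finset.sum_congr rfl fun d _ => ?_
    rw [Finset.sum_eq_single c, Finset.sum_eq_single d]
    · simp [mul_comm]
    · intro d' _ h; simp [h]
    · simp
    · intro c' _ h; simp [h]
    · simp
  ext x
  rw [mem_qperp]
  constructor
  · intro h y hy
    rw [← key]
    exact (Submodule.mem_dualAnnihilator _).1 h _ hy
  · intro h
    refine (Submodule.mem_dualAnnihilator _).2 fun t ht => ?_
    have := h (qco b t) (by
      change (qco b).symm (qco b t) ∈ J
      rwa [LinearEquiv.symm_apply_apply])
    rw [← key, LinearEquiv.symm_apply_apply] at this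
    exact this

theorem qco_up2 {k W : Type*} [Field k] [AddCommGroup W] [Module k W] {κ : Type} [Fintype κ]
    (b : Module.Basis κ k W) (x : κ × κ → k) :
    up2 k W ((qco b).symm x) =
      (qco (Module.Basis.baseChange (PowerSeries k) b)).symm (qlift x) := by
  rw [qco_symm, qco_symm, map_sum]
  refine Finset.sum_congr rfl fun c _ => ?_
  rw [map_sum]
  refine Finset.sum_congr rfl fun d _ => ?_
  rw [map_smul]
  simp only [up2, TensorProduct.lift.tmul, LinearMap.mk₂_apply, Module.Basis.baseChange_apply,
    qlift]
  rw [← algebraMap_smul (PowerSeries k) (x (c, d))]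
  rfl

theorem qred_iff_aux {k T T' : Type*} [Field k] [AddCommGroup T'] [Module k T'] {P : Type}
    [AddCommGroup T] [Module (PowerSeries k) T]
    (e : T ≃ₗ[PowerSeries k] (P → PowerSeries k)) (e' : T' ≃ₗ[k] (P → k)) (u : T' → T)
    (hup : ∀ t, e (u t) = qlift (e' t))
    (J : Submodule k T') (Jh : Submodule (PowerSeries k) T) :
    (Jh ⊔ Submodule.map ((PowerSeries.X : PowerSeries k) • LinearMap.id) ⊤ =
    Submodule.span (PowerSeries k) (u '' (J : Set T')) ⊔
      Submodule.map ((PowerSeries.X : PowerSeries k) • LinearMap.id) ⊤) ↔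
    qInto (Jh.comap e.symm.toLinearMap) (J.comap e'.symm.toLinearMap) ∧
    qLifts (Jh.comap e.symm.toLinearMap) (J.comap e'.symm.toLinearMap) := by
  have hX : ∀ t, t ∈ Submodule.map ((PowerSeries.X : PowerSeries k) • LinearMap.id)
      (⊤ : Submodule (PowerSeries k) T) ↔ qred (e t) = 0 := by
    intro t
    constructor
    · rintro ⟨s, -, rfl⟩
      rw [LinearMap.smul_apply, LinearMap.id_apply, map_smul, qred_X]
    · intro h
      obtain ⟨z, hz⟩ := qred_eq_zero h
      refine ⟨e.symm z, trivial, ?_⟩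
      rw [LinearMap.smul_apply, LinearMap.id_apply, ← map_smul, ← hz,
        LinearEquiv.symm_apply_apply]
  have hmem : ∀ x, x ∈ J.comap e'.symm.toLinearMap ↔ e'.symm x ∈ J := fun _ => Iff.rfl
  have hspan : ∀ t ∈ Submodule.span (PowerSeries k) (u '' (J : Set T')),
      qred (e t) ∈ J.comap e'.symm.toLinearMap := by
    intro t ht
    induction ht using Submodule.span_induction with
    | mem t ht =>
      obtain ⟨s, hs, rfl⟩ := ht
      rw [hup, qred_qlift, hmem, LinearEquiv.symm_apply_apply]; exact hs
    | zero => rw [map_zero]; convert (J.comap e'.symm.toLinearMap).zero_mem; ext; simp [qred]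
    | add s t _ _ hs ht => rw [map_add, qred_add]; exact Submodule.add_mem _ hs ht
    | smul r t _ ht =>
      rw [map_smul]
      have : qred (r • e t) = PowerSeries.constantCoeff r • qred (e t) := by
        ext; simp [qred]
      rw [this]; exact Submodule.smul_mem _ _ ht
  constructor
  · intro h
    constructor
    · intro x hx
      have h1 : e.symm x ∈ Submodule.span (PowerSeries k) (u '' (J : Set T')) ⊔
        Submodule.map ((PowerSeries.X : PowerSeries k) • LinearMap.id) ⊤ := by
        rw [← h]; exact Submodule.mem_sup_left hx
      obtain ⟨s, hs, t, ht, hst⟩ := Submodule.mem_sup.1 h1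
      have h2 : x = e s + e t := by rw [← map_add, hst, LinearEquiv.apply_symm_apply]
      rw [h2, qred_add, (hX t).1 ht, add_zero]
      exact hspan s hs
    · intro x hx
      have h1 : u (e'.symm x) ∈
          Jh ⊔ Submodule.map ((PowerSeries.X : PowerSeries k) • LinearMap.id) ⊤ := by
        rw [h]
        exact Submodule.mem_sup_left (Submodule.subset_span ⟨_, hx, rfl⟩)
      obtain ⟨s, hs, t, ht, hst⟩ := Submodule.mem_sup.1 h1
      refine ⟨e s, ?_, ?_⟩
      · change e.symm (e s) ∈ Jh
        rwa [LinearEquiv.symm_apply_apply]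
      · have h2 := congrArg (fun t => qred (e t)) hst
        simp only [hup, map_add, qred_add, (hX t).1 ht, qred_qlift, add_zero,
          LinearEquiv.apply_symm_apply] at h2
        exact h2
  · rintro ⟨hi, hl⟩
    apply le_antisymm
    · refine sup_le ?_ le_sup_right
      intro t ht
      have h1 : qred (e t) ∈ J.comap e'.symm.toLinearMap := hi _ (by
        change e.symm (e t) ∈ Jh
        rwa [LinearEquiv.symm_apply_apply])
      rw [← add_sub_cancel (u (e'.symm (qred (e t)))) t]
      refine Submodule.add_mem_sup (Submodule.subset_span ⟨_, h1, rfl⟩) ?_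
      rw [hX, map_sub, qred_sub, hup, LinearEquiv.apply_symm_apply, qred_qlift, sub_self]
    · refine sup_le ?_ le_sup_right
      rw [Submodule.span_le]
      rintro _ ⟨t, ht, rfl⟩
      obtain ⟨y, hy, hyt⟩ := hl (e' t) (by
        rw [hmem, LinearEquiv.symm_apply_apply]; exact ht)
      rw [SetLike.mem_coe, ← add_sub_cancel (e.symm y) (u t)]
      refine Submodule.add_mem_sup hy ?_
      rw [hX, map_sub, qred_sub, hup, LinearEquiv.apply_symm_apply, qred_qlift, hyt, sub_self]


theorem qred_iff {k W : Type*} [Field k] [AddCommGroup W] [Module k W] {κ : Type} [Fintype κ]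
    (b : Module.Basis κ k W) (J : Submodule k (W ⊗[k] W))
    (Jh : Submodule (PowerSeries k)
      ((PowerSeries k ⊗[k] W) ⊗[PowerSeries k] (PowerSeries k ⊗[k] W))) :
    (Jh ⊔ Submodule.map ((PowerSeries.X : PowerSeries k) • LinearMap.id) ⊤ =
    Submodule.span (PowerSeries k) (up2 k W '' (J : Set (W ⊗[k] W))) ⊔
      Submodule.map ((PowerSeries.X : PowerSeries k) • LinearMap.id) ⊤) ↔
    qInto (qC (Module.Basis.baseChange (PowerSeries k) b) Jh) (qC b J) ∧
    qLifts (qC (Module.Basis.baseChange (PowerSeries k) b) Jh) (qC b J) := by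
  refine qred_iff_aux (qco (Module.Basis.baseChange (PowerSeries k) b)) (qco b) (up2 k W) ?_ J Jh
  intro t
  have := qco_up2 b (qco b t)
  rw [LinearEquiv.symm_apply_apply] at this
  rw [this, LinearEquiv.apply_symm_apply]

/-- Proposition 1.2: if `(V, I)` is a Koszul quadratic algebra and `I_ħ` is a deformation
of it over `R = k[[ħ]]`, then the dual submodule
`I*_ħ = {λ ∈ V*_R ⊗ V*_R : λ(I_ħ) = 0}` is a deformation of the dual quadratic algebra
`(V*, I*)`, where `I* = {λ ∈ V* ⊗ V* : λ(I) = 0}`. -/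
theorem dual_deformation_of_koszul
    {k V : Type*} [Field k] [CharZero k] [AddCommGroup V] [Module k V]
    [FiniteDimensional k V]
    (I : Submodule k (V ⊗[k] V)) (hK : KoszulQuadratic k V I)
    (Ih : Submodule (PowerSeries k)
      ((PowerSeries k ⊗[k] V) ⊗[PowerSeries k] (PowerSeries k ⊗[k] V)))
    (hdef : IsQuadraticDeformation k V I Ih) :
    IsQuadraticDeformation k (Module.Dual k V)
      (Submodule.comap (TensorProduct.dualDistrib k V V) I.dualAnnihilator)
      (Submodule.comap
        (TensorProduct.dualDistrib (PowerSeries k) (PowerSeries k ⊗[k] V)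
            (PowerSeries k ⊗[k] V) ∘ₗ
          TensorProduct.map (dualUp k V) (dualUp k V))
        Ih.dualAnnihilator) := by
  let b := Module.finBasis k V
  let bR := Module.Basis.baseChange (PowerSeries k) b
  let bd := b.dualBasis
  let bdR := Module.Basis.baseChange (PowerSeries k) bd
  obtain ⟨h1, h2, h3⟩ := hdef
  rw [qred_iff b] at h2
  obtain ⟨hi, hl⟩ := h2
  have hc : ∃ C, IsCompl (qC bR Ih) C := (qC_isCompl bR Ih).1 h1
  have hs := qsat_of_isCompl hc
  have h3' : qsat PowerSeries.X (qQ (qC bR Ih) 3) :=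
    qsat_of_isCompl ((qsummand_iff bR Ih 3 (by norm_num)).1 (h3 3 (by norm_num)))
  have hmain := qmain hc hs hl hi h3' (qkoszul b I hK)
  have ek : qC bd (Submodule.comap (TensorProduct.dualDistrib k V V) I.dualAnnihilator) =
      qperp (qC b I) := by
    have := qC_dual b bd LinearMap.id (fun c d => by simp [bd, Finsupp.single_apply, eq_comm]) I
    rwa [TensorProduct.map_id, LinearMap.comp_id] at this
  have eR := qC_dual bR bdR (dualUp k V) (fun c d => by
    simp [bdR, bd, bR, dualUp, Finsupp.single_apply, eq_comm]) Ih
  refine ⟨?_, ?_, ?_⟩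
  · rw [qC_isCompl bdR, eR]
    exact qsat_exists_isCompl _ (qsat_perp _)
  · rw [qred_iff bd, ek, eR]
    exact ⟨qInto_perp hl, qlift_perp hc hi⟩
  · intro m hm
    rw [qsummand_iff bdR _ m hm, eR]
    exact hmain m
end
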